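/- Let 𝓜 = {m ∈ ℝ : m > 0 and X_m admits a heteroclinic connection}. Then 𝓜 is a nonempty finite set contained in the open interval (0.547, 0.6), and for every m ∈ 𝓜 the system X_m has no periodic orbit. -/

import Mathlib

open Real Filter Set

noncomputable section

/-- Bacciotti's system `X_m(x,y) = (y³ − x³, −x + m·y⁵)`. -/
def bacciotti (m : ℝ) (p : ℝ × ℝ) : ℝ × ℝ :=
  (p.2 ^ 3 - p.1 ^ 3, -p.1 + m * p.2 ^ 5)

/-- A (global) solution of Bacciotti's system. -/
def IsSolution (m : ℝ) (γ : ℝ → ℝ × ℝ) : Prop :=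
  ∀ t : ℝ, HasDerivAt γ (bacciotti m (γ t)) t

/-- A periodic orbit: a nonconstant `T`-periodic solution with `T > 0`. -/
def IsPeriodicOrbit (m : ℝ) (γ : ℝ → ℝ × ℝ) (T : ℝ) : Prop :=
  IsSolution m γ ∧ (¬ ∃ c : ℝ × ℝ, ∀ t, γ t = c) ∧ 0 < T ∧ Function.Periodic γ T

/-- The saddle point `p_m^+ = (m^{−1/4}, m^{−1/4})`. -/
def pPlus (m : ℝ) : ℝ × ℝ := (m ^ (-(1 : ℝ) / 4), m ^ (-(1 : ℝ) / 4))

/-- The saddle point `p_m^− = (−m^{−1/4}, −m^{−1/4})`. -/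
def pMinus (m : ℝ) : ℝ × ℝ := (-(m ^ (-(1 : ℝ) / 4)), -(m ^ (-(1 : ℝ) / 4)))

/-- A heteroclinic connection from `p_m^−` to `p_m^+`. -/
def IsHeteroclinic (m : ℝ) (γ : ℝ → ℝ × ℝ) : Prop :=
  IsSolution m γ ∧ Tendsto γ atBot (nhds (pMinus m)) ∧ Tendsto γ atTop (nhds (pPlus m))

/-- The divergence of Bacciotti's system: `div X_m(x,y) = −3x² + 5m·y⁴`. -/
def divBacciotti (m : ℝ) (p : ℝ × ℝ) : ℝ :=
  -3 * p.1 ^ 2 + 5 * m * p.2 ^ 4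

/-- `T` is the minimal period of `γ`. -/
def IsMinimalPeriod (γ : ℝ → ℝ × ℝ) (T : ℝ) : Prop :=
  0 < T ∧ Function.Periodic γ T ∧ ∀ T' : ℝ, 0 < T' → Function.Periodic γ T' → T ≤ T'

section PolynomialLists

variable {α : Type}

/-- Coefficientwise sum of two coefficient lists. -/
def addL (add : α → α → α) : List α → List α → List α
  | [], l => l
  | a :: l, [] => a :: l
  | a :: l, b :: m => add a b :: addL add l m

/-- Product of two coefficient lists. -/
def mulL (add mul : α → α → α) (zero : α) : List α → List α → List α
  | [], _ => []
  | a :: l, m => addL add (m.map (mul a)) (zero :: mulL add mul zero l m)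

/-- Value at `x` of the polynomial with coefficients `l`, read through `φ`. -/
def evL (φ : α → ℝ) (x : ℝ) : List α → ℝ
  | [] => 0
  | a :: l => φ a + x * evL φ x l

/-- The binary form `∑ φ cₖ tᵏ sⁿ⁻ᵏ`. -/
def formL (φ : α → ℝ) (t s : ℝ) : ℕ → List α → ℝ
  | _, [] => 0
  | n, a :: l => φ a * s ^ n + t * formL φ t s (n - 1) l

/-- Coefficients of `(1 + z)ⁿ`. -/
def binomialL : ℕ → List ℤ
  | 0 => [1]
  | n + 1 => addL (· + ·) (binomialL n) (0 :: binomialL n)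

/-- Scaled Bernstein coefficients on `[0, 1]`. -/
def bernsteinL (add : α → α → α) (smul : ℤ → α → α) : List α → List α
  | [] => []
  | a :: l => addL add ((binomialL l.length).map fun c => smul c a)
      (smul 0 a :: bernsteinL add smul l)

/-- Coefficients, up to a power of `N`, of the polynomial composed with `(a + w t) / N`. -/
def rescaleL (add : α → α → α) (smul : ℤ → α → α) (a w N : ℤ) : List α → List α
  | [] => []
  | c :: l => addL add [smul (N ^ l.length) c]
      (addL add ((rescaleL add smul a w N l).map (smul a))
        (smul 0 c :: (rescaleL add smul a w N l).map (smul w)))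

variable {add mul : α → α → α} {smul : ℤ → α → α} {zero : α} {φ : α → ℝ}

theorem evL_addL (hadd : ∀ a b, φ (add a b) = φ a + φ b) (x : ℝ) :
    ∀ l m, evL φ x (addL add l m) = evL φ x l + evL φ x m
  | [], l => by simp [addL, evL]
  | a :: l, [] => by simp [addL, evL]
  | a :: l, b :: m => by
    simp only [addL, evL, hadd, evL_addL hadd x l m]; ring

theorem formL_addL (hadd : ∀ a b, φ (add a b) = φ a + φ b) (t s : ℝ) :
    ∀ n l m, formL φ t s n (addL add l m) = formL φ t s n l + formL φ t s n m
  | _, [], l => by simp [addL, formL]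
  | _, a :: l, [] => by simp [addL, formL]
  | n, a :: l, b :: m => by
    simp only [addL, formL, hadd, formL_addL hadd t s (n - 1) l m]; ring

theorem evL_map {β : Type} {ψ : β → ℝ} (x c : ℝ) (f : α → β) (h : ∀ a, ψ (f a) = c * φ a) :
    ∀ l : List α, evL ψ x (l.map f) = c * evL φ x l
  | [] => by simp [evL]
  | a :: l => by simp only [List.map, evL, h, evL_map x c f h l]; ring

theorem formL_map {β : Type} {ψ : β → ℝ} (t s c : ℝ) (f : α → β) (h : ∀ a, ψ (f a) = c * φ a) :
    ∀ (n : ℕ) (l : List α), formL ψ t s n (l.map f) = c * formL φ t s n l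
  | _, [] => by simp [formL]
  | n, a :: l => by simp only [List.map, formL, h, formL_map t s c f h (n - 1) l]; ring

theorem evL_mulL (hadd : ∀ a b, φ (add a b) = φ a + φ b) (hmul : ∀ a b, φ (mul a b) = φ a * φ b)
    (hzero : φ zero = 0) (x : ℝ) :
    ∀ l m, evL φ x (mulL add mul zero l m) = evL φ x l * evL φ x m
  | [], _ => by simp [mulL, evL]
  | a :: l, m => by
    simp only [mulL, evL, evL_addL hadd, evL_mulL hadd hmul hzero x l m, hzero,
      evL_map (φ := φ) (ψ := φ) x (φ a) (mul a) (hmul a)]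
    ring

theorem formL_succ (t s : ℝ) : ∀ (n : ℕ) (l : List α), l.length ≤ n + 1 →
    formL φ t s (n + 1) l = s * formL φ t s n l
  | _, [], _ => by simp [formL]
  | 0, [a], _ => by simp [formL]; ring
  | 0, a :: b :: l, h => by simp at h
  | n + 1, a :: l, h => by
    simp only [formL, Nat.add_sub_cancel]
    rw [formL_succ t s n l (by simpa using h)]; ring

theorem length_addL : ∀ l m : List α, (addL add l m).length = max l.length m.length
  | [], l => by simp [addL]
  | a :: l, [] => by simp [addL]
  | a :: l, b :: m => by simp [addL, length_addL l m]

theorem length_binomialL : ∀ n, (binomialL n).length = n + 1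
  | 0 => rfl
  | n + 1 => by simp [binomialL, length_addL, length_binomialL n]

theorem formL_binomialL (t s : ℝ) : ∀ n,
    formL (fun c : ℤ => (c : ℝ)) t s n (binomialL n) = (s + t) ^ n
  | 0 => by simp [binomialL, formL]
  | n + 1 => by
    rw [binomialL, formL_addL (by simp), formL_succ t s n _ (length_binomialL n).le]
    simp only [formL, Nat.add_sub_cancel, formL_binomialL t s n]
    push_cast; ring

theorem formL_bernsteinL (hadd : ∀ a b, φ (add a b) = φ a + φ b)
    (hsmul : ∀ c a, φ (smul c a) = c * φ a) {t s : ℝ} (hts : s + t = 1) :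
    ∀ l, formL φ t s (l.length - 1) (bernsteinL add smul l) = evL φ t l
  | [] => by simp [bernsteinL, formL, evL]
  | a :: l => by
    rw [bernsteinL, formL_addL hadd]
    simp only [List.length_cons, Nat.add_sub_cancel, formL, hsmul,
      formL_bernsteinL hadd hsmul hts l, evL]
    rw [formL_map (φ := fun c : ℤ => (c : ℝ)) (ψ := φ) t s (φ a) (fun c => smul c a)
      (fun c => by rw [hsmul, mul_comm]), formL_binomialL, hts]
    simp

theorem evL_rescaleL (hadd : ∀ a b, φ (add a b) = φ a + φ b)
    (hsmul : ∀ c a, φ (smul c a) = c * φ a) {a w N : ℤ} (hN : 0 < N) (t : ℝ) :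
    ∀ l, N * evL φ t (rescaleL add smul a w N l) =
      (N : ℝ) ^ l.length * evL φ ((a + w * t) / N) l
  | [] => by simp [rescaleL, evL]
  | c :: l => by
    have hN' : (N : ℝ) ≠ 0 := by exact_mod_cast hN.ne'
    have ih := evL_rescaleL hadd hsmul (a := a) (w := w) hN t l
    rw [rescaleL, evL_addL hadd, evL_addL hadd]
    simp only [evL, hsmul, evL_map (φ := φ) (ψ := φ) t a (smul a) (hsmul a),
      evL_map (φ := φ) (ψ := φ) t w (smul w) (hsmul w), List.length_cons]
    push_cast
    have : evL φ t (rescaleL add smul a w N l) =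
      (N : ℝ) ^ l.length * evL φ ((a + w * t) / N) l / N := by rw [← ih]; field_simp
    rw [this]
    field_simp
    ring

theorem formL_pos {t s : ℝ} (ht : 0 ≤ t) (hs : 0 ≤ s) (hts : s + t = 1) :
    ∀ (n : ℕ) (l : List α), l.length = n + 1 → (∀ a ∈ l, 0 < φ a) → 0 < formL φ t s n l
  | _, [], h, _ => by simp at h
  | 0, [a], _, h => by simpa [formL] using h
  | 0, a :: b :: l, h, _ => by simp at h
  | n + 1, a :: l, h, h' => by
    have h1 := formL_pos ht hs hts n l (by simpa using h) fun b hb => h' b (by simp [hb])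
    have h2 := h' a (by simp)
    simp only [formL, Nat.add_sub_cancel]
    rcases hs.eq_or_lt with h0 | h0
    · obtain rfl : t = 1 := by linarith
      subst h0
      simpa using h1
    · have := mul_nonneg ht h1.le
      have := mul_pos h2 (pow_pos h0 (n + 1))
      linarith

end PolynomialLists

/-- Integer polynomial expressions in two variables. -/
inductive PolyExpr
  | const (c : ℤ)
  | varX
  | varY
  | add (p q : PolyExpr)
  | mul (p q : PolyExpr)
  | pow (p : PolyExpr) (n : ℕ)

namespace PolyExpr

/-- Value at a real point. -/
def eval : PolyExpr → ℝ → ℝ → ℝ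
  | const c, _, _ => c
  | varX, x, _ => x
  | varY, _, y => y
  | add p q, x, y => p.eval x y + q.eval x y
  | mul p q, x, y => p.eval x y * q.eval x y
  | pow p n, x, y => p.eval x y ^ n

/-- Formal partial derivative in the first variable. -/
def derivX : PolyExpr → PolyExpr
  | const _ => const 0
  | varX => const 1
  | varY => const 0
  | add p q => add p.derivX q.derivX
  | mul p q => add (mul p.derivX q) (mul p q.derivX)
  | pow p n => mul (mul (const n) (pow p (n - 1))) p.derivX

/-- Formal partial derivative in the second variable. -/
def derivY : PolyExpr → PolyExpr
  | const _ => const 0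
  | varX => const 0
  | varY => const 1
  | add p q => add p.derivY q.derivY
  | mul p q => add (mul p.derivY q) (mul p q.derivY)
  | pow p n => mul (mul (const n) (pow p (n - 1))) p.derivY

/-- Substitution of expressions for the two variables. -/
def subst : PolyExpr → PolyExpr → PolyExpr → PolyExpr
  | const c, _, _ => const c
  | varX, a, _ => a
  | varY, _, b => b
  | add p q, a, b => add (p.subst a b) (q.subst a b)
  | mul p q, a, b => mul (p.subst a b) (q.subst a b)
  | pow p n, a, b => pow (p.subst a b) n

theorem eval_subst (a b : PolyExpr) (x y : ℝ) :
    ∀ p : PolyExpr, (p.subst a b).eval x y = p.eval (a.eval x y) (b.eval x y)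
  | const _ => rfl
  | varX => rfl
  | varY => rfl
  | add p q => by simp only [subst, eval, eval_subst a b x y p, eval_subst a b x y q]
  | mul p q => by simp only [subst, eval, eval_subst a b x y p, eval_subst a b x y q]
  | pow p n => by simp only [subst, eval, eval_subst a b x y p]

theorem hasDerivAt_comp {f g : ℝ → ℝ} {f' g' t : ℝ} (hf : HasDerivAt f f' t)
    (hg : HasDerivAt g g' t) : ∀ p : PolyExpr, HasDerivAt (fun τ => p.eval (f τ) (g τ))
      (p.derivX.eval (f t) (g t) * f' + p.derivY.eval (f t) (g t) * g') t
  | const c => by simpa [eval, derivX, derivY] using hasDerivAt_const t (c : ℝ)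
  | varX => by simpa [eval, derivX, derivY] using hf
  | varY => by simpa [eval, derivX, derivY] using hg
  | add p q => by
    refine ((hasDerivAt_comp hf hg p).add (hasDerivAt_comp hf hg q)).congr_deriv ?_
    simp only [eval, derivX, derivY]; ring
  | mul p q => by
    refine ((hasDerivAt_comp hf hg p).mul (hasDerivAt_comp hf hg q)).congr_deriv ?_
    simp only [eval, derivX, derivY]; ring
  | pow p n => by
    refine ((hasDerivAt_comp hf hg p).pow n).congr_deriv ?_
    simp only [eval, derivX, derivY]; push_cast; ring

theorem continuous_eval : ∀ p : PolyExpr, Continuous fun z : ℝ × ℝ => p.eval z.1 z.2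
  | const _ => continuous_const
  | varX => continuous_fst
  | varY => continuous_snd
  | add p q => (continuous_eval p).add (continuous_eval q)
  | mul p q => (continuous_eval p).mul (continuous_eval q)
  | pow p n => (continuous_eval p).pow n

/-- Coefficients: a list, indexed by the power of the first variable, of lists indexed by the
power of the second. -/
def coeffs : PolyExpr → List (List ℤ)
  | const c => [[c]]
  | varX => [[], [1]]
  | varY => [[0, 1]]
  | add p q => addL (addL (· + ·)) p.coeffs q.coeffs
  | mul p q => mulL (addL (· + ·)) (mulL (· + ·) (· * ·) 0) [] p.coeffs q.coeffs
  | pow p n => n.rec [[1]] fun _ r =>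
      mulL (addL (· + ·)) (mulL (· + ·) (· * ·) 0) [] p.coeffs r

theorem evL_coeffs (x y : ℝ) :
    ∀ p : PolyExpr, evL (evL (fun c : ℤ => (c : ℝ)) y) x p.coeffs = p.eval x y
  | const c => by simp [coeffs, evL, eval]
  | varX => by simp [coeffs, evL, eval]
  | varY => by simp [coeffs, evL, eval]
  | add p q => by
    rw [coeffs, evL_addL (evL_addL (by simp) y), evL_coeffs x y p, evL_coeffs x y q, eval]
  | mul p q => by
    rw [coeffs, evL_mulL (evL_addL (by simp) y) (evL_mulL (by simp) (by simp) (by simp) y)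
      (by simp [evL]), evL_coeffs x y p, evL_coeffs x y q, eval]
  | pow p n => by
    rw [eval, coeffs]
    induction n with
    | zero => simp [evL]
    | succ n ih =>
      simp only
      rw [evL_mulL (evL_addL (by simp) y) (evL_mulL (by simp) (by simp) (by simp) y)
        (by simp [evL]), ih, evL_coeffs x y p, pow_succ']

end PolyExpr

/-- A scheme for bisecting a rectangle. -/
inductive Bisection
  | leaf
  | splitX (l r : Bisection)
  | splitY (l r : Bisection)

/-- All Bernstein coefficients on `[a/N, (a+w)/N] × [b/K, (b+h)/K]` are positive. -/
def bernsteinPos (a w N b h K : ℤ) (p : List (List ℤ)) : Bool :=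
  let rows := bernsteinL (addL (· + ·)) (fun c => List.map (c * ·))
    (rescaleL (addL (· + ·)) (fun c => List.map (c * ·)) a w N p)
  rows.length == (rescaleL (addL (· + ·)) (fun c => List.map (c * ·)) a w N p).length - 1 + 1 &&
  rows.all fun row =>
    let r := rescaleL (· + ·) (· * ·) b h K row
    let cs := bernsteinL (· + ·) (· * ·) r
    cs.length == r.length - 1 + 1 && cs.all fun c => decide (0 < c)

/-- Certified positivity on a rectangle by bisection. -/
def bisectPos (p : List (List ℤ)) : Bisection → ℤ → ℤ → ℤ → ℤ → ℤ → ℤ → Bool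
  | .leaf, a, w, N, b, h, K => bernsteinPos a w N b h K p
  | .splitX l r, a, w, N, b, h, K =>
    bisectPos p l (2 * a) w (2 * N) b h K && bisectPos p r (2 * a + w) w (2 * N) b h K
  | .splitY l r, a, w, N, b, h, K =>
    bisectPos p l a w N (2 * b) h (2 * K) && bisectPos p r a w N (2 * b + h) h (2 * K)

theorem evL_pos_of_bernsteinPos {α : Type} {add : α → α → α} {smul : ℤ → α → α} {φ : α → ℝ}
    (hadd : ∀ a b, φ (add a b) = φ a + φ b) (hsmul : ∀ c a, φ (smul c a) = c * φ a)
    {a w N : ℤ} (hN : 0 < N) {t : ℝ} (h0 : 0 ≤ t) (h1 : t ≤ 1) {l : List α}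
    (hlen : (bernsteinL add smul (rescaleL add smul a w N l)).length =
      (rescaleL add smul a w N l).length - 1 + 1)
    (hpos : ∀ c ∈ bernsteinL add smul (rescaleL add smul a w N l), 0 < φ c) :
    0 < evL φ ((a + w * t) / N) l := by
  have hN' : (0 : ℝ) < N := by exact_mod_cast hN
  have h2 := formL_pos (φ := φ) h0 (sub_nonneg.2 h1) (by ring : (1 - t) + t = 1) _ _ hlen hpos
  rw [formL_bernsteinL hadd hsmul (by ring)] at h2
  have h3 := evL_rescaleL hadd hsmul (a := a) (w := w) hN t l
  have h4 : (0 : ℝ) < (N : ℝ) ^ l.length * evL φ ((a + w * t) / N) l := by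
    rw [← h3]; positivity
  exact pos_of_mul_pos_right h4 (by positivity)

theorem evL_smul (y : ℝ) (c : ℤ) (l : List ℤ) :
    evL (fun c : ℤ => (c : ℝ)) y (l.map (c * ·)) = c * evL (fun c : ℤ => (c : ℝ)) y l :=
  evL_map (φ := fun c : ℤ => (c : ℝ)) y c _ (by simp) l

theorem pos_of_bernsteinPos {a w N b h K : ℤ} (hN : 0 < N) (hK : 0 < K) {p : List (List ℤ)}
    (hp : bernsteinPos a w N b h K p = true) {t u : ℝ} (ht0 : 0 ≤ t) (ht1 : t ≤ 1)
    (hu0 : 0 ≤ u) (hu1 : u ≤ 1) :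
    0 < evL (evL (fun c : ℤ => (c : ℝ)) ((b + h * u) / K)) ((a + w * t) / N) p := by
  simp only [bernsteinPos, Bool.and_eq_true, beq_iff_eq, List.all_eq_true, decide_eq_true_eq] at hp
  refine evL_pos_of_bernsteinPos (evL_addL (by simp) _) (evL_smul _) hN ht0 ht1 hp.1 ?_
  intro row hrow
  obtain ⟨h1, h2⟩ := hp.2 row hrow
  exact evL_pos_of_bernsteinPos (by simp) (by simp) hK hu0 hu1 h1 (by simpa using h2)

theorem pos_of_bisectPos {p : List (List ℤ)} : ∀ (T : Bisection) {a w N b h K : ℤ},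
    0 < N → 0 < K → bisectPos p T a w N b h K = true → ∀ {t u : ℝ}, 0 ≤ t → t ≤ 1 → 0 ≤ u →
    u ≤ 1 → 0 < evL (evL (fun c : ℤ => (c : ℝ)) ((b + h * u) / K)) ((a + w * t) / N) p
  | .leaf, a, w, N, b, h, K, hN, hK, hp, t, u, ht0, ht1, hu0, hu1 =>
    pos_of_bernsteinPos hN hK hp ht0 ht1 hu0 hu1
  | .splitX l r, a, w, N, b, h, K, hN, hK, hp, t, u, ht0, ht1, hu0, hu1 => by
    have hN' : (0 : ℝ) < N := by exact_mod_cast hN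
    simp only [bisectPos, Bool.and_eq_true] at hp
    rcases le_total t (1 / 2) with h2 | h2
    · convert pos_of_bisectPos l (by linarith) hK hp.1 (t := 2 * t) (by linarith) (by linarith)
        hu0 hu1 using 1
      congr 1; push_cast; field_simp
    · convert pos_of_bisectPos r (by linarith) hK hp.2 (t := 2 * t - 1) (by linarith)
        (by linarith) hu0 hu1 using 1
      congr 1; push_cast; field_simp; ring
  | .splitY l r, a, w, N, b, h, K, hN, hK, hp, t, u, ht0, ht1, hu0, hu1 => by
    have hK' : (0 : ℝ) < K := by exact_mod_cast hK
    simp only [bisectPos, Bool.and_eq_true] at hp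
    rcases le_total u (1 / 2) with h2 | h2
    · convert pos_of_bisectPos l hN (by linarith) hp.1 ht0 ht1 (u := 2 * u) (by linarith)
        (by linarith) using 1
      congr 2; push_cast; field_simp
    · convert pos_of_bisectPos r hN (by linarith) hp.2 ht0 ht1 (u := 2 * u - 1) (by linarith)
        (by linarith) using 1
      congr 2; push_cast; field_simp; ring

theorem evL_eq_pow_mul_evL_drop {α : Type} {φ : α → ℝ} (x : ℝ) : ∀ (k : ℕ) (l : List α),
    (∀ a ∈ l.take k, φ a = 0) → evL φ x l = x ^ k * evL φ x (l.drop k)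
  | 0, l, _ => by simp
  | k + 1, [], _ => by simp [evL]
  | k + 1, a :: l, h => by
    rw [evL, h a (by simp), evL_eq_pow_mul_evL_drop x k l fun b hb => h b (by simp [hb])]
    simp only [List.drop_succ_cons]; ring

/-- The polynomial with coefficients `p` is divisible by `xᵏ`, and the quotient is certified
positive on `[0, 1] × [b, b + h]`. -/
def checkPosL (p : List (List ℤ)) (k : ℕ) (T : Bisection) (b h : ℤ) : Bool :=
  ((p.take k).all fun r => r.all fun c => decide (c = 0)) && bisectPos (p.drop k) T 0 1 1 b h 1

theorem evL_pos_of_checkPosL {p : List (List ℤ)} {k : ℕ} {T : Bisection} {b h : ℤ}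
    (hp : checkPosL p k T b h = true) {x u : ℝ} (hx0 : 0 ≤ x) (hxk : 0 < x ^ k) (hx1 : x ≤ 1)
    (hu0 : 0 ≤ u) (hu1 : u ≤ 1) :
    0 < evL (evL (fun c : ℤ => (c : ℝ)) (b + h * u)) x p := by
  simp only [checkPosL, Bool.and_eq_true, List.all_eq_true, decide_eq_true_eq] at hp
  have hzero : ∀ l : List ℤ, (∀ c ∈ l, c = 0) → ∀ y, evL (fun c : ℤ => (c : ℝ)) y l = 0 := by
    intro l
    induction l with
    | nil => simp [evL]
    | cons c l ih =>
      intro hl y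
      rw [evL, ih (fun d hd => hl d (by simp [hd])), hl c (by simp)]; simp
  rw [evL_eq_pow_mul_evL_drop x k _ fun r hr => hzero r (hp.1 r hr) _]
  have := pos_of_bisectPos T one_pos one_pos hp.2 hx0 hx1 hu0 hu1
  simp only [Int.cast_zero, Int.cast_one, zero_add, one_mul, div_one] at this
  positivity

/-- The quotient of `p` by `xᵏ` is certified positive on `[0, 1] × [b, b + h]`. -/
def PolyExpr.checkPos (p : PolyExpr) (k : ℕ) (T : Bisection) (b h : ℤ) : Bool :=
  checkPosL p.coeffs k T b h

theorem PolyExpr.eval_pos_of_checkPos {p : PolyExpr} {k : ℕ} {T : Bisection} {b h : ℤ}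
    (hp : p.checkPos k T b h = true) {x u : ℝ} (hx0 : 0 ≤ x) (hxk : 0 < x ^ k) (hx1 : x ≤ 1)
    (hu0 : 0 ≤ u) (hu1 : u ≤ 1) : 0 < p.eval x (b + h * u) := by
  rw [← PolyExpr.evL_coeffs]
  exact evL_pos_of_checkPosL hp hx0 hxk hx1 hu0 hu1

/-- One thousand times a barrier piece: the interpolation of the end values `a`, `b` plus
`t (1 - t)` times the polynomial with coefficients `q`, with `t` the first variable. -/
def barrierPiece (a b : ℤ) (q : List ℤ) : PolyExpr :=
  .add (.add (.const a) (.mul (.const (b - a)) .varX))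
    (.mul (.mul .varX (.add (.const 1) (.mul (.const (-1)) .varX)))
      (q.foldr (fun c p => .add (.const c) (.mul .varX p)) (.const 0)))

/-- The affine expression `c + w t`. -/
def affineX (c w : ℤ) : PolyExpr := .add (.const c) (.mul (.const w) .varX)

/-- A multiple of `e ((y⁵ - x) / y' - (σ / 40) (y³ - x³))`, for `1000 x = c + w t` and
`1000 y = N`. -/
def barrierDefect (e σ c w : ℤ) (N : PolyExpr) : PolyExpr :=
  .mul (.const e) (.add
    (.mul (.const (40 * w)) (.add (.pow N 5) (.mul (.const (-10 ^ 12)) (affineX c w))))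
    (.mul (.mul (.const (-σ * 10 ^ 6)) (.add (.pow N 3)
        (.mul (.const (-1)) (.pow (affineX c w) 3))))
      N.derivX))

def barrierCheck (e c w : ℤ) (k : ℕ) (N : PolyExpr) : Bool :=
  (barrierDefect e 53 c w N).checkPos k .leaf 0 0 &&
  (barrierDefect (-e) 54 c w N).checkPos k .leaf 0 0 &&
  (PolyExpr.mul (.const e) N.derivX).checkPos 0 .leaf 0 0

def barrier₁ : PolyExpr := barrierPiece (-1000) 34 [33, -324, 202, -366]
def barrier₂ : PolyExpr := barrierPiece 34 356 [-22, 22, 95, -51]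
def barrier₃ : PolyExpr := barrierPiece 356 726 [467, -550, 401, -125]
def barrier₄ : PolyExpr := barrierPiece 1000 726 [145, 90, -25, 290, -375, 245]

theorem barrierCheck₁ : barrierCheck 1 (-1000) 500 1 barrier₁ = true := by decide +kernel
theorem barrierCheck₂ : barrierCheck 1 (-500) 100 0 barrier₂ = true := by decide +kernel
theorem barrierCheck₃ : barrierCheck 1 (-400) 300 0 barrier₃ = true := by decide +kernel
theorem barrierCheck₄ : barrierCheck (-1) 1000 (-1100) 1 barrier₄ = true := by decide +kernel

/-- The polynomial with the monomials `c xⁱ yʲ`, for `(c, i, j)` in the list. -/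
def ofMonomials (l : List (ℤ × ℕ × ℕ)) : PolyExpr :=
  l.foldr (fun m p => .add (.mul (.const m.1) (.mul (.pow .varX m.2.1) (.pow .varY m.2.2))) p)
    (.const 0)

/-- The Dulac polynomial. -/
def dulac : PolyExpr := ofMonomials
  [(200, 2, 0), (135, 0, 4), (-264, 3, 1), (-245, 1, 5), (-1, 4, 0), (5, 2, 4), (17, 3, 3),
    (323, 4, 2), (-7, 5, 1), (3, 6, 0), (2, 0, 8), (-2, 1, 7), (313, 2, 6), (-90, 3, 5),
    (81, 4, 4), (-498, 5, 3), (148, 6, 2), (-1, 0, 10), (-4, 1, 9), (22, 2, 8), (-373, 3, 7),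
    (350, 4, 6)]

/-- A multiple of the Dulac expression for the system `((27 / 20) (y³ - x³), (c / a) y⁵ - x)`. -/
def dulacDefect (a c : ℤ) : PolyExpr :=
  .add
    (.mul (.const a) (.add
      (.mul (.mul (.const 81) dulac.derivX) (.add (.pow .varX 3)
          (.mul (.const (-1)) (.pow .varY 3))))
      (.add (.mul (.const 60) (.mul dulac.derivY .varX))
        (.mul (.const (-81)) (.mul dulac (.pow .varX 2))))))
    (.mul (.const c) (.add (.mul (.mul (.const (-60)) dulac.derivY) (.pow .varY 5))
      (.mul (.const 100) (.mul dulac (.pow .varY 4)))))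

/-- Prepend a coefficient, unless the result is zero. -/
def consTrim {α : Type} (zero : α → Bool) (a : α) (l : List α) : List α :=
  if zero a && l.isEmpty then [] else a :: l

/-- Remove trailing zeros. -/
def trimL (p : List (List ℤ)) : List (List ℤ) :=
  (p.map fun r => r.foldr (consTrim fun c => decide (c = 0)) []).foldr (consTrim List.isEmpty) []

/-- Pull-back under `(r, u) ↦ (r² u, r)`. -/
def chartY : List (List ℤ) → List (List ℤ)
  | [] => []
  | a :: l => addL (addL (· + ·)) (a.map fun c => [c])
      ([] :: [] :: (chartY l).map fun r => 0 :: r)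

/-- Pull-back of a polynomial in the second variable under `(r, u) ↦ (r², r u)`. -/
def chartRow : List ℤ → List (List ℤ)
  | [] => []
  | c :: l => [c] :: (chartRow l).map fun r => 0 :: r

/-- Pull-back under `(r, u) ↦ (r², r u)`. -/
def chartX : List (List ℤ) → List (List ℤ)
  | [] => []
  | a :: l => addL (addL (· + ·)) (chartRow a) ([] :: [] :: chartX l)

theorem evL_foldr_consTrim {α : Type} {φ : α → ℝ} {zero : α → Bool}
    (h : ∀ a, zero a = true → φ a = 0) (x : ℝ) :
    ∀ l : List α, evL φ x (l.foldr (consTrim zero) []) = evL φ x l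
  | [] => rfl
  | a :: l => by
    rw [List.foldr_cons, consTrim, evL, ← evL_foldr_consTrim h x l]
    split_ifs with h'
    · rw [Bool.and_eq_true, List.isEmpty_iff] at h'
      simp [evL, h a h'.1, h'.2]
    · rfl

theorem evL_trimL (x y : ℝ) (p : List (List ℤ)) :
    evL (evL (fun c : ℤ => (c : ℝ)) y) x (trimL p) = evL (evL (fun c : ℤ => (c : ℝ)) y) x p := by
  rw [trimL, evL_foldr_consTrim (by simp [evL]), evL_map (φ := evL (fun c : ℤ => (c : ℝ)) y) x 1,
    one_mul]
  intro r
  rw [evL_foldr_consTrim (by simp), one_mul]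

theorem evL_map_cons_zero (r u : ℝ) (l : List (List ℤ)) :
    evL (evL (fun c : ℤ => (c : ℝ)) u) r (l.map fun r => 0 :: r) =
      u * evL (evL (fun c : ℤ => (c : ℝ)) u) r l :=
  evL_map (φ := evL (fun c : ℤ => (c : ℝ)) u) r u _ (by simp [evL]) l

theorem evL_chartY (r u : ℝ) : ∀ p : List (List ℤ),
    evL (evL (fun c : ℤ => (c : ℝ)) u) r (chartY p) =
      evL (evL (fun c : ℤ => (c : ℝ)) r) (r ^ 2 * u) p
  | [] => rfl
  | a :: l => by
    rw [chartY, evL_addL (evL_addL (by simp) u), evL_map (φ := fun c : ℤ => (c : ℝ)) r 1 _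
      (by simp [evL])]
    simp only [evL, evL_map_cons_zero, evL_chartY r u l]
    ring

theorem evL_chartRow (r u : ℝ) : ∀ p : List ℤ,
    evL (evL (fun c : ℤ => (c : ℝ)) u) r (chartRow p) = evL (fun c : ℤ => (c : ℝ)) (r * u) p
  | [] => rfl
  | a :: l => by
    simp only [chartRow, evL, evL_map_cons_zero, evL_chartRow r u l]
    ring

theorem evL_chartX (r u : ℝ) : ∀ p : List (List ℤ),
    evL (evL (fun c : ℤ => (c : ℝ)) u) r (chartX p) =
      evL (evL (fun c : ℤ => (c : ℝ)) (r * u)) (r ^ 2) p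
  | [] => rfl
  | a :: l => by
    rw [chartX, evL_addL (evL_addL (by simp) u), evL_chartRow]
    simp only [evL, evL_chartX r u l]
    ring

/-- The polynomial composed with `(x, y) ↦ (-x, -y)`. -/
def PolyExpr.neg (p : PolyExpr) : PolyExpr :=
  p.subst (.mul (.const (-1)) .varX) (.mul (.const (-1)) .varY)

/-- Certified positivity of an even polynomial, away from the origin, on the square `[-1, 1]²`. -/
def checkSquare (p : PolyExpr) (k : ℕ) (T₁ T₂ : Bisection) : Bool :=
  decide (trimL p.neg.coeffs = trimL p.coeffs) &&
    (checkPosL (trimL (chartY p.coeffs)) k T₁ (-1) 2 &&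
      checkPosL (trimL (chartX p.coeffs)) k T₂ (-1) 2)

open Bisection in
theorem checkSquare_dulac : checkSquare dulac 4 (splitY leaf leaf) leaf = true := by
  decide +kernel

open Bisection in
theorem checkSquare_dulacDefect_left : checkSquare (dulacDefect 1 1) 8
    (splitY (splitX leaf (splitY leaf leaf)) (splitX leaf (splitX leaf leaf)))
    (splitY (splitX leaf (splitX leaf (splitY leaf leaf)))
      (splitX leaf (splitY leaf (splitX leaf leaf)))) = true := by
  decide +kernel

open Bisection in
theorem checkSquare_dulacDefect_right : checkSquare (dulacDefect 2809 2916) 8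
    (splitY (splitY leaf leaf) (splitX leaf (splitX leaf leaf)))
    (splitY (splitX leaf (splitX leaf (splitY leaf leaf)))
      (splitX leaf (splitY leaf leaf))) = true := by
  decide +kernel

theorem eval_pos_of_checkSquare {p : PolyExpr} {k : ℕ} {T₁ T₂ : Bisection}
    (hp : checkSquare p k T₁ T₂ = true) {x y : ℝ} (hx : |x| ≤ 1) (hy : |y| ≤ 1)
    (h0 : x ≠ 0 ∨ y ≠ 0) : 0 < p.eval x y := by
  simp only [checkSquare, Bool.and_eq_true, decide_eq_true_eq] at hp
  obtain ⟨hp0, hp1, hp2⟩ := hp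
  have heven : ∀ x y, p.eval (-x) (-y) = p.eval x y := by
    intro x y
    rw [← PolyExpr.evL_coeffs x y, ← evL_trimL, ← hp0, evL_trimL, PolyExpr.evL_coeffs,
      PolyExpr.neg, PolyExpr.eval_subst]
    simp [PolyExpr.eval]
  have hY : ∀ x y : ℝ, 0 < y → y ≤ 1 → |x| ≤ y ^ 2 → 0 < p.eval x y := by
    intro x y h0 h1 hxy
    have h2 : |x / y ^ 2| ≤ 1 := by
      rw [abs_div, abs_of_pos (pow_pos h0 2)]
      exact div_le_one_of_le₀ hxy (by positivity)
    obtain ⟨h3, h4⟩ := abs_le.1 h2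
    have := evL_pos_of_checkPosL hp1 h0.le (pow_pos h0 k) h1 (u := (1 + x / y ^ 2) / 2)
        (by linarith) (by linarith)
    rw [evL_trimL, evL_chartY, PolyExpr.evL_coeffs] at this
    convert this using 2
    push_cast
    field_simp
    ring
  have hX : ∀ x y : ℝ, 0 < x → x ≤ 1 → y ^ 2 ≤ x → 0 < p.eval x y := by
    intro x y h0 h1 hxy
    have h2 := Real.sqrt_pos.2 h0
    have h5 := Real.sq_sqrt h0.le
    have h6 := abs_le_of_sq_le_sq' (show (y / √x) ^ 2 ≤ 1 ^ 2 by
      rw [div_pow, h5, one_pow]; exact div_le_one_of_le₀ hxy h0.le) zero_le_one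
    have := evL_pos_of_checkPosL hp2 h2.le (pow_pos h2 k) (Real.sqrt_le_one.2 h1)
        (u := (1 + y / √x) / 2)
      (by linarith) (by linarith)
    rw [evL_trimL, evL_chartX, PolyExpr.evL_coeffs, h5] at this
    convert this using 2
    push_cast
    field_simp
    ring
  rcases le_or_gt |x| (y ^ 2) with h | h
  · rcases lt_trichotomy y 0 with h1 | rfl | h1
    · rw [← heven]
      exact hY _ _ (by linarith) (by linarith [(abs_le.1 hy).1]) (by simpa using h)
    · simp_all
    · exact hY _ _ h1 (abs_le.1 hy).2 h
  · rcases lt_trichotomy x 0 with h1 | rfl | h1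
    · rw [← heven]
      rw [abs_of_neg h1] at h
      exact hX _ _ (by linarith) (by linarith [(abs_le.1 hx).1]) (by simpa using h.le)
    · rw [abs_zero] at h; exact absurd h (not_lt.2 (sq_nonneg y))
    · rw [abs_of_pos h1] at h
      exact hX _ _ h1 (abs_le.1 hx).2 h.le

theorem dulac_pos {x y : ℝ} (hx : |x| ≤ 1) (hy : |y| ≤ 1) (h0 : x ≠ 0 ∨ y ≠ 0) :
    0 < dulac.eval x y :=
  eval_pos_of_checkSquare checkSquare_dulac hx hy h0

theorem dulac_defect {x y μ : ℝ} (hx : |x| ≤ 1) (hy : |y| ≤ 1) (h0 : x ≠ 0 ∨ y ≠ 0)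
    (h1 : 1 ≤ μ) (h2 : μ ≤ 2916 / 2809) :
    3 * (dulac.derivX.eval x y * (27 / 20 * (y ^ 3 - x ^ 3)) +
      dulac.derivY.eval x y * (μ * y ^ 5 - x)) <
      dulac.eval x y * (-(81 / 20) * x ^ 2 + 5 * μ * y ^ 4) := by
  have hl := eval_pos_of_checkSquare checkSquare_dulacDefect_left hx hy h0
  have hr := eval_pos_of_checkSquare checkSquare_dulacDefect_right hx hy h0
  simp only [dulacDefect, PolyExpr.eval] at hl hr
  push_cast at hl hr
  nlinarith [mul_nonneg (sub_nonneg.2 h1) hr.le, mul_nonneg (sub_nonneg.2 h2) hl.le]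

/-- The graph of a barrier piece. -/
def pieceFun (N : PolyExpr) (c w : ℤ) (x : ℝ) : ℝ := N.eval ((1000 * x - c) / w) 0 / 1000

/-- The slope of a barrier piece. -/
def pieceSlope (N : PolyExpr) (c w : ℤ) (x : ℝ) : ℝ := N.derivX.eval ((1000 * x - c) / w) 0 / w

/-- `x ↦ y` has slope `d` at `x`, strictly between the slopes prescribed by the scaled system for
`s = 27 / 20` and for `s = 53 / 40`. -/
def IsBarrierSlope (x y d : ℝ) : Prop :=
  0 < d ∧ 53 / 40 * (y ^ 3 - x ^ 3) * d < y ^ 5 - x ∧ y ^ 5 - x < 27 / 20 * (y ^ 3 - x ^ 3) * d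

theorem hasDerivAt_pieceFun (N : PolyExpr) (c : ℤ) {w : ℤ} (hw : w ≠ 0) (x : ℝ) :
    HasDerivAt (pieceFun N c w) (pieceSlope N c w x) x := by
  have hw' : (w : ℝ) ≠ 0 := by exact_mod_cast hw
  have h1 : HasDerivAt (fun x : ℝ => (1000 * x - c) / w) (1000 / w) x := by
    simpa using (((hasDerivAt_id x).const_mul 1000).sub_const (c : ℝ)).div_const (w : ℝ)
  refine ((PolyExpr.hasDerivAt_comp h1 (hasDerivAt_const x (0 : ℝ))
    N).div_const 1000).congr_deriv ?_
  rw [pieceSlope]; field_simp; ring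

theorem isBarrierSlope_of_check {e c w : ℤ} {k : ℕ} {N : PolyExpr}
    (h : barrierCheck e c w k N = true) (hw : 0 < e * w) {x : ℝ}
    (h0 : 0 ≤ (1000 * x - c) / w) (hk : 0 < ((1000 * x - c) / w) ^ k)
    (h1 : (1000 * x - c) / w ≤ 1) :
    IsBarrierSlope x (pieceFun N c w x) (pieceSlope N c w x) := by
  simp only [barrierCheck, Bool.and_eq_true] at h
  have hw' : (0 : ℝ) < e * w := by exact_mod_cast hw
  have hw0 : (w : ℝ) ≠ 0 := by rintro h; simp [h] at hw'
  have e0 := PolyExpr.eval_pos_of_checkPos h.1.1 h0 hk h1 le_rfl zero_le_one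
  have e1 := PolyExpr.eval_pos_of_checkPos h.1.2 h0 hk h1 le_rfl zero_le_one
  have e2 := PolyExpr.eval_pos_of_checkPos h.2 h0 (by simp) h1 le_rfl zero_le_one
  have hN : N.eval ((1000 * x - c) / w) 0 = 1000 * pieceFun N c w x := by rw [pieceFun]; ring
  have hN' : N.derivX.eval ((1000 * x - c) / w) 0 = w * pieceSlope N c w x := by
    rw [pieceSlope]; field_simp
  have hx : c + w * ((1000 * x - c) / w) = 1000 * x := by field_simp; ring
  simp only [barrierDefect, affineX, PolyExpr.eval, Int.cast_zero, mul_zero, add_zero, hN, hN']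
    at e0 e1 e2
  push_cast at e0 e1 e2
  rw [hx] at e0 e1
  set y := pieceFun N c w x
  set d := pieceSlope N c w x
  refine ⟨?_, ?_, ?_⟩
  · have : 0 < (e * w : ℝ) * d := by linarith
    exact pos_of_mul_pos_right this hw'.le
  · have : 0 < (e * w : ℝ) * (10 ^ 15 * 40 * (y ^ 5 - x - 53 / 40 * (y ^ 3 - x ^ 3) * d)) := by
      linarith
    have := pos_of_mul_pos_right this hw'.le
    linarith
  · have : 0 < (e * w : ℝ) * (10 ^ 15 * 40 * (27 / 20 * (y ^ 3 - x ^ 3) * d - (y ^ 5 - x))) := by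
      linarith
    have := pos_of_mul_pos_right this hw'.le
    linarith

/-- A strictly increasing curve from `(-1, -1)` to `(1, 1)` separating the invariant manifolds of
the scaled system, in opposite order for `s = 53 / 40` and `s = 27 / 20`. -/
def barrier (x : ℝ) : ℝ :=
  if x < -(1 / 2) then pieceFun barrier₁ (-1000) 500 x
  else if x < -(2 / 5) then pieceFun barrier₂ (-500) 100 x
  else if x < -(1 / 10) then pieceFun barrier₃ (-400) 300 x
  else pieceFun barrier₄ 1000 (-1100) x

theorem continuous_pieceFun (N : PolyExpr) (c : ℤ) {w : ℤ} (hw : w ≠ 0) :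
    Continuous (pieceFun N c w) :=
  continuous_iff_continuousAt.2 fun x => (hasDerivAt_pieceFun N c hw x).continuousAt

theorem continuous_barrier : Continuous barrier := by
  unfold barrier
  have c1 := continuous_pieceFun barrier₁ (-1000) (w := 500) (by norm_num)
  have c2 := continuous_pieceFun barrier₂ (-500) (w := 100) (by norm_num)
  have c3 := continuous_pieceFun barrier₃ (-400) (w := 300) (by norm_num)
  have c4 := continuous_pieceFun barrier₄ 1000 (w := -1100) (by norm_num)
  have aux : ∀ {f g : ℝ → ℝ} {a : ℝ}, Continuous f → Continuous g → f a = g a →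
      Continuous fun x => if x < a then f x else g x := by
    intro f g a hf hg hfg
    refine Continuous.if (fun x hx => ?_) hf hg
    have : x = a := by
      have h := frontier_lt_subset_eq continuous_id continuous_const hx
      simpa using h
    rw [this, hfg]
  refine aux c1 (aux c2 (aux c3 c4 ?_) ?_) ?_
  · norm_num [pieceFun, barrier₃, barrier₄, barrierPiece, PolyExpr.eval]
  · norm_num [pieceFun, barrier₃, barrier₂, barrierPiece, PolyExpr.eval]
  · norm_num [pieceFun, barrier₁, barrier₂, barrierPiece, PolyExpr.eval]

theorem barrier_neg_one : barrier (-1) = -1 := by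
  norm_num [barrier, pieceFun, barrier₁, barrierPiece, PolyExpr.eval]

theorem barrier_one : barrier 1 = 1 := by
  norm_num [barrier, pieceFun, barrier₄, barrierPiece, PolyExpr.eval]

theorem barrier_neg_half : barrier (-(1 / 2)) = 17 / 500 := by
  norm_num [barrier, pieceFun, barrier₂, barrierPiece, PolyExpr.eval]

theorem exists_barrier_slope {x : ℝ} (h1 : -1 < x) (h2 : x < 1) :
    ∃ d, IsBarrierSlope x (barrier x) d ∧ HasDerivWithinAt barrier d (Ici x) x := by
  have aux : ∀ {N : PolyExpr} {e c w : ℤ} {k : ℕ} {U : Set ℝ},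
      barrierCheck e c w k N = true → 0 < e * w → 0 ≤ (1000 * x - c) / w →
          0 < ((1000 * x - c) / w) ^ k →
      (1000 * x - c) / w ≤ 1 → U ∈ nhds x → EqOn barrier (pieceFun N c w) (U ∩ Ici x) →
      ∃ d, IsBarrierSlope x (barrier x) d ∧ HasDerivWithinAt barrier d (Ici x) x := by
    intro N e c w k U hc hw h0 hk h1 hU hEq
    have hx : barrier x = pieceFun N c w x := hEq ⟨mem_of_mem_nhds hU, self_mem_Ici⟩
    refine ⟨pieceSlope N c w x, hx ▸ isBarrierSlope_of_check hc hw h0 hk h1, ?_⟩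
    refine (hasDerivAt_pieceFun N c (by rintro rfl; simp at hw) x).hasDerivWithinAt.congr_of_eventuallyEq
      (Filter.eventuallyEq_of_mem (inter_mem (mem_nhdsWithin_of_mem_nhds hU) self_mem_nhdsWithin) hEq) hx
  rcases lt_or_ge x (-(1 / 2)) with h3 | h3
  · refine aux barrierCheck₁ (by norm_num) (by norm_num; linarith) (by norm_num; linarith)
        (by norm_num; linarith)
      (Iio_mem_nhds h3) fun z hz => ?_
    exact if_pos hz.1
  rcases lt_or_ge x (-(2 / 5)) with h4 | h4
  · refine aux barrierCheck₂ (by norm_num) ?_ (by simp) (by norm_num; linarith)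
      (Iio_mem_nhds h4) fun z hz => ?_
    · exact div_nonneg (by push_cast; linarith) (by norm_num)
    · rw [barrier, if_neg (not_lt.2 (h3.trans hz.2)), if_pos (mem_Iio.1 hz.1)]
  rcases lt_or_ge x (-(1 / 10)) with h5 | h5
  · refine aux barrierCheck₃ (by norm_num) ?_ (by simp) (by norm_num; linarith)
      (Iio_mem_nhds h5) fun z hz => ?_
    · exact div_nonneg (by push_cast; linarith) (by norm_num)
    · rw [barrier, if_neg (not_lt.2 (h3.trans hz.2)), if_neg (not_lt.2 (h4.trans hz.2)),
          if_pos (mem_Iio.1 hz.1)]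
  · refine aux barrierCheck₄ (by norm_num) ?_ ?_ ?_ univ_mem fun z hz => ?_
    · push_cast; rw [le_div_iff_of_neg (by norm_num)]; linarith
    · push_cast; rw [pow_one, lt_div_iff_of_neg (by norm_num)]; linarith
    · push_cast; rw [div_le_one_of_neg (by norm_num)]; linarith
    · rw [barrier, if_neg (not_lt.2 (h3.trans hz.2)), if_neg (not_lt.2 (h4.trans hz.2)),
        if_neg (not_lt.2 (h5.trans hz.2))]

/-- The slope of the orbits of the scaled system `(s (y³ - x³), y⁵ - x)`. -/
def orbitSlope (s x y : ℝ) : ℝ := (y ^ 5 - x) / (s * (y ^ 3 - x ^ 3))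

theorem cube_sub_pos {x y : ℝ} (h : x < y) : 0 < y ^ 3 - x ^ 3 :=
  sub_pos.2 (Odd.strictMono_pow (by decide) h)

theorem hasDerivAt_slope {s x y : ℝ} (hs : 0 < s) (h : x < y) :
    HasDerivAt (orbitSlope s x)
      (y ^ 2 * (2 * y ^ 5 - 5 * x ^ 3 * y ^ 2 + 3 * x) / (s * (y ^ 3 - x ^ 3) ^ 2)) y := by
  have h1 := cube_sub_pos h
  refine (((hasDerivAt_pow 5 y).sub_const x).div (((hasDerivAt_pow 3 y).sub_const
    (x ^ 3)).const_mul s) (by positivity)).congr_deriv ?_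
  field_simp
  push_cast
  ring

theorem slope_mono_right {s x y z : ℝ} (hs : 0 < s) (h0 : 0 < x) (h1 : x < 1) (hxy : x < y)
    (hyz : y ≤ z) : orbitSlope s x y ≤ orbitSlope s x z := by
  refine monotoneOn_of_deriv_nonneg (D := Ioi x) (convex_Ioi x)
    (fun y hy => (hasDerivAt_slope hs hy).continuousAt.continuousWithinAt)
    (fun y hy => (hasDerivAt_slope hs (by simpa using hy)).differentiableAt.differentiableWithinAt)
    (fun y hy => ?_) hxy (hxy.trans_le hyz) hyz
  rw [interior_Ioi] at hy
  have hxy : x < y := hy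
  rw [(hasDerivAt_slope hs hy).deriv]
  have h2 := cube_sub_pos hxy
  have : 0 ≤ 2 * y ^ 5 - 5 * x ^ 3 * y ^ 2 + 3 * x := by
    have e : 2 * y ^ 5 - 5 * x ^ 3 * y ^ 2 + 3 * x = (y - x) ^ 2 * (2 * y ^ 3 + 4 * x * y ^ 2 +
      6 * x ^ 2 * y + 3 * x ^ 3) + 3 * x * (1 - x ^ 4) := by ring
    rw [e]
    have : 0 ≤ 1 - x ^ 4 := sub_nonneg.2 (pow_le_one₀ h0.le h1.le)
    have : 0 < y := h0.trans hxy
    positivity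
  positivity

theorem slope_anti_left {s x y z : ℝ} (hs : 0 < s) (h0 : -1 < x) (h1 : x < 0) (hxy : x < y)
    (hyz : y ≤ z) (hz : z ≤ 0) : orbitSlope s x z ≤ orbitSlope s x y := by
  refine antitoneOn_of_deriv_nonpos (D := Ioc x 0) (convex_Ioc x 0)
    (fun y hy => (hasDerivAt_slope hs hy.1).continuousAt.continuousWithinAt)
    (fun y hy => (hasDerivAt_slope hs
      (interior_subset hy).1).differentiableAt.differentiableWithinAt)
    (fun y hy => ?_) ⟨hxy, hyz.trans hz⟩ ⟨hxy.trans_le hyz, hz⟩ hyz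
  obtain ⟨hxy, hy0⟩ := interior_subset hy
  rw [(hasDerivAt_slope hs hxy).deriv]
  have h2 := cube_sub_pos hxy
  have : 2 * y ^ 5 - 5 * x ^ 3 * y ^ 2 + 3 * x ≤ 0 := by
    have e : 2 * y ^ 5 - 5 * x ^ 3 * y ^ 2 + 3 * x = -((y - x) ^ 2 * (2 * (-y) ^ 3 +
      4 * (-x) * y ^ 2 + 6 * x ^ 2 * (-y) + 3 * (-x) ^ 3) + 3 * (-x) * (1 - x ^ 4)) := by ring
    rw [e, neg_nonpos]
    have : 0 ≤ 1 - x ^ 4 := by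
      have : x ^ 2 ≤ 1 := by nlinarith
      nlinarith [sq_nonneg x]
    have : 0 ≤ -y := by linarith
    have : 0 < -x := by linarith
    positivity
  exact div_nonpos_of_nonpos_of_nonneg (mul_nonpos_of_nonneg_of_nonpos (sq_nonneg y) this)
    (by positivity)

/-- If the gap `f - g` grows wherever it equals `κ`, it stays above `κ`. -/
theorem le_sub_of_deriv_right_lt {f g f' g' : ℝ → ℝ} {a b κ : ℝ} (hab : a ≤ b)
    (hf : ContinuousOn f (Icc a b)) (hg : ContinuousOn g (Icc a b))
    (hf' : ∀ x ∈ Ico a b, HasDerivWithinAt f (f' x) (Ici x) x)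
    (hg' : ∀ x ∈ Ico a b, HasDerivWithinAt g (g' x) (Ici x) x)
    (ha : κ ≤ f a - g a) (h : ∀ x ∈ Ico a b, f x - g x = κ → g' x < f' x) :
    κ ≤ f b - g b := by
  have := image_le_of_deriv_right_lt_deriv_boundary' (f := fun x => g x + κ) (f' := g')
    (hg.add continuousOn_const) (fun x hx => (hg' x hx).add_const κ) (B := f) (B' := f')
    (by linarith) hf hf' (fun x hx hx' => h x hx (by linarith)) ⟨hab, le_rfl⟩
  linarith

/-- A subsolution and a supersolution cannot both connect `(-1, -1)` to `(1, 1)`, if at every point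
one of them is strict. -/
theorem false_of_sub_super {s : ℝ} (hs : 0 < s) {f g f' g' : ℝ → ℝ}
    (hf : ContinuousOn f (Ioo (-1) 1)) (hg : ContinuousOn g (Ioo (-1) 1))
    (hf' : ∀ x ∈ Ioo (-1 : ℝ) 1, HasDerivWithinAt f (f' x) (Ici x) x)
    (hg' : ∀ x ∈ Ioo (-1 : ℝ) 1, HasDerivWithinAt g (g' x) (Ici x) x)
    (hxf : ∀ x ∈ Ioo (-1 : ℝ) 1, x < f x) (hxg : ∀ x ∈ Ioo (-1 : ℝ) 1, x < g x)
    (hfl : Tendsto f (nhdsWithin (-1) (Ioi (-1))) (nhds (-1)))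
    (hgl : Tendsto g (nhdsWithin (-1) (Ioi (-1))) (nhds (-1)))
    (hfr : Tendsto f (nhdsWithin 1 (Iio 1)) (nhds 1))
    (hgr : Tendsto g (nhdsWithin 1 (Iio 1)) (nhds 1))
    (hlt : ∀ x ∈ Ioo (-1 : ℝ) 1, orbitSlope s x (g x) ≤ orbitSlope s x (f x) → g' x < f' x) :
        False := by
  have persist : ∀ {a b κ : ℝ}, -1 < a → b < 1 → a ≤ b → κ ≤ f a - g a →
      (∀ x ∈ Ico a b, f x - g x = κ → orbitSlope s x (g x) ≤ orbitSlope s x (f x)) →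
          κ ≤ f b - g b := by
    intro a b κ ha hb hab hκ h
    have hsub : Icc a b ⊆ Ioo (-1) 1 := fun x hx => ⟨ha.trans_le hx.1, hx.2.trans_lt hb⟩
    have hsub' : Ico a b ⊆ Ioo (-1) 1 := Ico_subset_Icc_self.trans hsub
    exact le_sub_of_deriv_right_lt hab (hf.mono hsub) (hg.mono hsub) (fun x hx => hf' x (hsub' hx))
      (fun x hx => hg' x (hsub' hx)) hκ fun x hx hx' => hlt x (hsub' hx) (h x hx hx')
  have hl : Tendsto (fun x => f x - g x) (nhdsWithin (-1) (Ioi (-1))) (nhds 0) := by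
    simpa using hfl.sub hgl
  have hr : Tendsto (fun x => f x - g x) (nhdsWithin 1 (Iio 1)) (nhds 0) := by
    simpa using hfr.sub hgr
  obtain ⟨c, hc1, hc⟩ : ∃ c > (-1 : ℝ), ∀ x ∈ Ioo (-1) c, f x < 0 ∧ g x < 0 ∧ x < 0 := by
    have h1 := hfl.eventually (gt_mem_nhds (by norm_num : (-1 : ℝ) < 0))
    have h2 := hgl.eventually (gt_mem_nhds (by norm_num : (-1 : ℝ) < 0))
    have h3 := (eventually_lt_nhds (by norm_num : (-1 : ℝ) < 0)).filter_mono
      (nhdsWithin_le_nhds (s := Ioi (-1)))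
    obtain ⟨c, hc, h⟩ := mem_nhdsGT_iff_exists_Ioo_subset.1 (h1.and (h2.and h3))
    exact ⟨c, hc, fun x hx => h hx⟩
  have hneg : ∀ x ∈ Ioo (-1) c, 0 ≤ f x - g x := by
    intro x hx
    by_contra! hx0
    have hle : ∀ x₁ ∈ Ioo (-1) x, f x₁ - g x₁ ≤ f x - g x := by
      intro x₁ hx₁
      by_contra! h
      have hκ : f x - g x < min (f x₁ - g x₁) 0 := lt_min h hx0
      refine absurd (persist hx₁.1 (by linarith [(hc x hx).2.2]) hx₁.2.le (min_le_left _ 0) ?_)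
        (not_le.2 hκ)
      intro z hz hz'
      have hzc : z ∈ Ioo (-1) c := ⟨hx₁.1.trans_le hz.1, hz.2.trans hx.2⟩
      obtain ⟨-, h2, h3⟩ := hc z hzc
      exact slope_anti_left hs hzc.1 h3 (hxf z ⟨hzc.1, by linarith⟩)
        (by linarith [min_le_right (f x₁ - g x₁) 0]) h2.le
    have := le_of_tendsto hl (Filter.eventually_of_mem (Ioo_mem_nhdsGT hx.1) hle)
    linarith
  have hnonneg : ∀ x ∈ Ioo (-1 : ℝ) 1, 0 ≤ f x - g x := by
    intro x hx
    rcases lt_or_ge x c with h | h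
    · exact hneg x ⟨hx.1, h⟩
    · obtain ⟨a, ha⟩ := exists_between hc1
      refine persist ha.1 hx.2 (ha.2.le.trans h) (hneg a ha) fun z _ hz' => ?_
      rw [sub_eq_zero.1 hz']
  obtain ⟨a, ha, ha'⟩ : ∃ a ∈ Icc (1 / 3 : ℝ) (1 / 2), 0 < f a - g a := by
    by_contra! h
    have heq : ∀ x ∈ Icc (1 / 3 : ℝ) (1 / 2), f x = g x := fun x hx =>
      sub_eq_zero.1 (le_antisymm (h x hx)
        (hnonneg x ⟨by linarith [hx.1], by linarith [hx.2]⟩))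
    have h3 : (1 / 3 : ℝ) ∈ Ioo (-1 : ℝ) 1 := by norm_num
    have hev : f =ᶠ[nhdsWithin (1 / 3) (Ici (1 / 3))] g :=
      Filter.eventuallyEq_of_mem (Icc_mem_nhdsGE (by norm_num)) heq
    have h4 := (uniqueDiffWithinAt_Ici (1 / 3 : ℝ)).eq_deriv _ (hf' _ h3)
      ((hg' _ h3).congr_of_eventuallyEq hev (heq _ (by norm_num)))
    have := hlt _ h3 (by rw [heq _ (by norm_num)])
    linarith
  have hle : ∀ x ∈ Ioo a 1, f a - g a ≤ f x - g x := by
    intro x hx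
    refine persist (by linarith [ha.1]) hx.2 hx.1.le le_rfl fun z hz hz' => ?_
    have h1 : z < 1 := hz.2.trans hx.2
    have h0 : 0 < z := by linarith [hz.1, ha.1]
    exact slope_mono_right hs h0 h1 (hxg z ⟨by linarith, h1⟩) (by linarith)
  have := ge_of_tendsto hr (Filter.eventually_of_mem
    (Ioo_mem_nhdsLT (by linarith [ha.2] : a < 1)) hle)
  linarith

/-- The graph of `f` is an orbit of the scaled system connecting `(-1, -1)` to `(1, 1)`. -/
structure IsProfile (s : ℝ) (f : ℝ → ℝ) : Prop where
  lt : ∀ x ∈ Ioo (-1 : ℝ) 1, x < f x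
  lt_pow : ∀ x ∈ Ioo (-1 : ℝ) 1, x < f x ^ 5
  hasDerivAt : ∀ x ∈ Ioo (-1 : ℝ) 1, HasDerivAt f (orbitSlope s x (f x)) x
  tendsto_left : Tendsto f (nhdsWithin (-1) (Ioi (-1))) (nhds (-1))
  tendsto_right : Tendsto f (nhdsWithin 1 (Iio 1)) (nhds 1)

namespace IsProfile

variable {s : ℝ} {f : ℝ → ℝ}

theorem continuousOn (h : IsProfile s f) : ContinuousOn f (Ioo (-1) 1) :=
  fun x hx => (h.hasDerivAt x hx).continuousAt.continuousWithinAt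

theorem slope_pos (hs : 0 < s) (h : IsProfile s f) {x : ℝ} (hx : x ∈ Ioo (-1 : ℝ) 1) :
    0 < orbitSlope s x (f x) :=
  div_pos (sub_pos.2 (h.lt_pow x hx)) (mul_pos hs (cube_sub_pos (h.lt x hx)))

end IsProfile

theorem slope_mul (s x y : ℝ) : orbitSlope s x y = orbitSlope 1 x y / s := by
  rw [orbitSlope, orbitSlope, one_mul, mul_comm s, div_div]

theorem slope_lt_slope {s s' x y : ℝ} (hs : 0 < s) (h : s < s') (h0 : 0 < orbitSlope s x y) :
    orbitSlope s' x y < orbitSlope s x y := by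
  rw [slope_mul] at h0
  rw [slope_mul, slope_mul s]
  exact div_lt_div_of_pos_left (by rwa [div_pos_iff_of_pos_right hs] at h0) hs h

/-- A profile exists for at most one parameter. -/
theorem IsProfile.param_unique {s s' : ℝ} {f g : ℝ → ℝ} (hs : 0 < s) (hs' : 0 < s')
    (hf : IsProfile s f) (hg : IsProfile s' g) : s = s' := by
  have key : ∀ {s s' : ℝ} {f g : ℝ → ℝ}, 0 < s → 0 < s' → IsProfile s f → IsProfile s' g →
      ¬ s < s' := by
    intro s s' f g hs hs' hf hg h
    refine false_of_sub_super hs hf.continuousOn hg.continuousOn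
      (fun x hx => (hf.hasDerivAt x hx).hasDerivWithinAt)
      (fun x hx => (hg.hasDerivAt x hx).hasDerivWithinAt) hf.lt hg.lt hf.tendsto_left
      hg.tendsto_left hf.tendsto_right hg.tendsto_right fun x hx hle => ?_
    refine lt_of_lt_of_le (slope_lt_slope hs h ?_) hle
    have := hg.slope_pos hs' hx
    rw [slope_mul] at this ⊢
    exact div_pos ((div_pos_iff_of_pos_right hs').1 this) hs
  exact le_antisymm (not_lt.1 (key hs' hs hg hf)) (not_lt.1 (key hs hs' hf hg))

theorem IsBarrierSlope.lt {x y d : ℝ} (h : IsBarrierSlope x y d) : x < y := by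
  by_contra! hle
  have : y ^ 3 ≤ x ^ 3 := Odd.strictMono_pow (by decide) |>.monotone hle
  nlinarith [h.1, h.2.1, h.2.2, mul_nonneg (sub_nonneg.2 this) h.1.le]

theorem IsBarrierSlope.lt_slope {x y d : ℝ} (h : IsBarrierSlope x y d) :
    d < orbitSlope (53 / 40) x y := by
  have := cube_sub_pos h.lt
  rw [orbitSlope, lt_div_iff₀ (by positivity)]
  linarith [h.2.1]

theorem IsBarrierSlope.slope_lt {x y d : ℝ} (h : IsBarrierSlope x y d) :
    orbitSlope (27 / 20) x y < d := by
  have := cube_sub_pos h.lt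
  rw [orbitSlope, div_lt_iff₀ (by positivity)]
  linarith [h.2.2]

theorem barrier_tendsto_left : Tendsto barrier (nhdsWithin (-1) (Ioi (-1))) (nhds (-1)) := by
  simpa [barrier_neg_one] using (continuous_barrier.tendsto (-1)).mono_left nhdsWithin_le_nhds

theorem barrier_tendsto_right : Tendsto barrier (nhdsWithin 1 (Iio 1)) (nhds 1) := by
  simpa [barrier_one] using (continuous_barrier.tendsto 1).mono_left nhdsWithin_le_nhds

theorem IsProfile.param_mem {s : ℝ} {f : ℝ → ℝ} (hs : 0 < s) (hf : IsProfile s f) :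
    s ∈ Ioo (53 / 40 : ℝ) (27 / 20) := by
  have hb : ∀ x ∈ Ioo (-1 : ℝ) 1, ∃ d, IsBarrierSlope x (barrier x) d ∧
    HasDerivWithinAt barrier d (Ici x) x := fun x hx => exists_barrier_slope hx.1 hx.2
  choose! b' hb1 hb2 using hb
  have hpos : ∀ {σ x}, 0 < σ → x ∈ Ioo (-1 : ℝ) 1 → 0 < orbitSlope σ x (f x) := by
    intro σ x hσ hx
    exact div_pos (sub_pos.2 (hf.lt_pow x hx)) (mul_pos hσ (cube_sub_pos (hf.lt x hx)))
  refine ⟨?_, ?_⟩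
  · by_contra! h
    refine false_of_sub_super hs hf.continuousOn continuous_barrier.continuousOn
      (fun x hx => (hf.hasDerivAt x hx).hasDerivWithinAt) hb2 hf.lt (fun x hx => (hb1 x hx).lt)
      hf.tendsto_left barrier_tendsto_left hf.tendsto_right barrier_tendsto_right
      fun x hx hle => ?_
    refine lt_of_lt_of_le ((hb1 x hx).lt_slope.trans_le ?_) hle
    rcases h.eq_or_lt with rfl | h
    · exact le_rfl
    · have h1 := (hb1 x hx).1.trans (hb1 x hx).lt_slope
      refine (slope_lt_slope hs h ?_).le
      rw [slope_mul] at h1 ⊢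
      exact div_pos ((div_pos_iff_of_pos_right (by norm_num)).1 h1) hs
  · by_contra! h
    refine false_of_sub_super (by norm_num : (0 : ℝ) < 27 / 20) continuous_barrier.continuousOn
      hf.continuousOn hb2
      (fun x hx => (hf.hasDerivAt x hx).hasDerivWithinAt) (fun x hx => (hb1 x hx).lt) hf.lt
      barrier_tendsto_left hf.tendsto_left barrier_tendsto_right hf.tendsto_right
      fun x hx hle => ?_
    refine lt_of_le_of_lt (le_trans ?_ hle) (hb1 x hx).slope_lt
    rcases h.eq_or_lt with rfl | h
    · exact le_rfl
    · exact (slope_lt_slope (by norm_num) h (hpos (by norm_num) hx)).le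

/-- Solutions of `y' = σ Φ(x, y)` on a compact interval exist and depend continuously on `σ`. -/
theorem exists_solution_family {a b C y₀ : ℝ} {K : NNReal} {Φ : ℝ → ℝ → ℝ} (hab : a ≤ b)
    (hC : 0 ≤ C) (hlip : ∀ x ∈ Icc a b, LipschitzWith K (Φ x))
    (hcont : ∀ y, ContinuousOn (fun x => Φ x y) (Icc a b))
    (hbound : ∀ x ∈ Icc a b, ∀ y, |Φ x y| ≤ C) :
    ∃ y : ℝ → ℝ → ℝ, (∀ σ, y σ a = y₀) ∧
      (∀ σ, ∀ x ∈ Icc a b, HasDerivWithinAt (y σ) (σ * Φ x (y σ x)) (Icc a b) x) ∧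
      Continuous fun σ => y σ b := by
  have hlipσ : ∀ σ, ∀ x ∈ Icc a b, LipschitzWith (Real.nnabs σ * K) fun y => σ * Φ x y := by
    intro σ x hx
    refine LipschitzWith.of_dist_le_mul fun y z => ?_
    rw [Real.dist_eq, ← mul_sub, abs_mul, NNReal.coe_mul, Real.coe_nnabs, mul_assoc]
    exact mul_le_mul_of_nonneg_left ((hlip x hx).dist_le_mul y z) (abs_nonneg σ)
  have hex : ∀ σ, ∃ y : ℝ → ℝ, y a = y₀ ∧
      ∀ x ∈ Icc a b, HasDerivWithinAt y (σ * Φ x (y x)) (Icc a b) x := by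
    intro σ
    have hPL : IsPicardLindelof (fun x y => σ * Φ x y) (⟨a, le_rfl, hab⟩ : Icc a b) y₀
        (Real.nnabs σ * Real.toNNReal C * Real.toNNReal (b - a)) 0 (Real.nnabs σ * Real.toNNReal C)
        (Real.nnabs σ * K) := by
      refine ⟨fun x hx => (hlipσ σ x hx).lipschitzOnWith, fun y _ => (hcont y).const_mul σ,
        fun x hx y _ => ?_, ?_⟩
      · rw [norm_mul, Real.norm_eq_abs, Real.norm_eq_abs, NNReal.coe_mul, Real.coe_nnabs,
          Real.coe_toNNReal _ hC]
        exact mul_le_mul_of_nonneg_left (hbound x hx y) (abs_nonneg σ)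
      · simp [hab]
    exact hPL.exists_eq_forall_mem_Icc_hasDerivWithinAt₀
  choose y hy0 hy using hex
  refine ⟨y, hy0, hy, continuous_iff_continuousAt.2 fun σ => ?_⟩
  have hcy : ∀ τ, ContinuousOn (y τ) (Icc a b) := fun τ x hx => (hy τ x hx).continuousWithinAt
  have hIci : ∀ τ, ∀ x ∈ Ico a b, HasDerivWithinAt (y τ) (τ * Φ x (y τ x)) (Ici x) x :=
    fun τ x hx => (hy τ x (Ico_subset_Icc_self hx)).mono_of_mem_nhdsWithin (Icc_mem_nhdsGE_of_mem hx)
  have hd : ∀ τ, dist (y τ b) (y σ b) ≤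
      gronwallBound 0 (Real.nnabs σ * K : NNReal) (|τ - σ| * C + 0) (b - a) := by
    intro τ
    refine dist_le_of_approx_trajectories_ODE_of_mem (v := fun x y => σ * Φ x y)
      (s := fun _ => univ) (fun x hx => (hlipσ σ x (Ico_subset_Icc_self hx)).lipschitzOnWith)
      (hcy τ) (hIci τ) (fun x hx => ?_) (fun _ _ => trivial) (hcy σ) (hIci σ)
      (fun x _ => (dist_self _).le) (fun _ _ => trivial) (by simp [hy0]) b ⟨hab, le_rfl⟩
    rw [Real.dist_eq, ← sub_mul, abs_mul]
    exact mul_le_mul_of_nonneg_left (hbound x (Ico_subset_Icc_self hx) _) (abs_nonneg _)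
  refine tendsto_iff_dist_tendsto_zero.2 (squeeze_zero (fun _ => dist_nonneg) hd ?_)
  have h1 := (gronwallBound_continuous_ε 0 (Real.nnabs σ * K : NNReal) (b - a)).tendsto 0
  rw [gronwallBound_ε0_δ0] at h1
  refine h1.comp ?_
  have : Continuous fun τ => |τ - σ| * C + 0 := by fun_prop
  simpa using this.tendsto σ

/-- A lower bound for the connecting orbits. -/
def envelope (x : ℝ) : ℝ := max (min (1 / 2 + 3 * x / 2) (1 / 32)) ((3 * x - x ^ 2) / 2)

theorem continuous_envelope : Continuous envelope := by unfold envelope; fun_prop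

theorem lt_envelope {x : ℝ} (h : x ∈ Ioo (-1 : ℝ) 1) : x < envelope x := by
  rcases le_or_gt x 0 with h0 | h0
  · exact lt_max_of_lt_left (lt_min (by linarith [h.1]) (by linarith))
  · exact lt_max_of_lt_right (by nlinarith [h.2])

theorem envelope_lt_one {x : ℝ} (h : x ∈ Ioo (-1 : ℝ) 1) : envelope x < 1 :=
  max_lt (min_lt_of_right_lt (by norm_num)) (by nlinarith [h.2])

theorem envelope_le {x z : ℝ} (hx : -1 < x) (h1 : x ≤ -(5 / 16) → 1 / 2 + 3 * x / 2 ≤ z)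
    (h2 : -(5 / 16) ≤ x → 1 / 32 ≤ z) (h3 : 1 / 64 ≤ x → (3 * x - x ^ 2) / 2 ≤ z) :
    envelope x ≤ z := by
  rcases le_total x (-(5 / 16)) with h | h
  · exact max_le ((min_le_left _ _).trans (h1 h)) (by nlinarith [h1 h])
  · refine max_le ((min_le_right _ _).trans (h2 h)) ?_
    rcases le_total (1 / 64) x with h' | h'
    · exact h3 h'
    · nlinarith [h2 h]

theorem envelope_bounds {x z : ℝ} (hx : x ∈ Ioo (-1 : ℝ) 1) (h : envelope x ≤ z) (hz : z ≤ 1) :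
    (1 - x ^ 2) / 256 ≤ z - x ∧ (1 - z ^ 2) / 256 ≤ z - x ∧ 3 / 4096 ≤ z ^ 2 + z * x + x ^ 2 := by
  obtain ⟨hx1, hx2⟩ := hx
  have h1 := (le_max_left _ _).trans h
  have h2 := (le_max_right _ _).trans h
  rcases le_total x (-(5 / 16)) with h0 | h0
  · rw [min_eq_left (by linarith)] at h1
    refine ⟨?_, ?_, ?_⟩ <;> nlinarith [sq_nonneg (x + 2 * z)]
  · rw [min_eq_right (by linarith)] at h1
    rcases le_total (1 / 64) x with h' | h'
    · refine ⟨?_, ?_, ?_⟩ <;> nlinarith [sq_nonneg (2 * x + z)]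
    · refine ⟨?_, ?_, ?_⟩ <;> nlinarith [sq_nonneg (2 * x + z)]

theorem orbitSlope_bounds {x z : ℝ} (hx : x ∈ Ioo (-1 : ℝ) 1) (h : envelope x ≤ z) (hz : z ≤ 1) :
    (1 - x ^ 2) / 2 ^ 19 ≤ z ^ 3 - x ^ 3 ∧ |orbitSlope 1 x z| ≤ 10 ^ 6 := by
  obtain ⟨h1, h2, h3⟩ := envelope_bounds hx h hz
  have hxz := (lt_envelope hx).trans_le h
  have hP : 3 / 4096 * (z - x) ≤ z ^ 3 - x ^ 3 := by nlinarith
  have hx2 : 0 ≤ 1 - x ^ 2 := by nlinarith [hx.1, hx.2]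
  refine ⟨by linarith, ?_⟩
  have hz1 : -1 ≤ z := by linarith [hx.1]
  have hz2 : 0 ≤ 1 - z ^ 2 := by nlinarith
  have hQ : |z ^ 5 - x| ≤ 513 * (z - x) := by
    have e : z ^ 5 - x = -(z * ((1 - z ^ 2) * (1 + z ^ 2))) + (z - x) := by ring
    have : |z * ((1 - z ^ 2) * (1 + z ^ 2))| ≤ 1 * (512 * (z - x)) := by
      rw [abs_mul, abs_of_nonneg (mul_nonneg hz2 (by positivity))]
      exact mul_le_mul (abs_le.2 ⟨hz1, hz⟩) (by nlinarith) (by positivity) zero_le_one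
    rw [abs_le] at this ⊢
    constructor <;> linarith [this.1, this.2]
  have hP0 := cube_sub_pos hxz
  rw [orbitSlope, one_mul, abs_div, abs_of_pos hP0, div_le_iff₀ hP0]
  linarith

/-- The slope of the orbits, made globally Lipschitz in `y` by truncation. -/
def truncSlope (x y : ℝ) : ℝ := orbitSlope 1 x (max (envelope x) (min y 1))

theorem trunc_mem {x : ℝ} (hx : x ∈ Ioo (-1 : ℝ) 1) (y : ℝ) :
    envelope x ≤ max (envelope x) (min y 1) ∧ max (envelope x) (min y 1) ≤ 1 :=
  ⟨le_max_left _ _, max_le (envelope_lt_one hx).le (min_le_right _ _)⟩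

theorem truncSlope_eq {x y : ℝ} (h : envelope x ≤ y) (h1 : y ≤ 1) :
    truncSlope x y = orbitSlope 1 x y := by rw [truncSlope, min_eq_left h1, max_eq_right h]

theorem abs_truncSlope_le {x : ℝ} (hx : x ∈ Ioo (-1 : ℝ) 1) (y : ℝ) : |truncSlope x y| ≤ 10 ^ 6 :=
  (orbitSlope_bounds hx (trunc_mem hx y).1 (trunc_mem hx y).2).2

theorem continuousOn_truncSlope :
    ContinuousOn (fun p : ℝ × ℝ => truncSlope p.1 p.2) (Ioo (-1) 1 ×ˢ univ) := by
  have := continuous_envelope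
  unfold truncSlope orbitSlope
  refine ContinuousOn.div (by fun_prop) (by fun_prop) fun p hp => ?_
  have := cube_sub_pos ((lt_envelope hp.1).trans_le (trunc_mem hp.1 p.2).1)
  positivity

theorem lipschitzWith_truncSlope {δ x : ℝ} (hδ : 0 < δ) (hx : x ∈ Icc (-1 + δ) (1 - δ)) :
    LipschitzWith (Real.toNNReal (2 ^ 41 / δ)) (truncSlope x) := by
  have hx' : x ∈ Ioo (-1 : ℝ) 1 := ⟨by linarith [hx.1], by linarith [hx.2]⟩
  have main : ∀ z w, envelope x ≤ z → z ≤ 1 → envelope x ≤ w → w ≤ 1 →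
      |orbitSlope 1 x z - orbitSlope 1 x w| ≤ 2 ^ 41 / δ * |z - w| := by
    intro z w hz hz1 hw hw1
    have hxz := (lt_envelope hx').trans_le hz
    have hxw := (lt_envelope hx').trans_le hw
    have bz := (orbitSlope_bounds hx' hz hz1).1
    have bw := (orbitSlope_bounds hx' hw hw1).2
    have hP := cube_sub_pos hxz
    have hP' := cube_sub_pos hxw
    have hPδ : δ / 2 ^ 19 ≤ z ^ 3 - x ^ 3 := le_trans (by nlinarith [hx.1, hx.2]) bz
    have haz : |z| ≤ 1 := abs_le.2 ⟨by linarith [hx'.1], hz1⟩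
    have haw : |w| ≤ 1 := abs_le.2 ⟨by linarith [hx'.1], hw1⟩
    have e : (orbitSlope 1 x z - orbitSlope 1 x w) * (z ^ 3 - x ^ 3) =
        (z - w) * (z ^ 4 + z ^ 3 * w + z ^ 2 * w ^ 2 + z * w ^ 3 + w ^ 4 -
          orbitSlope 1 x w * (z ^ 2 + z * w + w ^ 2)) := by
      rw [orbitSlope, orbitSlope]; field_simp; ring
    have hpow : ∀ i j : ℕ, |z ^ i * w ^ j| ≤ 1 := fun i j => by
      rw [abs_mul, abs_pow, abs_pow]
      exact mul_le_one₀ (pow_le_one₀ (abs_nonneg _) haz) (by positivity)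
        (pow_le_one₀ (abs_nonneg _) haw)
    have h5 : |z ^ 4 + z ^ 3 * w + z ^ 2 * w ^ 2 + z * w ^ 3 + w ^ 4| ≤ 5 := by
      have := hpow 4 0; have := hpow 3 1; have := hpow 2 2; have := hpow 1 3; have := hpow 0 4
      simp only [pow_zero, pow_one, mul_one, one_mul, abs_le] at *
      constructor <;> linarith
    have h3 : |z ^ 2 + z * w + w ^ 2| ≤ 3 := by
      have := hpow 2 0; have := hpow 1 1; have := hpow 0 2
      simp only [pow_zero, pow_one, mul_one, one_mul, abs_le] at *
      constructor <;> linarith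
    have h6 : |z ^ 4 + z ^ 3 * w + z ^ 2 * w ^ 2 + z * w ^ 3 + w ^ 4 -
          orbitSlope 1 x w * (z ^ 2 + z * w + w ^ 2)| ≤ 2 ^ 22 := by
      refine (abs_sub _ _).trans ?_
      rw [abs_mul]
      have := mul_le_mul bw h3 (abs_nonneg _) (by norm_num)
      linarith
    have h7 : |orbitSlope 1 x z - orbitSlope 1 x w| * (z ^ 3 - x ^ 3) ≤ |z - w| * 2 ^ 22 := by
      have := congrArg abs e
      rw [abs_mul, abs_of_pos hP, abs_mul (z - w)] at this
      rw [this]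
      exact mul_le_mul_of_nonneg_left h6 (abs_nonneg _)
    rw [div_mul_eq_mul_div, le_div_iff₀ hδ]
    nlinarith [mul_le_mul_of_nonneg_left hPδ (abs_nonneg (orbitSlope 1 x z - orbitSlope 1 x w))]
  refine LipschitzWith.of_dist_le_mul fun y y' => ?_
  rw [Real.coe_toNNReal _ (by positivity), Real.dist_eq, Real.dist_eq]
  refine (main _ _ (trunc_mem hx' y).1 (trunc_mem hx' y).2 (trunc_mem hx' y').1
    (trunc_mem hx' y').2).trans (mul_le_mul_of_nonneg_left ?_ (by positivity))
  refine (abs_max_sub_max_le_max _ _ _ _).trans (max_le (by simp) ?_)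
  exact (abs_min_sub_min_le_max _ _ _ _).trans (max_le le_rfl (by simp))

theorem barrier_le_barrier {x z : ℝ} (hx : -1 < x) (hxz : x ≤ z) (hz : z < 1) :
    barrier x ≤ barrier z := by
  have hb : ∀ y ∈ Ico x z, ∃ d, 0 < d ∧ HasDerivWithinAt barrier d (Ici y) y := fun y hy => by
    obtain ⟨d, h, h'⟩ := exists_barrier_slope (hx.trans_le hy.1) (hy.2.trans hz)
    exact ⟨d, h.1, h'⟩
  choose! b' h0 hb using hb
  have := le_sub_of_deriv_right_lt (f := barrier) (g := fun _ => barrier x) (g' := fun _ => 0)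
    (κ := 0) hxz continuous_barrier.continuousOn continuousOn_const hb
    (fun y _ => hasDerivWithinAt_const _ _ _) (by simp) fun y hy _ => h0 y hy
  linarith

theorem barrier_lt_one {x : ℝ} (hx : x ∈ Ioo (-1 : ℝ) 1) : barrier x < 1 := by
  have hle : ∀ z ∈ Ioo (-1 : ℝ) 1, barrier z ≤ 1 := fun z hz =>
    ge_of_tendsto barrier_tendsto_right (Filter.eventually_of_mem (Ioo_mem_nhdsLT hz.2)
      fun w hw => barrier_le_barrier hz.1 hw.1.le hw.2)
  by_contra! h
  obtain ⟨d, hd, hd'⟩ := exists_barrier_slope hx.1 hx.2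
  have hev : barrier =ᶠ[nhdsWithin x (Ici x)] fun _ => 1 :=
    Filter.eventuallyEq_of_mem (Ico_mem_nhdsGE hx.2) fun z hz =>
      le_antisymm (hle z ⟨hx.1.trans_le hz.1, hz.2⟩) (h.trans (barrier_le_barrier hx.1 hz.1 hz.2))
  have := (uniqueDiffWithinAt_Ici x).eq_deriv _ hd'
    ((hasDerivWithinAt_const x (Ici x) (1 : ℝ)).congr_of_eventuallyEq hev (le_antisymm (hle x hx) h))
  exact hd.1.ne' this

theorem barrier_lt_pow {x : ℝ} (hx : x ∈ Ioo (-1 : ℝ) 1) : x < barrier x ^ 5 := by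
  obtain ⟨d, h, -⟩ := exists_barrier_slope hx.1 hx.2
  have := cube_sub_pos h.lt
  have := h.1
  have : 0 < 53 / 40 * (barrier x ^ 3 - x ^ 3) * d := by positivity
  linarith [h.2.1]

theorem quadratic_pow_lt {x : ℝ} (h0 : 0 < x) (h1 : x < 1) : ((3 * x - x ^ 2) / 2) ^ 5 < x := by
  set u := (3 * x - x ^ 2) / 2 with hu
  have hu0 : 0 < u := by nlinarith
  have hu1 : u < 1 := by nlinarith
  have h2 : u ^ 2 < x := by
    have : x - u ^ 2 = x * ((1 - x) ^ 2 * (4 - x)) / 4 := by rw [hu]; ring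
    have : 0 < x * ((1 - x) ^ 2 * (4 - x)) / 4 := by
      have : 0 < 1 - x := by linarith
      have : 0 < 4 - x := by linarith
      positivity
    linarith
  exact (pow_le_pow_of_le_one hu0.le hu1.le (by norm_num)).trans_lt h2

theorem quadratic_le_of_le_pow {x y : ℝ} (h0 : 0 < x) (h1 : x < 1) (h : x ≤ y ^ 5) :
    (3 * x - x ^ 2) / 2 ≤ y := by
  by_contra! hlt
  have := Odd.strictMono_pow (R := ℝ) (n := 5) (by decide) hlt
  have := quadratic_pow_lt h0 h1
  simp only at *
  linarith

theorem envelope_le_barrier {x : ℝ} (hx : x ∈ Ioo (-1 : ℝ) 1) : envelope x ≤ barrier x := by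
  have hhalf : ∀ z, -(1 / 2) ≤ z → z < 1 → 1 / 32 ≤ barrier z := fun z hz hz1 => by
    have := barrier_le_barrier (by norm_num) hz hz1
    rw [barrier_neg_half] at this
    linarith
  refine envelope_le hx.1 (fun h => ?_) (fun h => hhalf x (by linarith) hx.2)
    (fun h => quadratic_le_of_le_pow (by linarith) hx.2 (barrier_lt_pow hx).le)
  rcases lt_or_ge x (-(1 / 2)) with h' | h'
  · rw [barrier, if_pos h', pieceFun]
    obtain ⟨t, rfl⟩ : ∃ t, x = -1 + t / 2 := ⟨2 * (1 + x), by ring⟩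
    have h0 : 0 < t := by linarith [hx.1]
    have h1 : t < 1 := by linarith
    have e : (1000 * (-1 + t / 2) - ((-1000 : ℤ) : ℝ)) / ((500 : ℤ) : ℝ) = t := by push_cast; ring
    rw [e]
    simp only [barrier₁, barrierPiece, PolyExpr.eval, List.foldr]
    push_cast
    have : 0 ≤ t * (284 + (1 - t) * (33 - 324 * t + 202 * t ^ 2 - 366 * t ^ 3)) := by
      refine mul_nonneg h0.le ?_
      have : t ^ 3 ≤ t := by nlinarith [sq_nonneg t]
      nlinarith [mul_nonneg (sub_nonneg.2 h1.le) (sub_nonneg.2 this), sq_nonneg (2 * t - 1),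
        mul_nonneg (sub_nonneg.2 h1.le) (sq_nonneg t)]
    nlinarith
  · have := hhalf x h' hx.2
    linarith

theorem line_slope {x : ℝ} (h0 : -1 < x) (h1 : x ≤ -(5 / 16)) :
    27 / 20 * (3 / 2) < orbitSlope 1 x (1 / 2 + 3 * x / 2) := by
  have h := cube_sub_pos (show x < 1 / 2 + 3 * x / 2 by linarith)
  rw [orbitSlope, one_mul, lt_div_iff₀ h]
  obtain ⟨t, rfl⟩ : ∃ t, x = -1 + t := ⟨1 + x, by ring⟩
  have ht : 0 < t := by linarith
  have ht1 : t ≤ 11 / 16 := by linarith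
  rw [← sub_pos]
  have e : (1 / 2 + 3 * (-1 + t) / 2) ^ 5 - (-1 + t) -
      27 / 20 * (3 / 2) * ((1 / 2 + 3 * (-1 + t) / 2) ^ 3 - (-1 + t) ^ 3) =
      t * (277 / 80 - 477 / 32 * t + 9261 / 320 * t ^ 2 - 405 / 16 * t ^ 3 + 243 / 32 * t ^ 4) := by
    ring
  rw [e]
  refine mul_pos ht ?_
  have := mul_nonneg ht.le (sub_nonneg.2 ht1)
  nlinarith [mul_nonneg this (sub_nonneg.2 ht1), mul_nonneg this ht.le,
    mul_nonneg (sub_nonneg.2 ht1) (sq_nonneg (t - 3 / 5)), mul_nonneg this (sq_nonneg (t - 3 / 5)),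
    sq_nonneg (t ^ 2 - t * 5 / 3), sq_nonneg (t - 3 / 5), sq_nonneg (t ^ 2 - 9 / 25)]

/-- Approximate profiles on `[-1 + δ, 1 - δ]`, found by shooting. -/
theorem exists_approx_profile {δ : ℝ} (hδ : 0 < δ) (hδ' : δ ≤ 1 / 2) :
    ∃ σ ∈ Icc (20 / 27 : ℝ) (40 / 53), ∃ y : ℝ → ℝ, y (-1 + δ) = barrier (-1 + δ) ∧
      ∀ x ∈ Icc (-1 + δ) (1 - δ),
        HasDerivWithinAt y (σ * truncSlope x (y x)) (Icc (-1 + δ) (1 - δ)) x ∧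
        envelope x ≤ y x ∧ y x ≤ 1 ∧ (0 ≤ x → x ≤ y x ^ 5) := by
  set a := -1 + δ with ha
  set b := 1 - δ with hb
  have hab : a ≤ b := by linarith
  have hI : ∀ {x}, x ∈ Icc a b → x ∈ Ioo (-1 : ℝ) 1 := fun {x} hx =>
    ⟨by linarith [hx.1], by linarith [hx.2]⟩
  obtain ⟨y, hya, hy, hcont⟩ := exists_solution_family (y₀ := barrier a)
      (C := 10 ^ 6) hab (by norm_num)
    (fun x hx => lipschitzWith_truncSlope hδ hx)
    (fun y => continuousOn_truncSlope.comp (f := fun x : ℝ => (x, y)) (by fun_prop)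
      fun x hx => ⟨hI hx, trivial⟩) fun x hx => abs_truncSlope_le (hI hx)
  have hyc : ∀ σ, ContinuousOn (y σ) (Icc a b) := fun σ x hx => (hy σ x hx).continuousWithinAt
  have hyr : ∀ σ, ∀ x ∈ Ico a b, HasDerivWithinAt (y σ) (σ * truncSlope x (y σ x)) (Ici x) x :=
    fun σ x hx => (hy σ x (Ico_subset_Icc_self hx)).mono_of_mem_nhdsWithin (Icc_mem_nhdsGE_of_mem hx)
  have hbar : ∀ x ∈ Ico a b, ∃ d, IsBarrierSlope x (barrier x) d ∧
      HasDerivWithinAt barrier d (Ici x) x := fun x hx =>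
    exists_barrier_slope (hI (Ico_subset_Icc_self hx)).1 (hI (Ico_subset_Icc_self hx)).2
  choose! b' hb1 hb2 using hbar
  have htrunc : ∀ x ∈ Ico a b, truncSlope x (barrier x) = orbitSlope 1 x (barrier x) := fun x hx =>
    truncSlope_eq (envelope_le_barrier (hI (Ico_subset_Icc_self hx)))
      (barrier_lt_one (hI (Ico_subset_Icc_self hx))).le
  have hlow : y (20 / 27) b ≤ barrier b := by
    have := le_sub_of_deriv_right_lt (κ := 0) hab continuous_barrier.continuousOn (hyc (20 / 27)) hb2
      (hyr (20 / 27)) (by simp [hya]) fun x hx hx' => ?_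
    · linarith
    · have h := (hb1 x hx).slope_lt
      rw [← sub_eq_zero.1 hx', htrunc x hx]
      rw [slope_mul] at h
      linarith
  have hhigh : barrier b ≤ y (40 / 53) b := by
    have := le_sub_of_deriv_right_lt (κ := 0) hab (hyc (40 / 53)) continuous_barrier.continuousOn
      (hyr (40 / 53)) hb2 (by simp [hya]) fun x hx hx' => ?_
    · linarith
    · have h := (hb1 x hx).lt_slope
      rw [sub_eq_zero.1 hx', htrunc x hx]
      rw [slope_mul] at h
      linarith
  obtain ⟨σ, hσ, hσb⟩ := intermediate_value_Icc (by norm_num : (20 / 27 : ℝ) ≤ 40 / 53)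
    hcont.continuousOn ⟨hlow, hhigh⟩
  have hσ0 : 0 < σ := by linarith [hσ.1]
  have hσb : y σ b = barrier b := hσb
  have stay_above : ∀ {c d m k : ℝ}, a ≤ c → c ≤ d → d ≤ b → k + m * c ≤ y σ c →
      (∀ x ∈ Ico c d, y σ x = k + m * x → m < σ * truncSlope x (k + m * x)) →
          k + m * d ≤ y σ d := by
    intro c d m k hc hcd hd h0 h
    have hsub : Icc c d ⊆ Icc a b := Icc_subset_Icc hc hd
    have hsub' : Ico c d ⊆ Ico a b := Ico_subset_Ico hc hd
    have := le_sub_of_deriv_right_lt (κ := 0) (g := fun x => k + m * x) (g' := fun _ => m) hcd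
      ((hyc σ).mono hsub) (by fun_prop) (fun x hx => hyr σ x (hsub' hx)) (fun x _ => ?_)
      (by linarith) fun x hx hx' => ?_
    · linarith
    · simpa using ((hasDerivAt_id x).const_mul m |>.const_add k).hasDerivWithinAt
    · rw [sub_eq_zero.1 hx']; exact h x hx (sub_eq_zero.1 hx')
  have hle1 : ∀ x ∈ Icc a b, y σ x ≤ 1 := by
    intro c hc
    by_contra! h
    have := stay_above (k := 1) (m := 0) hc.1 hc.2 le_rfl (by linarith) fun x hx _ => ?_
    · linarith [barrier_lt_one (hI ⟨hab, le_rfl⟩)]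
    · have hx' := hI ⟨hc.1.trans hx.1, hx.2.le⟩
      rw [zero_mul, add_zero, truncSlope_eq (envelope_lt_one hx').le le_rfl, orbitSlope]
      have := cube_sub_pos hx'.2
      have : 0 < 1 ^ 5 - x := by linarith [hx'.2]
      positivity
  have hline : ∀ x ∈ Icc a b, x ≤ -(5 / 16) → 1 / 2 + 3 * x / 2 ≤ y σ x := by
    intro c hc hc'
    have := stay_above (k := 1 / 2) (m := 3 / 2) le_rfl hc.1 hc.2 ?_ fun x hx _ => ?_
    · linarith
    · have := envelope_le_barrier (hI ⟨le_rfl, hab⟩)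
      have := (le_max_left _ _).trans this
      rw [min_eq_left (by linarith [hc.1])] at this
      rw [hya]
      linarith
    · have hx1 : x ∈ Ioo (-1 : ℝ) 1 := hI ⟨hx.1, hx.2.le.trans hc.2⟩
      have hxc := hx.2
      have h1 := line_slope hx1.1 (by linarith)
      rw [show 1 / 2 + 3 / 2 * x = 1 / 2 + 3 * x / 2 by ring,
        truncSlope_eq (envelope_le hx1.1 (fun _ => le_rfl) (fun _ => by linarith)
          fun _ => by linarith) (by linarith)]
      nlinarith [hσ.1]
  have hsmall : ∀ x ∈ Icc a b, -(5 / 16) ≤ x → x ≤ 1 / 32 ^ 5 → 1 / 32 ≤ y σ x := by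
    intro c hc hc1 hc2
    have key : ∀ e ≤ c, a ≤ e → -(5 / 16) ≤ e → 1 / 32 ≤ y σ e → 1 / 32 ≤ y σ c := by
      intro e hec hae he hye
      have := stay_above (k := 1 / 32) (m := 0) hae hec hc.2 (by linarith) fun x hx _ => ?_
      · linarith
      · have hx1 : x ∈ Ioo (-1 : ℝ) 1 := hI ⟨hae.trans hx.1, hx.2.le.trans hc.2⟩
        have hxc : x < 1 / 32 ^ 5 := hx.2.trans_le hc2
        have hxe := hx.1
        rw [zero_mul, add_zero, truncSlope_eq (envelope_le hx1.1 (fun _ => by linarith)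
          (fun _ => le_rfl) fun _ => by norm_num at hxc; linarith) (by norm_num), orbitSlope]
        have := cube_sub_pos (show x < 1 / 32 by norm_num at hxc ⊢; linarith)
        have : 0 < (1 / 32) ^ 5 - x := by norm_num at hxc ⊢; linarith
        positivity
    rcases le_total a (-(5 / 16)) with h | h
    · exact key _ hc1 h le_rfl ((by norm_num : (1 / 32 : ℝ) ≤ 1 / 2 + 3 * -(5 / 16) / 2).trans
        (hline _ ⟨h, hc1.trans hc.2⟩ le_rfl))
    · refine key a hc.1 le_rfl h ?_
      have := (le_max_left _ _).trans (envelope_le_barrier (hI ⟨le_rfl, hab⟩))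
      rwa [min_eq_right (by linarith), ← hya σ] at this
  have hpow : ∀ x ∈ Icc a b, 0 ≤ x → x ≤ y σ x ^ 5 := by
    intro c hc hc0
    rcases le_or_gt c (1 / 32 ^ 5) with h | h
    · calc c ≤ (1 / 32) ^ 5 := by rwa [one_div_pow]
        _ ≤ y σ c ^ 5 := pow_le_pow_left₀ (by norm_num) (hsmall c hc (by linarith) h) 5
    · by_contra! hlt
      have := image_le_of_deriv_right_lt_deriv_boundary' (f := y σ)
        (f' := fun x => σ * truncSlope x (y σ x)) (B := fun _ => y σ c) (B' := fun _ => 0)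
        ((hyc σ).mono (Icc_subset_Icc hc.1 le_rfl)) (fun x hx => hyr σ x ⟨hc.1.trans hx.1, hx.2⟩)
        le_rfl continuousOn_const (fun x _ => hasDerivWithinAt_const _ _ _) (fun x hx hx' => ?_)
        ⟨hc.2, le_rfl⟩
      · rw [hσb] at this
        have h5 := (Odd.strictMono_pow (R := ℝ) (n := 5) (by decide)).monotone this
        have := barrier_lt_pow (hI ⟨hab, le_rfl⟩)
        linarith [hc.2]
      · have hx1 : x ∈ Ioo (-1 : ℝ) 1 := hI ⟨hc.1.trans hx.1, hx.2.le⟩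
        have hcx := hx.1
        rw [hx']
        refine mul_neg_of_pos_of_neg hσ0 (div_neg_of_neg_of_pos ?_ ?_)
        · have hx0 : 0 < x := by linarith
          have hlt5 : ∀ u v : ℝ, u ^ 5 < x → v ^ 5 < x → (max u v) ^ 5 < x := fun u v hu hv => by
            rcases max_choice u v with h | h <;> rwa [h]
          refine sub_neg.2 (hlt5 _ _ (hlt5 _ _ ?_ (quadratic_pow_lt hx0 hx1.2)) ?_)
          · rw [min_eq_right (by linarith), one_div_pow]; linarith
          · rw [min_eq_left (hle1 c hc)]; linarith
        · rw [one_mul]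
          exact cube_sub_pos ((lt_envelope hx1).trans_le (trunc_mem hx1 _).1)
  refine ⟨σ, hσ, y σ, hya σ, fun x hx => ⟨hy σ x hx, ?_, hle1 x hx, hpow x hx⟩⟩
  have hx1 := hI hx
  refine envelope_le hx1.1 (hline x hx) (fun h => ?_)
    fun h => quadratic_le_of_le_pow (by linarith) hx1.2 (hpow x hx (by linarith))
  rcases le_total x (1 / 32 ^ 5) with h' | h'
  · exact hsmall x hx h h'
  · have h0 : 0 ≤ x := le_trans (by positivity) h'
    by_contra! hlt
    have := Odd.strictMono_pow (R := ℝ) (n := 5) (by decide) hlt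
    have := hpow x hx h0
    norm_num at *
    linarith

theorem lipschitz_of_approx {a b σ : ℝ} {y : ℝ → ℝ} (hσ : σ ∈ Icc (20 / 27 : ℝ) (40 / 53))
    (hab : Icc a b ⊆ Ioo (-1) 1)
    (hy : ∀ x ∈ Icc a b, HasDerivWithinAt y (σ * truncSlope x (y x)) (Icc a b) x) {x z : ℝ}
    (hx : x ∈ Icc a b) (hz : z ∈ Icc a b) : |y z - y x| ≤ 10 ^ 6 * |z - x| := by
  refine (convex_Icc a b).norm_image_sub_le_of_norm_hasDerivWithin_le hy (fun w hw => ?_) hx hz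
  rw [norm_mul, Real.norm_eq_abs, Real.norm_eq_abs]
  have h1 : |σ| ≤ 1 := abs_le.2 ⟨by linarith [hσ.1], by linarith [hσ.2]⟩
  have := mul_le_mul h1 (abs_truncSlope_le (hab hw) (y w)) (abs_nonneg _) zero_le_one
  linarith

/-- A connecting orbit exists for some parameter. -/
theorem exists_profile : ∃ s ∈ Icc (53 / 40 : ℝ) (27 / 20), ∃ f, IsProfile s f ∧
    ∀ x ∈ Ioo (-1 : ℝ) 1, f x ≤ -1 + 10 ^ 6 * (1 + x) := by
  have hδ : ∀ n : ℕ, 0 < 1 / ((n : ℝ) + 2) ∧ 1 / ((n : ℝ) + 2) ≤ 1 / 2 := fun n =>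
    ⟨by positivity, one_div_le_one_div_of_le (by norm_num) (by linarith [n.cast_nonneg (α := ℝ)])⟩
  choose σ hσ y hya hy using fun n => exists_approx_profile (hδ n).1 (hδ n).2
  set δ : ℕ → ℝ := fun n => 1 / ((n : ℝ) + 2) with hδdef
  have hI : ∀ n, Icc (-1 + δ n) (1 - δ n) ⊆ Ioo (-1) 1 := fun n x hx =>
    ⟨by linarith [hx.1, (hδ n).1], by linarith [hx.2, (hδ n).1]⟩
  let U : Ultrafilter ℕ := hyperfilter ℕ
  have hU : (U : Filter ℕ) ≤ atTop := Nat.hyperfilter_le_atTop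
  have hδ0 : Tendsto δ atTop (nhds 0) :=
    tendsto_const_nhds.div_atTop (tendsto_natCast_atTop_atTop.atTop_add tendsto_const_nhds)
  have hδ0 := hδ0.mono_left hU
  obtain ⟨τ, hτ, hτlim⟩ := (isCompact_Icc (a := (20 / 27 : ℝ)) (b := 40 / 53)).ultrafilter_le_nhds
    (U.map σ) (le_principal_iff.2
      (show ∀ᶠ n in (U : Filter ℕ), σ n ∈ Icc (20 / 27 : ℝ) (40 / 53) from .of_forall hσ))
  have hτlim : Tendsto σ U (nhds τ) := hτlim
  have hmem : ∀ x ∈ Ioo (-1 : ℝ) 1, ∀ᶠ n in (U : Filter ℕ), x ∈ Icc (-1 + δ n) (1 - δ n) := by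
    intro x hx
    have h1 := hδ0.eventually (gt_mem_nhds (by linarith [hx.1] : 0 < 1 + x))
    have h2 := hδ0.eventually (gt_mem_nhds (by linarith [hx.2] : 0 < 1 - x))
    filter_upwards [h1, h2] with n h1 h2
    constructor <;> linarith
  have hlim : ∀ x ∈ Ioo (-1 : ℝ) 1, ∃ z, Tendsto (fun n => y n x) U (nhds z) := by
    intro x hx
    obtain ⟨z, -, hz⟩ := (isCompact_Icc (a := -1) (b := 1)).ultrafilter_le_nhds (U.map fun n => y n x) (by
      simp only [Ultrafilter.coe_map, le_principal_iff, Filter.mem_map]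
      filter_upwards [hmem x hx] with n hn
      obtain ⟨-, h1, h2, -⟩ := hy n x hn
      exact ⟨by linarith [lt_envelope hx, hx.1], h2⟩)
    exact ⟨z, hz⟩
  choose! f hf using hlim
  have hfb : ∀ x ∈ Ioo (-1 : ℝ) 1, envelope x ≤ f x ∧ f x ≤ 1 ∧ (0 ≤ x → x ≤ f x ^ 5) := by
    intro x hx
    refine ⟨ge_of_tendsto (hf x hx) ((hmem x hx).mono fun n hn => (hy n x hn).2.1),
      le_of_tendsto (hf x hx) ((hmem x hx).mono fun n hn => (hy n x hn).2.2.1),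
      fun h0 => ge_of_tendsto ((hf x hx).pow 5) ((hmem x hx).mono fun n hn => (hy n x hn).2.2.2 h0)⟩
  have hfC : ∀ x ∈ Ioo (-1 : ℝ) 1, f x ≤ -1 + 10 ^ 6 * (1 + x) := by
    intro x hx
    have h1 : Tendsto (fun n => barrier (-1 + δ n) + 10 ^ 6 * (x - (-1 + δ n))) U
        (nhds (barrier (-1 + 0) + 10 ^ 6 * (x - (-1 + 0)))) :=
      ((continuous_barrier.tendsto _).comp (hδ0.const_add (-1))).add
        (((hδ0.const_add (-1)).const_sub x).const_mul _)
    rw [add_zero, barrier_neg_one, sub_neg_eq_add, add_comm x] at h1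
    refine le_of_tendsto_of_tendsto (hf x hx) h1 ((hmem x hx).mono fun n hn => ?_)
    have h2 := lipschitz_of_approx (hσ n) (hI n) (fun z hz => (hy n z hz).1)
      (left_mem_Icc.2 (hn.1.trans hn.2)) hn
    rw [hya n, abs_of_nonneg (sub_nonneg.2 hn.1)] at h2
    linarith [(abs_le.1 h2).2]
  have hder : ∀ x ∈ Ioo (-1 : ℝ) 1, HasDerivAt f (τ * truncSlope x (f x)) x := by
    intro x₀ hx₀
    obtain ⟨r, hr, hrI⟩ : ∃ r > 0, Icc (x₀ - r) (x₀ + r) ⊆ Ioo (-1 : ℝ) 1 := by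
      refine ⟨min (1 + x₀) (1 - x₀) / 2, half_pos (lt_min (by linarith [hx₀.1])
          (by linarith [hx₀.2])),
        fun z hz => ?_⟩
      have h1 := min_le_left (1 + x₀) (1 - x₀)
      have h2 := min_le_right (1 + x₀) (1 - x₀)
      exact ⟨by linarith [hz.1, hx₀.1], by linarith [hz.2, hx₀.2]⟩
    set Ψ : ℝ × ℝ × ℝ → ℝ := fun p => p.1 * truncSlope p.2.1 p.2.2 with hΨ
    set S : Set (ℝ × ℝ × ℝ) :=
      Icc (20 / 27 : ℝ) (40 / 53) ×ˢ (Icc (x₀ - r) (x₀ + r) ×ˢ Icc (-1 : ℝ) 1) with hS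
    have hΨc : ContinuousOn Ψ S := by
      refine continuousOn_fst.mul (continuousOn_truncSlope.comp continuousOn_snd fun p hp => ?_)
      exact ⟨hrI hp.2.1, trivial⟩
    have hScomp : IsCompact S := isCompact_Icc.prod (isCompact_Icc.prod isCompact_Icc)
    have huc := Metric.uniformContinuousOn_iff.1 (hScomp.uniformContinuousOn_of_continuous hΨc)
    have hyS : ∀ n, ∀ x ∈ Icc (x₀ - r) (x₀ + r), x ∈ Icc (-1 + δ n) (1 - δ n) →
        (σ n, x, y n x) ∈ S := fun n x hx hx' => by
      obtain ⟨-, h1, h2, -⟩ := hy n x hx'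
      exact ⟨hσ n, hx, by linarith [lt_envelope (hI n hx'), (hI n hx').1], h2⟩
    have hx₀r : x₀ ∈ Icc (x₀ - r) (x₀ + r) := ⟨by linarith, by linarith⟩
    have hfx₀ : (τ, x₀, f x₀) ∈ S := by
      obtain ⟨h1, h2, -⟩ := hfb x₀ hx₀
      exact ⟨hτ, hx₀r, by linarith [lt_envelope hx₀, hx₀.1], h2⟩
    have hDlim : Tendsto (fun n => Ψ (σ n, x₀, y n x₀)) U (nhds (Ψ (τ, x₀, f x₀))) := by
      refine (hΨc _ hfx₀).tendsto.comp (tendsto_nhdsWithin_iff.2 ⟨?_, ?_⟩)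
      · exact hτlim.prodMk_nhds (tendsto_const_nhds.prodMk_nhds (hf x₀ hx₀))
      · filter_upwards [hmem x₀ hx₀] with n hn using hyS n x₀ hx₀r hn
    rw [hasDerivAt_iff_isLittleO, Asymptotics.isLittleO_iff]
    intro ε hε
    obtain ⟨η, hη, hηε⟩ := huc ε hε
    have hρ : 0 < min r (η / 10 ^ 7) := lt_min hr (by positivity)
    filter_upwards [Metric.ball_mem_nhds x₀ hρ] with x hx
    have hxr : |x - x₀| < r := hx.trans_le (min_le_left _ _)
    have hxη : |x - x₀| < η / 10 ^ 7 := hx.trans_le (min_le_right _ _)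
    have hxI : x ∈ Icc (x₀ - r) (x₀ + r) := by
      rw [abs_lt] at hxr; constructor <;> linarith
    have hlim := (((hf x (hrI hxI)).sub (hf x₀ hx₀)).sub (hDlim.const_mul (x - x₀))).norm
    refine le_of_tendsto hlim ?_
    filter_upwards [hmem _ (hrI hxI), hmem _ hx₀] with n hn hn₀
    have hsub : uIcc x₀ x ⊆ Icc (-1 + δ n) (1 - δ n) := uIcc_subset_Icc hn₀ hn
    have hsub' : uIcc x₀ x ⊆ Icc (x₀ - r) (x₀ + r) := uIcc_subset_Icc hx₀r hxI
    have := (convex_uIcc x₀ x).norm_image_sub_le_of_norm_hasDerivWithin_le (C := ε)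
      (f := fun z => y n z - z * Ψ (σ n, x₀, y n x₀))
      (f' := fun z => Ψ (σ n, z, y n z) - 1 * Ψ (σ n, x₀, y n x₀))
      (fun z hz => ((hy n z (hsub hz)).1.mono hsub).sub
        ((hasDerivWithinAt_id z _).mul_const _)) (fun z hz => ?_) left_mem_uIcc right_mem_uIcc
    · rw [show y n x - y n x₀ - (x - x₀) * Ψ (σ n, x₀, y n x₀) =
        y n x - x * Ψ (σ n, x₀, y n x₀) - (y n x₀ - x₀ * Ψ (σ n, x₀, y n x₀)) by ring]
      exact this
    · rw [one_mul, ← dist_eq_norm]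
      refine (hηε _ (hyS n z (hsub' hz) (hsub hz)) _ (hyS n x₀ hx₀r hn₀) ?_).le
      have hzx : |z - x₀| ≤ |x - x₀| := abs_sub_left_of_mem_uIcc hz
      have hyz := lipschitz_of_approx (hσ n) (hI n) (fun z hz => (hy n z hz).1) hn₀ (hsub hz)
      simp only [Prod.dist_eq, dist_self, Real.dist_eq]
      exact max_lt hη (max_lt (by linarith) (by linarith))
  have hτ0 : 0 < τ := by linarith [hτ.1]
  have hder' : ∀ x ∈ Ioo (-1 : ℝ) 1, HasDerivAt f (orbitSlope τ⁻¹ x (f x)) x := by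
    intro x hx
    refine (hder x hx).congr_deriv ?_
    rw [truncSlope_eq (hfb x hx).1 (hfb x hx).2.1, slope_mul τ⁻¹, div_inv_eq_mul, mul_comm]
  refine ⟨τ⁻¹, ⟨?_, ?_⟩, f, ⟨fun x hx => (lt_envelope hx).trans_le (hfb x hx).1, ?_, hder', ?_, ?_⟩,
      hfC⟩
  · rw [le_inv_comm₀ (by norm_num) hτ0]; norm_num; linarith [hτ.2]
  · rw [inv_le_comm₀ hτ0 (by norm_num)]; norm_num; linarith [hτ.1]
  · intro x hx
    obtain ⟨h1, h2, h3⟩ := hfb x hx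
    have hxf := (lt_envelope hx).trans_le h1
    rcases lt_or_ge x 0 with h0 | h0
    · rcases le_or_gt 0 (f x) with hf0 | hf0
      · exact h0.trans_le (by positivity)
      · have : f x ^ 4 ≤ 1 := by
          have : f x ^ 2 ≤ 1 := by nlinarith [hx.1]
          nlinarith [sq_nonneg (f x)]
        nlinarith
    · refine (h3 h0).lt_of_ne fun heq => ?_
      rcases h0.eq_or_lt with rfl | h0
      · have : f 0 = 0 := by simpa using heq.symm
        linarith
      · have hd := ((hder' x hx).pow 5).sub (hasDerivAt_id x)
        have hmin : IsLocalMin (f ^ 5 - id) x := by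
          filter_upwards [Ioo_mem_nhds h0 hx.2] with z hz
          have := (hfb z ⟨by linarith [hz.1], hz.2⟩).2.2 hz.1.le
          simp only [Pi.sub_apply, Pi.pow_apply, id]
          linarith
        have := hmin.hasDerivAt_eq_zero hd
        rw [orbitSlope, ← heq] at this
        simp at this
  · have h2 : Tendsto (fun x : ℝ => -1 + 10 ^ 6 * (1 + x)) (nhdsWithin (-1) (Ioi (-1)))
        (nhds (-1)) := by
      have : Continuous fun x : ℝ => -1 + 10 ^ 6 * (1 + x) := by fun_prop
      simpa using (this.tendsto (-1)).mono_left nhdsWithin_le_nhds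
    refine tendsto_of_tendsto_of_tendsto_of_le_of_le' (tendsto_id.mono_left nhdsWithin_le_nhds) h2 ?_ ?_
    · filter_upwards [Ioo_mem_nhdsGT (by norm_num : (-1 : ℝ) < 1)] with x hx
      exact (lt_envelope hx).le.trans (hfb x hx).1
    · filter_upwards [Ioo_mem_nhdsGT (by norm_num : (-1 : ℝ) < 1)] with x hx using hfC x hx
  · refine tendsto_of_tendsto_of_tendsto_of_le_of_le' (tendsto_id.mono_left nhdsWithin_le_nhds)
      tendsto_const_nhds ?_ ?_
    · filter_upwards [Ioo_mem_nhdsLT (by norm_num : (-1 : ℝ) < 1)] with x hx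
      exact (lt_envelope hx).le.trans (hfb x hx).1
    · filter_upwards [Ioo_mem_nhdsLT (by norm_num : (-1 : ℝ) < 1)] with x hx using (hfb x hx).2.1

/-- A solution `(x, y)` of the scaled system. -/
structure IsScaledSolution (s : ℝ) (x y : ℝ → ℝ) : Prop where
  hasDerivAt_fst : ∀ t, HasDerivAt x (s * (y t ^ 3 - x t ^ 3)) t
  hasDerivAt_snd : ∀ t, HasDerivAt y (y t ^ 5 - x t) t

theorem IsScaledSolution.isSolution {a m : ℝ} (ha : m * a ^ 4 = 1) {x y : ℝ → ℝ}
    (h : IsScaledSolution (a ^ 2) x y) : IsSolution m fun t => (a * x t, a * y t) := by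
  intro t
  refine (((h.1 t).const_mul a).prodMk ((h.2 t).const_mul a)).congr_deriv (Prod.ext ?_ ?_)
  · simp only [bacciotti]; ring
  · simp only [bacciotti]; linear_combination (-a * y t ^ 5) * ha

theorem IsSolution.isScaledSolution {a m : ℝ} (ha0 : a ≠ 0) (ha : m * a ^ 4 = 1) {γ : ℝ → ℝ × ℝ}
    (h : IsSolution m γ) :
    IsScaledSolution (a ^ 2) (fun t => (γ t).1 / a) (fun t => (γ t).2 / a) := by
  refine ⟨fun t => ?_, fun t => ?_⟩
  · refine (((hasFDerivAt_fst (𝕜 := ℝ) (p := γ t)).comp_hasDerivAt t (h t)).div_const a).congr_deriv ?_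
    simp only [bacciotti, ContinuousLinearMap.coe_fst']
    field_simp
  · refine (((hasFDerivAt_snd (𝕜 := ℝ) (p := γ t)).comp_hasDerivAt t (h t)).div_const a).congr_deriv ?_
    simp only [bacciotti, ContinuousLinearMap.coe_snd']
    field_simp
    linear_combination (γ t).2 ^ 5 * ha

theorem mul_rpow_neg_quarter_pow {m : ℝ} (hm : 0 < m) : m * (m ^ (-(1 : ℝ) / 4)) ^ 4 = 1 := by
  rw [← Real.rpow_natCast, ← Real.rpow_mul hm.le]
  norm_num
  rw [Real.rpow_neg_one, mul_inv_cancel₀ hm.ne']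

/-- A strictly increasing continuous function on an interval has a continuous left inverse. -/
theorem exists_continuousOn_leftInverse {φ : ℝ → ℝ} {S : Set ℝ} (hS : S.OrdConnected)
    (hc : ContinuousOn φ S) (hm : StrictMonoOn φ S) :
    ∃ τ : ℝ → ℝ, ContinuousOn τ (image φ S) ∧ ∀ t ∈ S, τ (φ t) = t := by
  have : OrdConnected (image φ S) := (hS.isPreconnected.image φ hc).ordConnected
  refine ⟨Function.invFunOn φ S, ?_, fun t ht => hm.injOn.leftInvOn_invFunOn ht⟩
  rw [continuousOn_iff_continuous_domRestrict]
  have e : (image φ S).domRestrict (Function.invFunOn φ S) =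
      Subtype.val ∘ (hm.orderIso φ S).symm := by
    ext z
    obtain ⟨⟨t, ht⟩, rfl⟩ := (hm.orderIso φ S).surjective z
    rw [Function.comp_apply, OrderIso.symm_apply_apply]
    exact hm.injOn.leftInvOn_invFunOn ht
  rw [e]
  exact continuous_subtype_val.comp (hm.orderIso φ S).symm.continuous

theorem exists_global_flow {g : ℝ → ℝ} {M : ℝ} (hM : 0 < M) (hg : ContinuousOn g (Ioo (-1) 1))
    (hpos : ∀ x ∈ Ioo (-1 : ℝ) 1, 0 < g x) (hr : ∀ x ∈ Ioo (-1 : ℝ) 1, g x ≤ M * (1 - x))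
    (hl : ∀ x ∈ Ioo (-1 : ℝ) 1, g x ≤ M * (1 + x)) :
    ∃ X : ℝ → ℝ, (∀ t, X t ∈ Ioo (-1 : ℝ) 1 ∧ HasDerivAt X (g (X t)) t) ∧
      Tendsto X atBot (nhds (-1)) ∧ Tendsto X atTop (nhds 1) := by
  have h0 : (0 : ℝ) ∈ Ioo (-1 : ℝ) 1 := by norm_num
  have hinv : ContinuousOn (fun x => (g x)⁻¹) (Ioo (-1) 1) := hg.inv₀ fun x hx => (hpos x hx).ne'
  set T : ℝ → ℝ := fun x => ∫ ξ in (0 : ℝ)..x, (g ξ)⁻¹ with hT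
  have hTd : ∀ x ∈ Ioo (-1 : ℝ) 1, HasDerivAt T (g x)⁻¹ x := by
    intro x hx
    have hsub : uIcc 0 x ⊆ Ioo (-1 : ℝ) 1 := ordConnected_Ioo.uIcc_subset h0 hx
    exact intervalIntegral.integral_hasDerivAt_right ((hinv.mono hsub).intervalIntegrable)
      (hinv.stronglyMeasurableAtFilter isOpen_Ioo x hx) (hinv.continuousAt (Ioo_mem_nhds hx.1 hx.2))
  have hTc : ContinuousOn T (Ioo (-1) 1) := fun x hx => (hTd x hx).continuousAt.continuousWithinAt
  have hTm : StrictMonoOn T (Ioo (-1) 1) := by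
    refine strictMonoOn_of_deriv_pos (convex_Ioo _ _) hTc fun x hx => ?_
    rw [interior_Ioo] at hx
    rw [(hTd x hx).deriv]
    exact inv_pos.2 (hpos x hx)
  have hT0 : T 0 = 0 := by simp [hT]
  have hlarge : ∀ x ∈ Ico (0 : ℝ) 1, -log (1 - x) / M ≤ T x ∧ T (-x) ≤ log (1 - x) / M := by
    have key : ∀ {F F' : ℝ → ℝ}, F 0 = 0 → (∀ x ∈ Ico (0 : ℝ) 1, HasDerivAt F (F' x) x) →
        (∀ x ∈ Ico (0 : ℝ) 1, (M * (1 - x))⁻¹ ≤ F' x) → ∀ x ∈ Ico (0 : ℝ) 1,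
            -log (1 - x) / M ≤ F x := by
      intro F F' hF0 hF hF' x hx
      have hd : ∀ z ∈ Ico (0 : ℝ) 1, HasDerivAt (fun z => F z + log (1 - z) / M)
          (F' z + -1 / (1 - z) / M) z := fun z hz =>
        (hF z hz).add ((((hasDerivAt_id z).const_sub 1).log (by simp; linarith [hz.2])).div_const M)
      have hmono : MonotoneOn (fun z => F z + log (1 - z) / M) (Ico 0 1) := by
        refine monotoneOn_of_deriv_nonneg (convex_Ico _ _)
          (fun z hz => (hd z hz).continuousAt.continuousWithinAt)
          (fun z hz => (hd z (interior_subset hz)).differentiableAt.differentiableWithinAt) fun z hz => ?_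
        have hz := interior_subset hz
        rw [(hd z hz).deriv]
        have := hF' z hz
        have : -1 / (1 - z) / M = -(M * (1 - z))⁻¹ := by
          have : 1 - z ≠ 0 := by linarith [hz.2]
          field_simp
        linarith
      have := hmono ⟨le_rfl, zero_lt_one⟩ hx hx.1
      simp only [hF0, sub_zero, log_one, zero_div, add_zero] at this
      rw [neg_div]
      linarith
    intro x hx
    refine ⟨key hT0 (fun z hz => hTd z ⟨by linarith [hz.1], hz.2⟩) (fun z hz => ?_) x hx, ?_⟩
    · have hz' : z ∈ Ioo (-1 : ℝ) 1 := ⟨by linarith [hz.1], hz.2⟩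
      exact inv_anti₀ (hpos z hz') (hr z hz')
    · have := key (F := fun z => -T (-z)) (F' := fun z => (g (-z))⁻¹) (by simp [hT0])
          (fun z hz => ?_)
        (fun z hz => ?_) x hx
      · rw [neg_div] at this
        linarith
      · have hz' : -z ∈ Ioo (-1 : ℝ) 1 := ⟨by linarith [hz.2], by linarith [hz.1]⟩
        exact (((hTd (-z) hz').scomp z (hasDerivAt_neg z)).neg).congr_deriv (by simp)
      · have hz' : -z ∈ Ioo (-1 : ℝ) 1 := ⟨by linarith [hz.2], by linarith [hz.1]⟩
        exact inv_anti₀ (hpos _ hz') (by simpa [sub_eq_add_neg] using hl _ hz')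
  have hsurj : image T (Ioo (-1) 1) = univ := by
    refine eq_univ_of_forall fun v => ?_
    obtain ⟨x, hx, hxv⟩ : ∃ x ∈ Ico (0 : ℝ) 1, |v| = -log (1 - x) / M := by
      refine ⟨1 - exp (-M * |v|), ⟨?_, by linarith [exp_pos (-M * |v|)]⟩, ?_⟩
      · have : exp (-M * |v|) ≤ 1 := exp_le_one_iff.2 (by nlinarith [abs_nonneg v])
        linarith
      · rw [sub_sub_cancel, log_exp]; field_simp
    obtain ⟨h1, h2⟩ := hlarge x hx
    rw [← hxv] at h1
    have h3 : log (1 - x) / M = -|v| := by rw [hxv]; ring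
    have hsub : Icc (-x) x ⊆ Ioo (-1 : ℝ) 1 := fun z hz => ⟨by linarith [hz.1, hx.2],
        by linarith [hz.2, hx.2]⟩
    obtain ⟨z, hz, hzv⟩ := intermediate_value_Icc (by linarith [hx.1]) (hTc.mono hsub)
      ⟨by linarith [neg_abs_le v], (le_abs_self v).trans h1⟩
    exact ⟨z, hsub hz, hzv⟩
  obtain ⟨X, hXc, hX⟩ := exists_continuousOn_leftInverse ordConnected_Ioo hTc hTm
  rw [hsurj] at hXc
  have hXc := continuousOn_univ.1 hXc
  have hXI : ∀ t, X t ∈ Ioo (-1 : ℝ) 1 ∧ T (X t) = t := by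
    intro t
    obtain ⟨x, hx, rfl⟩ : t ∈ image T (Ioo (-1) 1) := hsurj ▸ mem_univ t
    rw [hX x hx]
    exact ⟨hx, rfl⟩
  have hXd : ∀ t, HasDerivAt X (g (X t)) t := fun t => by
    simpa using HasDerivAt.of_local_left_inverse hXc.continuousAt (hTd _ (hXI t).1)
      (inv_pos.2 (hpos _ (hXI t).1)).ne' (Filter.Eventually.of_forall fun u => (hXI u).2)
  have hXm : Monotone X := monotone_of_deriv_nonneg (fun t => (hXd t).differentiableAt) fun t => by
    rw [(hXd t).deriv]; exact (hpos _ (hXI t).1).le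
  have hrange : range X = Ioo (-1) 1 :=
    Subset.antisymm (range_subset_iff.2 fun t => (hXI t).1) fun x hx => ⟨T x, hX x hx⟩
  refine ⟨X, fun t => ⟨(hXI t).1, hXd t⟩, tendsto_atBot_isGLB hXm ?_, tendsto_atTop_isLUB hXm ?_⟩
  · rw [hrange]; exact isGLB_Ioo (by norm_num)
  · rw [hrange]; exact isLUB_Ioo (by norm_num)

theorem IsProfile.lt_one {s : ℝ} {f : ℝ → ℝ} (hs : 0 < s) (h : IsProfile s f) {x : ℝ}
    (hx : x ∈ Ioo (-1 : ℝ) 1) : f x < 1 := by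
  have hm : StrictMonoOn f (Ioo (-1) 1) := by
    refine strictMonoOn_of_deriv_pos (convex_Ioo _ _) h.continuousOn fun z hz => ?_
    rw [interior_Ioo] at hz
    rw [(h.hasDerivAt z hz).deriv]
    exact h.slope_pos hs hz
  obtain ⟨z, hz⟩ := exists_between hx.2
  refine (hm hx ⟨hx.1.trans hz.1, hz.2⟩ hz.1).trans_le ?_
  refine ge_of_tendsto h.tendsto_right (Filter.eventually_of_mem (Ioo_mem_nhdsLT hz.2) fun w hw => ?_)
  exact (hm ⟨hx.1.trans hz.1, hz.2⟩ ⟨hx.1.trans (hz.1.trans hw.1), hw.2⟩ hw.1).le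

theorem cube_sub_le {x y : ℝ} (hx : x ∈ Ioo (-1 : ℝ) 1) (hxy : x ≤ y) (hy : y ≤ 1) :
    y ^ 3 - x ^ 3 ≤ 3 * (y - x) := by
  have : y ^ 3 - x ^ 3 = (y - x) * (y ^ 2 + y * x + x ^ 2) := by ring
  have : y ^ 2 + y * x + x ^ 2 ≤ 3 := by nlinarith [hx.1, hx.2]
  nlinarith

theorem exists_heteroclinic : ∃ m : ℝ, 0 < m ∧ ∃ γ, IsHeteroclinic m γ := by
  obtain ⟨s, hs, f, hf, hC⟩ := exists_profile
  have hs0 : 0 < s := by linarith [hs.1]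
  have hb : ∀ x ∈ Ioo (-1 : ℝ) 1, f x ^ 3 - x ^ 3 ≤ 3 * (f x - x) ∧ f x < 1 := fun x hx =>
    have h1 := hf.lt_one hs0 hx
    ⟨cube_sub_le hx (hf.lt x hx).le h1.le, h1⟩
  obtain ⟨X, hX, hX1, hX2⟩ := exists_global_flow (g := fun x => s * (f x ^ 3 - x ^ 3))
    (M := s * (3 * 10 ^ 6)) (by positivity)
    (continuousOn_const.mul ((hf.continuousOn.pow 3).sub (continuousOn_id.pow 3)))
    (fun x hx => mul_pos hs0 (cube_sub_pos (hf.lt x hx)))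
    (fun x hx => by
      rw [mul_assoc]
      exact mul_le_mul_of_nonneg_left (by linarith [hx.2, hb x hx]) hs0.le)
    (fun x hx => by
      rw [mul_assoc]
      exact mul_le_mul_of_nonneg_left (by linarith [hx.1, hC x hx, hb x hx]) hs0.le)
  have hsol : IsScaledSolution s X fun t => f (X t) := by
    refine ⟨fun t => (hX t).2, fun t => ((hf.hasDerivAt _ (hX t).1).comp t (hX t).2).congr_deriv ?_⟩
    have := cube_sub_pos (hf.lt _ (hX t).1)
    rw [orbitSlope]
    field_simp
  have hXl : Tendsto X atBot (nhdsWithin (-1) (Ioi (-1))) :=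
    tendsto_nhdsWithin_iff.2 ⟨hX1, Filter.Eventually.of_forall fun t => (hX t).1.1⟩
  have hXr : Tendsto X atTop (nhdsWithin 1 (Iio 1)) :=
    tendsto_nhdsWithin_iff.2 ⟨hX2, Filter.Eventually.of_forall fun t => (hX t).1.2⟩
  have hm : 0 < (s ^ 2)⁻¹ := by positivity
  have hsq : √s ^ 2 = s := Real.sq_sqrt hs0.le
  have hroot : ((s ^ 2)⁻¹) ^ (-(1 : ℝ) / 4) = √s := by
    rw [Real.sqrt_eq_rpow, ← Real.rpow_natCast, ← Real.rpow_neg hs0.le, ← Real.rpow_mul hs0.le]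
    norm_num
  rw [← hsq] at hsol
  refine ⟨(s ^ 2)⁻¹, hm, _, hsol.isSolution (m := (s ^ 2)⁻¹) ?_, ?_, ?_⟩
  · rw [show √s ^ 4 = (√s ^ 2) ^ 2 by ring, hsq]; field_simp
  · rw [pMinus, hroot]
    simpa using (hX1.const_mul √s).prodMk_nhds ((hf.tendsto_left.comp hXl).const_mul √s)
  · rw [pPlus, hroot]
    simpa using (hX2.const_mul √s).prodMk_nhds ((hf.tendsto_right.comp hXr).const_mul √s)

/-- Invariance of the region `0 < φ`, `0 ≤ ψ`, in which `φ` increases. -/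
theorem forward_invariant {φ ψ φ' ψ' : ℝ → ℝ} {t₀ : ℝ} (hφ : ∀ t, HasDerivAt φ (φ' t) t)
    (hψ : ∀ t, HasDerivAt ψ (ψ' t) t) (h1 : 0 < φ t₀) (h2 : 0 ≤ ψ t₀)
    (hφ' : ∀ t ≥ t₀, 0 < φ t → 0 ≤ ψ t → 0 ≤ φ' t)
    (hψ' : ∀ t ≥ t₀, 0 < φ t → ψ t = 0 → 0 < ψ' t) :
    ∀ t ≥ t₀, φ t₀ ≤ φ t ∧ 0 ≤ ψ t := by
  have hcφ : Continuous φ := continuous_iff_continuousAt.2 fun t => (hφ t).continuousAt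
  have hcψ : Continuous ψ := continuous_iff_continuousAt.2 fun t => (hψ t).continuousAt
  have key : ∀ t₁ ≥ t₀, (∀ t ∈ Ico t₀ t₁, 0 < φ t) → φ t₀ ≤ φ t₁ ∧ 0 ≤ ψ t₁ := by
    intro t₁ ht₁ hpos
    have hψ0 : ∀ t ∈ Icc t₀ t₁, 0 ≤ ψ t := fun t ht => neg_nonpos.1 <|
      image_le_of_deriv_right_lt_deriv_boundary (f := fun t => -ψ t) (f' := fun t => -ψ' t)
        (B := fun _ => 0) (B' := fun _ => 0) hcψ.neg.continuousOn
        (fun t _ => (hψ t).neg.hasDerivWithinAt) (by simpa using h2)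
        (fun t => hasDerivAt_const t 0)
        (fun t ht h0 => neg_lt_zero.2 (hψ' t ht.1 (hpos t ht) (by simpa using h0))) ht
    have hmono : MonotoneOn φ (Icc t₀ t₁) := by
      refine monotoneOn_of_deriv_nonneg (convex_Icc _ _) hcφ.continuousOn
        (fun t _ => (hφ t).differentiableAt.differentiableWithinAt) fun t ht => ?_
      rw [interior_Icc] at ht
      rw [(hφ t).deriv]
      exact hφ' t ht.1.le (hpos t ⟨ht.1.le, ht.2⟩) (hψ0 t ⟨ht.1.le, ht.2.le⟩)
    exact ⟨hmono ⟨le_rfl, ht₁⟩ ⟨ht₁, le_rfl⟩ ht₁, hψ0 t₁ ⟨ht₁, le_rfl⟩⟩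
  have hpos : ∀ t ≥ t₀, 0 < φ t := by
    by_contra! hne
    obtain ⟨u, hu, hu0⟩ := hne
    have hcl : IsClosed {t | t₀ ≤ t ∧ φ t ≤ 0} :=
      (isClosed_le continuous_const continuous_id).inter (isClosed_le hcφ continuous_const)
    have hbdd : BddBelow {t | t₀ ≤ t ∧ φ t ≤ 0} := ⟨t₀, fun t ht => ht.1⟩
    obtain ⟨hm1, hm2⟩ := hcl.csInf_mem ⟨u, hu, hu0⟩ hbdd
    have := (key _ hm1 fun t ht => ?_).1
    · linarith
    · by_contra! h
      exact absurd (csInf_le hbdd ⟨ht.1, h⟩) (not_le.2 ht.2)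
  exact fun t ht => key t ht fun u hu => hpos u hu.1

theorem backward_invariant {φ ψ φ' ψ' : ℝ → ℝ} {t₀ : ℝ} (hφ : ∀ t, HasDerivAt φ (φ' t) t)
    (hψ : ∀ t, HasDerivAt ψ (ψ' t) t) (h1 : 0 < φ t₀) (h2 : 0 ≤ ψ t₀)
    (hφ' : ∀ t ≤ t₀, 0 < φ t → 0 ≤ ψ t → φ' t ≤ 0)
    (hψ' : ∀ t ≤ t₀, 0 < φ t → ψ t = 0 → ψ' t < 0) :
    ∀ t ≤ t₀, φ t₀ ≤ φ t ∧ 0 ≤ ψ t := by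
  intro t ht
  have hrev : ∀ {F F' : ℝ → ℝ}, (∀ t, HasDerivAt F (F' t) t) →
      ∀ t, HasDerivAt (fun t => F (-t)) (-F' (-t)) t := fun hF t =>
    ((hF (-t)).scomp t (hasDerivAt_neg t)).congr_deriv (by simp)
  have := forward_invariant (t₀ := -t₀) (hrev hφ) (hrev hψ) (by simpa using h1) (by simpa using h2)
    (fun u hu h1 h2 => neg_nonneg.2 (hφ' (-u) (by linarith) h1 h2))
    (fun u hu h1 h2 => neg_pos.2 (hψ' (-u) (by linarith) h1 h2)) (-t) (by linarith)
  simpa using this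

/-- A function that is positive before `t` and vanishes at `t` has nonpositive derivative. -/
theorem HasDerivAt.nonpos_of_pos_left {d : ℝ → ℝ} {d' t c : ℝ} (h : HasDerivAt d d' t)
    (hc : c < t) (hpos : ∀ u ∈ Ioo c t, 0 < d u) (h0 : d t = 0) : d' ≤ 0 := by
  by_contra! hd
  have h1 := (hasDerivWithinAt_iff_tendsto_slope' (s := Iio t) (by simp)).1 h.hasDerivWithinAt
  obtain ⟨u, hu1, hu2⟩ := ((h1.eventually (lt_mem_nhds hd)).and (Ioo_mem_nhdsLT hc)).exists
  rw [slope_def_field, h0, sub_zero] at hu1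
  exact absurd hu1 (not_lt.2 (div_nonpos_of_nonneg_of_nonpos (hpos u hu2).le (by linarith [hu2.2])))

theorem HasDerivAt.nonneg_of_pos_right {d : ℝ → ℝ} {d' t c : ℝ} (h : HasDerivAt d d' t)
    (hc : t < c) (hpos : ∀ u ∈ Ioo t c, 0 < d u) (h0 : d t = 0) : 0 ≤ d' := by
  have h' : HasDerivAt (fun u => d (-u)) (-d') (-t) := by
    rw [← neg_neg t] at h
    exact (h.scomp (-t) (hasDerivAt_neg (-t))).congr_deriv (by simp)
  have := h'.nonpos_of_pos_left (c := -c) (by linarith)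
    (fun u hu => hpos (-u) ⟨by linarith [hu.2], by linarith [hu.1]⟩) (by simpa using h0)
  linarith

namespace IsScaledSolution

variable {s : ℝ} {x y : ℝ → ℝ}

theorem continuous_fst (h : IsScaledSolution s x y) : Continuous x :=
  continuous_iff_continuousAt.2 fun t => (h.1 t).continuousAt

theorem continuous_snd (h : IsScaledSolution s x y) : Continuous y :=
  continuous_iff_continuousAt.2 fun t => (h.2 t).continuousAt

protected theorem neg (h : IsScaledSolution s x y) :
    IsScaledSolution s (fun t => -x t) fun t => -y t :=
  ⟨fun t => (h.1 t).neg.congr_deriv (by ring), fun t => (h.2 t).neg.congr_deriv (by ring)⟩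

theorem comp_add_const (h : IsScaledSolution s x y) (c : ℝ) :
    IsScaledSolution s (fun t => x (t + c)) fun t => y (t + c) :=
  ⟨fun t => (h.1 (t + c)).comp_add_const t c, fun t => (h.2 (t + c)).comp_add_const t c⟩

theorem hasDerivAt_sub (h : IsScaledSolution s x y) (t : ℝ) :
    HasDerivAt (fun t => y t - x t) (y t ^ 5 - x t - s * (y t ^ 3 - x t ^ 3)) t :=
  (h.2 t).sub (h.1 t)

theorem hasDerivAt_pow_sub (h : IsScaledSolution s x y) (t : ℝ) :
    HasDerivAt (fun t => y t ^ 5 - x t)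
      (5 * y t ^ 4 * (y t ^ 5 - x t) - s * (y t ^ 3 - x t ^ 3)) t :=
  (((h.2 t).pow 5).sub (h.1 t)).congr_deriv (by push_cast; ring)

theorem eq_of_eq {x₁ y₁ x₂ y₂ : ℝ → ℝ} (h₁ : IsScaledSolution s x₁ y₁)
    (h₂ : IsScaledSolution s x₂ y₂) {t₀ : ℝ} (hx : x₁ t₀ = x₂ t₀) (hy : y₁ t₀ = y₂ t₀) (t : ℝ) :
    x₁ t = x₂ t ∧ y₁ t = y₂ t := by
  set v : ℝ × ℝ → ℝ × ℝ := fun p => (s * (p.2 ^ 3 - p.1 ^ 3), p.2 ^ 5 - p.1) with hv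
  have hvc : ContDiff ℝ 1 v := by fun_prop
  set a := min t t₀ - 1
  set b := max t t₀ + 1
  have hc : ∀ {x y : ℝ → ℝ}, IsScaledSolution s x y → Continuous fun t => (x t, y t) :=
    fun h => h.continuous_fst.prodMk h.continuous_snd
  obtain ⟨R, hR⟩ := (((isCompact_Icc (a := a) (b := b)).image (hc h₁)).union
    ((isCompact_Icc (a := a) (b := b)).image (hc h₂))).isBounded.subset_closedBall 0
  obtain ⟨K, hK⟩ := hvc.contDiffOn.exists_lipschitzOnWith one_ne_zero
    (convex_closedBall (0 : ℝ × ℝ) R) (isCompact_closedBall 0 R)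
  have := ODE_solution_unique_of_mem_Icc (v := fun _ => v) (s := fun _ => Metric.closedBall 0 R)
    (t₀ := t₀) (a := a) (b := b) (fun _ _ => hK)
    ⟨by linarith [min_le_right t t₀], by linarith [le_max_right t t₀]⟩
    (hc h₁).continuousOn (fun u _ => (h₁.1 u).prodMk (h₁.2 u))
    (fun u hu => hR (Or.inl ⟨u, Ioo_subset_Icc_self hu, rfl⟩))
    (hc h₂).continuousOn (fun u _ => (h₂.1 u).prodMk (h₂.2 u))
    (fun u hu => hR (Or.inr ⟨u, Ioo_subset_Icc_self hu, rfl⟩)) (Prod.ext hx hy)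
    (x := t) ⟨by linarith [min_le_left t t₀], by linarith [le_max_left t t₀]⟩
  exact Prod.ext_iff.1 this

/-- A solution passing through an equilibrium is constant. -/
theorem eq_const (h : IsScaledSolution s x y) {t₀ : ℝ} (hx : y t₀ = x t₀)
    (hy : x t₀ ^ 5 = x t₀) (t : ℝ) : x t = x t₀ ∧ y t = x t₀ :=
  h.eq_of_eq (t₀ := t₀) (x₂ := fun _ => x t₀) (y₂ := fun _ => x t₀)
    ⟨fun t => (hasDerivAt_const t _).congr_deriv (by ring),
      fun t => (hasDerivAt_const t _).congr_deriv (by rw [hy, sub_self])⟩ rfl hx t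

theorem fst_lt_one (h : IsScaledSolution s x y) (hs : 0 < s) {a b : ℝ} (ha : a ≤ 1) (hb : b ≤ 1)
    (hbot : Tendsto x atBot (nhds a)) (htop : Tendsto x atTop (nhds b)) (hne : ∃ t, x t ≠ 1)
    (t : ℝ) : x t < 1 := by
  have hle : ∀ t, x t ≤ 1 := by
    intro t₀
    by_contra! h0
    have hd : ∀ t, HasDerivAt (fun t => x t - 1) (s * (y t ^ 3 - x t ^ 3)) t := fun t =>
      (h.1 t).sub_const 1
    have hcub : ∀ {a b : ℝ}, a ≤ b → a ^ 3 ≤ b ^ 3 := fun hab =>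
      (Odd.strictMono_pow (by decide) : StrictMono fun z : ℝ => z ^ 3).monotone hab
    have hpow : ∀ z : ℝ, 1 < z → z < z ^ 5 := fun z hz => lt_self_pow₀ hz (by norm_num)
    rcases le_total (x t₀) (y t₀) with h1 | h1
    · have := forward_invariant hd h.hasDerivAt_sub (t₀ := t₀) (by linarith) (by linarith)
        (fun t _ _ h2 => mul_nonneg hs.le (sub_nonneg.2 (hcub (by linarith))))
        (fun t _ h2 h3 => by
          have h4 := hpow (x t) (by linarith)
          rw [show y t = x t by linarith]
          linarith)
      have := ge_of_tendsto htop ((eventually_ge_atTop t₀).mono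
        fun t ht => (by linarith [(this t ht).1] : x t₀ ≤ x t))
      linarith
    · have := backward_invariant hd (fun t => (h.hasDerivAt_sub t).neg) (t₀ := t₀) (by linarith)
        (by simp only [Pi.neg_apply]; linarith)
        (fun t _ _ h2 => mul_nonpos_of_nonneg_of_nonpos hs.le (sub_nonpos.2 (hcub (by
          simp only [Pi.neg_apply] at h2; linarith))))
        (fun t _ h2 h3 => by
          have h4 := hpow (x t) (by linarith)
          simp only [Pi.neg_apply] at h3
          rw [show y t = x t by linarith]
          linarith)
      have := ge_of_tendsto hbot ((eventually_le_atBot t₀).mono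
        fun t ht => (by linarith [(this t ht).1] : x t₀ ≤ x t))
      linarith
  refine (hle t).lt_of_ne fun h1 => ?_
  have h2 : s * (y t ^ 3 - x t ^ 3) = 0 := IsLocalMax.hasDerivAt_eq_zero
    (Filter.Eventually.of_forall fun u => (hle u).trans h1.ge) (h.1 t)
  have h3 : y t = x t := (Odd.strictMono_pow (by decide) : StrictMono fun z : ℝ => z ^ 3).injective
    (sub_eq_zero.1 ((mul_eq_zero.1 h2).resolve_left hs.ne'))
  obtain ⟨u, hu⟩ := hne
  exact hu ((h.eq_const h3 (by rw [h1, one_pow]) u).1.trans h1)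

theorem snd_lt_one (h : IsScaledSolution s x y) (hs : 0 < s) {a b : ℝ} (ha : a ≤ 1) (hb : b ≤ 1)
    (hbot : Tendsto y atBot (nhds a)) (htop : Tendsto y atTop (nhds b)) (hne : ∃ t, y t ≠ 1)
    (t : ℝ) : y t < 1 := by
  have hle : ∀ t, y t ≤ 1 := by
    intro t₀
    by_contra! h0
    have hd : ∀ t, HasDerivAt (fun t => y t - 1) (y t ^ 5 - x t) t := fun t => (h.2 t).sub_const 1
    have hcub : ∀ z : ℝ, 1 < z → z ^ 3 < (z ^ 5) ^ 3 := fun z hz => by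
      rw [← pow_mul]
      exact pow_lt_pow_right₀ hz (by norm_num)
    rcases le_total (x t₀) (y t₀ ^ 5) with h1 | h1
    · have := forward_invariant hd h.hasDerivAt_pow_sub (t₀ := t₀) (by linarith) (by linarith)
        (fun t _ _ h2 => h2)
        (fun t _ h2 h3 => by
          have h4 := hcub (y t) (by linarith)
          rw [h3, show x t = y t ^ 5 by linarith]
          nlinarith)
      have := ge_of_tendsto htop ((eventually_ge_atTop t₀).mono
        fun t ht => (by linarith [(this t ht).1] : y t₀ ≤ y t))
      linarith
    · have := backward_invariant hd (fun t => (h.hasDerivAt_pow_sub t).neg) (t₀ := t₀)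
        (by linarith) (by simp only [Pi.neg_apply]; linarith)
        (fun t _ _ h2 => by simp only [Pi.neg_apply] at h2; linarith)
        (fun t _ h2 h3 => by
          have h4 := hcub (y t) (by linarith)
          simp only [Pi.neg_apply] at h3
          rw [show y t ^ 5 - x t = 0 by linarith, show x t = y t ^ 5 by linarith]
          nlinarith)
      have := ge_of_tendsto hbot ((eventually_le_atBot t₀).mono
        fun t ht => (by linarith [(this t ht).1] : y t₀ ≤ y t))
      linarith
  refine (hle t).lt_of_ne fun h1 => ?_
  have h2 : y t ^ 5 - x t = 0 := IsLocalMax.hasDerivAt_eq_zero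
    (Filter.Eventually.of_forall fun u => (hle u).trans h1.ge) (h.2 t)
  rw [h1, one_pow] at h2
  have h3 : x t = 1 := by linarith
  obtain ⟨u, hu⟩ := hne
  exact hu ((h.eq_const (h1.trans h3.symm) (by rw [h3, one_pow]) u).2.trans h3)

end IsScaledSolution

/-- A solution of the scaled system connecting `(-1, -1)` to `(1, 1)`. -/
structure IsConnection (s : ℝ) (x y : ℝ → ℝ) : Prop extends IsScaledSolution s x y where
  fst_atBot : Tendsto x atBot (nhds (-1))
  snd_atBot : Tendsto y atBot (nhds (-1))
  fst_atTop : Tendsto x atTop (nhds 1)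
  snd_atTop : Tendsto y atTop (nhds 1)

namespace IsConnection

variable {s : ℝ} {x y : ℝ → ℝ}

theorem bounds (h : IsConnection s x y) (hs : 0 < s) (t : ℝ) :
    x t ∈ Ioo (-1 : ℝ) 1 ∧ y t ∈ Ioo (-1 : ℝ) 1 := by
  refine ⟨⟨neg_lt.1 ?_, ?_⟩, ⟨neg_lt.1 ?_, ?_⟩⟩
  · exact h.neg.fst_lt_one hs (by norm_num) (by norm_num) h.fst_atBot.neg h.fst_atTop.neg
      (h.fst_atTop.neg.eventually_ne (by norm_num)).exists t
  · exact h.fst_lt_one hs (by norm_num) (by norm_num) h.fst_atBot h.fst_atTop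
      (h.fst_atBot.eventually_ne (by norm_num)).exists t
  · exact h.neg.snd_lt_one hs (by norm_num) (by norm_num) h.snd_atBot.neg h.snd_atTop.neg
      (h.snd_atTop.neg.eventually_ne (by norm_num)).exists t
  · exact h.snd_lt_one hs (by norm_num) (by norm_num) h.snd_atBot h.snd_atTop
      (h.snd_atBot.eventually_ne (by norm_num)).exists t

/-- A connection does not meet a closed orbit. -/
theorem not_periodic (h : IsConnection s x y) {T : ℝ} (hT : 0 < T) :
    ¬ Function.Periodic x T := by
  intro hp
  have h1 : ∀ t, x t = 1 := fun t => by
    refine tendsto_nhds_unique (f := fun n : ℕ => x (t + n * T)) (l := atTop) ?_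
      (h.fst_atTop.comp ?_)
    · exact tendsto_const_nhds.congr fun n => (hp.nat_mul n t).symm
    · exact tendsto_atTop_add_const_left _ _ (tendsto_natCast_atTop_atTop.atTop_mul_const hT)
  have := tendsto_nhds_unique h.fst_atBot (tendsto_const_nhds.congr fun t => (h1 t).symm)
  norm_num at this

theorem injective (h : IsConnection s x y) {t u : ℝ} (hx : x t = x u) (hy : y t = y u) :
    t = u := by
  have key : ∀ {t u : ℝ}, x t = x u → y t = y u → ¬ t < u := by
    intro t u hx hy htu
    refine h.not_periodic (sub_pos.2 htu) fun v => ?_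
    have := ((h.comp_add_const (u - t)).eq_of_eq h.toIsScaledSolution (t₀ := t) (by simp [hx])
      (by simp [hy]) v).1
    exact this
  exact le_antisymm (not_lt.1 (key hx.symm hy.symm)) (not_lt.1 (key hx hy))

theorem fst_lt_snd_of_neg (h : IsConnection s x y) (hs : 0 < s) {t₀ : ℝ}
    (h0 : ∀ t ≤ t₀, x t < 0) : x t₀ < y t₀ := by
  by_contra! hle
  have := backward_invariant (t₀ := t₀) (fun t => (h.1.1 t).add_const 1)
    (fun t => (h.hasDerivAt_sub t).neg) (by linarith [(h.bounds hs t₀).1.1])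
    (by simp only [Pi.neg_apply]; linarith)
    (fun t _ _ h2 => mul_nonpos_of_nonneg_of_nonpos hs.le (sub_nonpos.2
      ((Odd.strictMono_pow (by decide) : StrictMono fun z : ℝ => z ^ 3).monotone
        (by simp only [Pi.neg_apply] at h2; linarith))))
    (fun t ht h2 h3 => by
      have h4 := h0 t ht
      simp only [Pi.neg_apply] at h3
      rw [show y t = x t by linarith]
      have : x t ^ 4 < 1 := by
        rw [← (show Even 4 by decide).neg_pow]
        exact pow_lt_one₀ (by linarith) (by linarith) (by norm_num)
      nlinarith)
  have h1 := ge_of_tendsto h.fst_atBot ((eventually_le_atBot t₀).mono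
    fun t ht => (by linarith [(this t ht).1] : x t₀ ≤ x t))
  linarith [(h.bounds hs t₀).1.1]

/-- Where `y ^ 5 ≤ x` and `0 < y < 1`, the ordinate can only increase back to `1` by crossing the
diagonal. -/
theorem not_pow_le (h : IsConnection s x y) (hs : 0 < s) {t₀ : ℝ} (h0 : y t₀ ^ 5 ≤ x t₀)
    (hlt : ∀ t ≥ t₀, x t = y t ^ 5 → x t < y t) : False := by
  have h1 := (h.bounds hs t₀).2.2
  have := forward_invariant (t₀ := t₀) (fun t => (h.1.2 t).const_sub 1)
    (fun t => (h.hasDerivAt_pow_sub t).neg) (by linarith) (by simp only [Pi.neg_apply]; linarith)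
    (fun t _ _ h2 => by simp only [Pi.neg_apply] at h2; linarith)
    (fun t ht _ h3 => by
      simp only [Pi.neg_apply] at h3
      have h4 := mul_pos hs (cube_sub_pos (hlt t ht (by linarith)))
      rw [show y t ^ 5 - x t = 0 by linarith]
      linarith)
  have h2 := le_of_tendsto h.snd_atTop ((eventually_ge_atTop t₀).mono
    fun t ht => (by linarith [(this t ht).1] : y t ≤ y t₀))
  linarith

theorem fst_lt_snd (h : IsConnection s x y) (hs : 0 < s) (t : ℝ) : x t < y t := by
  obtain ⟨T₀, hT₀⟩ := eventually_atBot.1 (h.fst_atBot.eventually (gt_mem_nhds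
    (by norm_num : (-1 : ℝ) < 0)))
  obtain ⟨T₁, hT₁⟩ := eventually_atTop.1 (h.snd_atTop.eventually (lt_mem_nhds
    (by norm_num : (0 : ℝ) < 1)))
  have hbot : ∀ t ≤ T₀, x t < y t := fun t ht =>
    h.fst_lt_snd_of_neg hs fun u hu => hT₀ u (hu.trans ht)
  have htop : ∀ t ≥ T₁, x t < y t := by
    intro t ht
    have hy : ∀ u ≥ t, y u ^ 5 < y u := fun u hu =>
      pow_lt_self_of_lt_one₀ (hT₁ u (ht.le.trans hu)) (h.bounds hs u).2.2 (by norm_num)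
    by_contra! hle
    exact h.not_pow_le hs ((hy t le_rfl).le.trans hle) fun u hu hxy => hxy.trans_lt (hy u hu)
  by_contra! hle
  have hcx := h.continuous_fst
  have hcy := h.continuous_snd
  have hcl : IsClosed {u | y u ≤ x u} := isClosed_le hcy hcx
  have hbb : BddBelow {u | y u ≤ x u} := ⟨T₀, fun u hu => by
    by_contra! h'; exact absurd hu (not_le.2 (hbot u h'.le))⟩
  have hba : BddAbove {u | y u ≤ x u} := ⟨T₁, fun u hu => by
    by_contra! h'; exact absurd hu (not_le.2 (htop u h'.le))⟩
  set t₁ := sInf {u | y u ≤ x u}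
  set t₂ := sSup {u | y u ≤ x u}
  have h12 : t₁ ≤ t₂ := (csInf_le hbb hle).trans (le_csSup hba hle)
  have hlt₁ : ∀ u < t₁, x u < y u := fun u hu => by
    by_contra! h'; exact absurd (csInf_le hbb h') (not_le.2 hu)
  have hlt₂ : ∀ u > t₂, x u < y u := fun u hu => by
    by_contra! h'; exact absurd (le_csSup hba h') (not_le.2 hu)
  have he₁ : y t₁ = x t₁ := (hcl.csInf_mem ⟨t, hle⟩ hbb).antisymm <|
    ge_of_tendsto ((hcy.sub hcx).tendsto t₁ |>.mono_left nhdsWithin_le_nhds)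
      (eventually_nhdsWithin_of_forall (s := Iio t₁) fun u hu => (sub_pos.2 (hlt₁ u hu)).le)
      |> sub_nonneg.1
  have he₂ : y t₂ = x t₂ := (hcl.csSup_mem ⟨t, hle⟩ hba).antisymm <|
    ge_of_tendsto ((hcy.sub hcx).tendsto t₂ |>.mono_left nhdsWithin_le_nhds)
      (eventually_nhdsWithin_of_forall (s := Ioi t₂) fun u hu => (sub_pos.2 (hlt₂ u hu)).le)
      |> sub_nonneg.1
  have hne : ∀ u, y u = x u → x u ^ 5 ≠ x u := fun u hu h5 => by
    have h0 := h.eq_const hu h5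
    have := tendsto_nhds_unique h.fst_atBot
      (tendsto_const_nhds.congr fun t => (h0 t).1.symm)
    linarith [(h.bounds hs u).1.1]
  have hsign : ∀ z : ℝ, z ∈ Ioo (-1 : ℝ) 1 → z < 0 → z < z ^ 5 := fun z hz hz0 => by
    have : z ^ 4 < 1 := by
      rw [← (show Even 4 by decide).neg_pow]
      exact pow_lt_one₀ (by linarith) (by linarith [hz.1]) (by norm_num)
    nlinarith
  have hq : 0 < x t₁ := by
    have h1 := (h.hasDerivAt_sub t₁).nonpos_of_pos_left (sub_one_lt t₁)
      (fun u hu => sub_pos.2 (hlt₁ u hu.2)) (sub_eq_zero.2 he₁)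
    rw [he₁] at h1
    rcases lt_trichotomy (x t₁) 0 with h0 | h0 | h0
    · linarith [hsign _ (h.bounds hs t₁).1 h0]
    · exact absurd (by rw [h0]; norm_num) (hne t₁ he₁)
    · exact h0
  have hp : x t₂ < 0 := by
    have h1 := (h.hasDerivAt_sub t₂).nonneg_of_pos_right (lt_add_one t₂)
      (fun u hu => sub_pos.2 (hlt₂ u hu.1)) (sub_eq_zero.2 he₂)
    rw [he₂] at h1
    rcases lt_trichotomy (x t₂) 0 with h0 | h0 | h0
    · exact h0
    · exact absurd (by rw [h0]; norm_num) (hne t₂ he₂)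
    · linarith [pow_lt_self_of_lt_one₀ h0 (h.bounds hs t₂).1.2 (by norm_num : 1 < 5)]
  have hmono : ∀ {S : Set ℝ}, Convex ℝ S → (∀ u ∈ interior S, x u < y u) → StrictMonoOn x S :=
    fun hS hlt => strictMonoOn_of_deriv_pos hS hcx.continuousOn fun u hu => by
      rw [(h.1.1 u).deriv]
      exact mul_pos hs (cube_sub_pos (hlt u hu))
  have hm₁ : StrictMonoOn x (Iic t₁) := hmono (convex_Iic _) fun u hu =>
    hlt₁ u (by simpa using hu)
  have hm₂ : StrictMonoOn x (Ici t₂) := hmono (convex_Ici _) fun u hu =>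
    hlt₂ u (by simpa using hu)
  obtain ⟨ta, hta, hxa⟩ : ∃ ta ∈ Iic t₁, x ta = x t₂ := by
    obtain ⟨v, hv, hv1⟩ := ((h.fst_atBot.eventually (gt_mem_nhds (h.bounds hs t₂).1.1)).and
      (eventually_le_atBot t₁)).exists
    obtain ⟨w, hw, hw'⟩ := intermediate_value_Icc hv1 hcx.continuousOn ⟨hv.le, (hp.trans hq).le⟩
    exact ⟨w, hw.2, hw'⟩
  obtain ⟨tb, htb, hxb⟩ : ∃ tb ∈ Ici t₂, x tb = x t₁ := by
    obtain ⟨v, hv, hv1⟩ := ((h.fst_atTop.eventually (lt_mem_nhds (h.bounds hs t₁).1.2)).and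
      (eventually_ge_atTop t₂)).exists
    obtain ⟨w, hw, hw'⟩ := intermediate_value_Icc hv1 hcx.continuousOn ⟨(hp.trans hq).le, hv.le⟩
    exact ⟨w, hw.1, hw'⟩
  have hta' : ta < t₁ := lt_of_le_of_ne hta fun he => by rw [he] at hxa; linarith
  have htb' : t₂ < tb := lt_of_le_of_ne htb fun he => by rw [← he] at hxb; linarith
  obtain ⟨τ, hτc, hτ⟩ := exists_continuousOn_leftInverse ordConnected_Ici hcx.continuousOn hm₂
  have himg : ∀ u ∈ Icc ta t₁, ∃ w ∈ Ici t₂, x w = x u := by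
    intro u hu
    obtain ⟨w, hw, hw'⟩ := intermediate_value_Icc htb'.le hcx.continuousOn (show x u ∈ _ from
      ⟨by rw [← hxa]; exact hm₁.monotoneOn hta hu.2 hu.1,
        by rw [hxb]; exact hm₁.monotoneOn hu.2 self_mem_Iic hu.2⟩)
    exact ⟨w, hw.1, hw'⟩
  have hhc : ContinuousOn (fun u => y u - y (τ (x u))) (Icc ta t₁) :=
    hcy.continuousOn.sub (hcy.comp_continuousOn (hτc.comp hcx.continuousOn himg))
  have hτa : τ (x ta) = t₂ := by rw [hxa, hτ _ self_mem_Ici]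
  have hτb : τ (x t₁) = tb := by rw [← hxb, hτ _ htb]
  obtain ⟨u, hu, hu0⟩ := intermediate_value_Icc' hta hhc (show (0 : ℝ) ∈ _ from
    ⟨by rw [hτb]; linarith [hlt₂ tb htb'], by rw [hτa]; linarith [hlt₁ ta hta']⟩)
  obtain ⟨w, hw, hwu⟩ := himg u hu
  simp only [← hwu, hτ w hw] at hu0
  have huw : u = w := h.injective hwu.symm (by linarith)
  have : u = t₁ := le_antisymm hu.2 (h12.trans (huw ▸ hw))
  have : w = t₂ := by linarith [mem_Ici.1 hw]
  rw [‹w = t₂›, ‹u = t₁›] at hwu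
  linarith

theorem fst_lt_pow (h : IsConnection s x y) (hs : 0 < s) (t : ℝ) : x t < y t ^ 5 := by
  by_contra! hle
  exact h.not_pow_le hs hle fun u _ _ => h.fst_lt_snd hs u

/-- The orbit of a connection is a profile. -/
theorem exists_profile (h : IsConnection s x y) (hs : 0 < s) :
    ∃ f, IsProfile s f ∧ (∀ t, f (x t) = y t) ∧ range x = Ioo (-1) 1 := by
  have hcx := h.continuous_fst
  have hmono : StrictMono x := strictMono_of_deriv_pos fun t => by
    rw [(h.1.1 t).deriv]
    exact mul_pos hs (cube_sub_pos (h.fst_lt_snd hs t))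
  have hrange : range x = Ioo (-1) 1 := by
    refine Subset.antisymm (range_subset_iff.2 fun t => (h.bounds hs t).1) fun z hz => ?_
    exact mem_range_of_exists_le_of_exists_ge hcx
      ((h.fst_atBot.eventually (gt_mem_nhds hz.1)).exists.imp fun _ => le_of_lt)
      ((h.fst_atTop.eventually (lt_mem_nhds hz.2)).exists.imp fun _ => le_of_lt)
  obtain ⟨τ, hτc, hτ⟩ := exists_continuousOn_leftInverse ordConnected_univ hcx.continuousOn
    (hmono.strictMonoOn univ)
  rw [image_univ, hrange] at hτc
  have hτ : ∀ t, τ (x t) = t := fun t => hτ t (mem_univ t)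
  have hsurj : ∀ z ∈ Ioo (-1 : ℝ) 1, ∃ t, x t = z := fun z hz => by rwa [← hrange] at hz
  have hbot : Tendsto τ (nhdsWithin (-1) (Ioi (-1))) atBot := by
    refine tendsto_atBot.2 fun b => Filter.eventually_of_mem
      (Ioo_mem_nhdsGT (h.bounds hs b).1.1) fun z hz => ?_
    obtain ⟨t, rfl⟩ := hsurj z ⟨hz.1, hz.2.trans (h.bounds hs b).1.2⟩
    rw [hτ]
    exact (hmono.lt_iff_lt.1 hz.2).le
  have htop : Tendsto τ (nhdsWithin 1 (Iio 1)) atTop := by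
    refine tendsto_atTop.2 fun b => Filter.eventually_of_mem
      (Ioo_mem_nhdsLT (h.bounds hs b).1.2) fun z hz => ?_
    obtain ⟨t, rfl⟩ := hsurj z ⟨(h.bounds hs b).1.1.trans hz.1, hz.2⟩
    rw [hτ]
    exact (hmono.lt_iff_lt.1 hz.1).le
  refine ⟨fun z => y (τ z), ⟨?_, ?_, ?_, h.snd_atBot.comp hbot, h.snd_atTop.comp htop⟩,
    fun t => congrArg y (hτ t), hrange⟩
  · intro z hz
    obtain ⟨t, rfl⟩ := hsurj z hz
    rw [hτ]
    exact h.fst_lt_snd hs t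
  · intro z hz
    obtain ⟨t, rfl⟩ := hsurj z hz
    rw [hτ]
    exact h.fst_lt_pow hs t
  · intro z hz
    have hev : ∀ᶠ w in nhds z, x (τ w) = w :=
      Filter.eventually_of_mem (Ioo_mem_nhds hz.1 hz.2) fun w hw => by
        obtain ⟨t, rfl⟩ := hsurj w hw
        rw [hτ]
    obtain ⟨t, rfl⟩ := hsurj z hz
    have hpos := mul_pos hs (cube_sub_pos (h.fst_lt_snd hs t))
    have hd := HasDerivAt.of_local_left_inverse (f := x) (g := τ) (a := x t)
      (hτc.continuousAt (Ioo_mem_nhds hz.1 hz.2)) (by rw [hτ]; exact h.1.1 t) hpos.ne' hev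
    refine (((h.1.2 (τ (x t))).comp (x t) hd)).congr_deriv ?_
    rw [hτ, orbitSlope, div_eq_mul_inv]

end IsConnection

/-- Leibniz rule for the integral of `H` over a moving vertical segment. -/
theorem hasDerivAt_integral_segment {U : Set (ℝ × ℝ)} (hU : IsOpen U) {H H' : ℝ → ℝ → ℝ}
    (hH : ContinuousOn (fun p : ℝ × ℝ => H p.1 p.2) U)
    (hH' : ContinuousOn (fun p : ℝ × ℝ => H' p.1 p.2) U)
    (hd : ∀ p ∈ U, HasDerivAt (fun z => H z p.2) (H' p.1 p.2) p.1)
    {ξ a b : ℝ → ℝ} {ξ' a' b' t : ℝ} (hξ : HasDerivAt ξ ξ' t) (ha : HasDerivAt a a' t)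
    (hb : HasDerivAt b b' t) (hab : a t ≤ b t) (hseg : ∀ w ∈ Icc (a t) (b t), (ξ t, w) ∈ U) :
    HasDerivAt (fun u => ∫ w in a u..b u, H (ξ u) w)
      ((∫ w in a t..b t, H' (ξ t) w) * ξ' + (H (ξ t) (b t) * b' - H (ξ t) (a t) * a')) t := by
  obtain ⟨δ, hδ, hbox⟩ : ∃ δ > 0, Icc (ξ t - δ) (ξ t + δ) ×ˢ Icc (a t - δ) (b t + δ) ⊆ U := by
    obtain ⟨δ, hδ, h⟩ := ((isCompact_singleton (x := ξ t)).prod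
      (isCompact_Icc (a := a t) (b := b t))).exists_cthickening_subset_open hU (by
        rintro ⟨z, w⟩ ⟨rfl, hw⟩; exact hseg w hw)
    refine ⟨δ, hδ, fun p hp => h (Metric.mem_cthickening_of_dist_le p
      (ξ t, max (a t) (min (b t) p.2)) δ _ ⟨rfl, le_max_left _ _, max_le hab (min_le_left _ _)⟩ ?_)⟩
    obtain ⟨⟨h1, h2⟩, h3, h4⟩ := hp
    rw [Prod.dist_eq, Real.dist_eq, Real.dist_eq]
    refine max_le (abs_le.2 ⟨by linarith, by linarith⟩) (abs_le.2 ?_)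
    rcases max_cases (a t) (min (b t) p.2) with h5 | h5 <;>
      rcases min_cases (b t) p.2 with h6 | h6 <;> constructor <;> simp only <;> linarith
  set R := Icc (ξ t - δ) (ξ t + δ) ×ˢ Icc (a t - δ) (b t + δ) with hR
  have hRc : IsCompact R := isCompact_Icc.prod isCompact_Icc
  have hsec : ∀ {F : ℝ → ℝ → ℝ}, ContinuousOn (fun p : ℝ × ℝ => F p.1 p.2) U →
      ∀ z ∈ Icc (ξ t - δ) (ξ t + δ), ContinuousOn (F z) (Icc (a t - δ) (b t + δ)) :=
    fun hF z hz => hF.comp (f := fun w => (z, w)) (by fun_prop) fun w hw => hbox ⟨hz, hw⟩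
  have hInt : ∀ {F : ℝ → ℝ → ℝ}, ContinuousOn (fun p : ℝ × ℝ => F p.1 p.2) U →
      ∀ z ∈ Icc (ξ t - δ) (ξ t + δ), ∀ c ∈ Icc (a t - δ) (b t + δ),
      ∀ d ∈ Icc (a t - δ) (b t + δ), IntervalIntegrable (F z) MeasureTheory.volume c d :=
    fun hF z hz c hc d hd =>
      ((hsec hF z hz).mono (ordConnected_Icc.uIcc_subset hc hd)).intervalIntegrable
  have ha0 : a t ∈ Icc (a t - δ) (b t + δ) := ⟨by linarith, by linarith⟩
  have hb0 : b t ∈ Icc (a t - δ) (b t + δ) := ⟨by linarith, by linarith⟩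
  have hξ0 : Icc (ξ t - δ) (ξ t + δ) ∈ nhds (ξ t) := Icc_mem_nhds (by linarith) (by linarith)
  have hξt := mem_of_mem_nhds hξ0
  have hsub : Icc (a t) (b t) ⊆ Icc (a t - δ) (b t + δ) :=
    Icc_subset_Icc (by linarith) (by linarith)
  -- fixed endpoints
  have hfix : HasDerivAt (fun z => ∫ w in a t..b t, H z w) (∫ w in a t..b t, H' (ξ t) w) (ξ t) := by
    obtain ⟨C, hC⟩ := hRc.exists_bound_of_continuousOn (hH'.mono hbox)
    have hI : uIoc (a t) (b t) ⊆ Icc (a t - δ) (b t + δ) :=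
      uIoc_subset_uIcc.trans (by rwa [uIcc_of_le hab])
    refine (intervalIntegral.hasDerivAt_integral_of_dominated_loc_of_deriv_le (F' := H')
      (bound := fun _ => C) hξ0 ?_ (hInt hH _ hξt _ ha0 _ hb0)
      (hInt hH' _ hξt _ ha0 _ hb0).aestronglyMeasurable_restrict_uIoc ?_
      intervalIntegrable_const ?_).2
    · filter_upwards [hξ0] with z hz
      exact (hInt hH z hz _ ha0 _ hb0).aestronglyMeasurable_restrict_uIoc
    · exact Filter.Eventually.of_forall fun w hw z hz => hC (z, w) ⟨hz, hI hw⟩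
    · exact Filter.Eventually.of_forall fun w hw z hz => hd (z, w) (hbox ⟨hz, hI hw⟩)
  -- one moving endpoint
  have hend : ∀ {c : ℝ → ℝ} {c' : ℝ}, HasDerivAt c c' t → c t ∈ Icc (a t) (b t) →
      HasDerivAt (fun u => ∫ w in c t..c u, H (ξ u) w) (H (ξ t) (c t) * c') t := by
    intro c c' hc hct
    have hcb : Icc (a t - δ) (b t + δ) ∈ nhds (c t) :=
      Icc_mem_nhds (by linarith [hct.1]) (by linarith [hct.2])
    have hrem : (fun u => ∫ w in c t..c u, (H (ξ u) w - H (ξ t) (c t))) =o[nhds t]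
        fun u => c u - c t := by
      refine Asymptotics.isLittleO_iff.2 fun ε hε => ?_
      have hcont := (hH.continuousAt (hU.mem_nhds (hseg _ hct))).eventually
        (Metric.ball_mem_nhds _ hε)
      obtain ⟨ρ, hρ, hball⟩ := Metric.eventually_nhds_iff_ball.1 hcont
      filter_upwards [hξ.continuousAt.eventually (Metric.ball_mem_nhds _ hρ),
        hc.continuousAt.eventually (Metric.ball_mem_nhds _ hρ)] with u h1 h2
      refine intervalIntegral.norm_integral_le_of_norm_le_const fun w hw => ?_
      have hw' : w ∈ Metric.ball (c t) ρ := by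
        rw [← Metric.mem_ball, Real.ball_eq_Ioo] at h2
        rw [Real.ball_eq_Ioo]
        exact ordConnected_Ioo.uIcc_subset ⟨by linarith, by linarith⟩ h2 (uIoc_subset_uIcc hw)
      have := hball (ξ u, w) (by
        rw [← ball_prod_same]; exact ⟨h1, hw'⟩)
      exact (dist_eq_norm (H (ξ u) w) _ ▸ this).le
    have hev : (fun u => (∫ w in c t..c u, (H (ξ u) w - H (ξ t) (c t))) +
        H (ξ t) (c t) * (c u - c t - (u - t) • c')) =ᶠ[nhds t] fun u =>
        (∫ w in c t..c u, H (ξ u) w) - (∫ w in c t..c t, H (ξ t) w) -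
          (u - t) • (H (ξ t) (c t) * c') := by
      filter_upwards [hξ.continuousAt.eventually hξ0, hc.continuousAt.eventually hcb] with u h1 h2
      rw [intervalIntegral.integral_sub (hInt hH _ h1 _ (hsub hct) _ h2) intervalIntegrable_const,
        intervalIntegral.integral_const, intervalIntegral.integral_same]
      simp only [smul_eq_mul]
      ring
    rw [hasDerivAt_iff_isLittleO]
    exact ((hrem.trans_isBigO hc.isBigO_sub).add (hc.isLittleO.const_mul_left _)).congr'
      hev Filter.EventuallyEq.rfl
  refine ((((hfix.comp t hξ).add (hend hb ⟨hab, le_rfl⟩)).sub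
    (hend ha ⟨le_rfl, hab⟩)).congr_of_eventuallyEq ?_).congr_deriv (by ring)
  filter_upwards [hξ.continuousAt.eventually hξ0,
    ha.continuousAt.eventually (Icc_mem_nhds (by linarith) (by linarith) :
      Icc (a t - δ) (b t + δ) ∈ nhds (a t)),
    hb.continuousAt.eventually (Icc_mem_nhds (by linarith) (by linarith) :
      Icc (a t - δ) (b t + δ) ∈ nhds (b t))] with u h1 h2 h3
  have e1 := intervalIntegral.integral_add_adjacent_intervals (hInt hH _ h1 _ h2 _ ha0)
    (hInt hH _ h1 _ ha0 _ hb0)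
  have e2 := intervalIntegral.integral_add_adjacent_intervals (hInt hH _ h1 _ h2 _ hb0)
    (hInt hH _ h1 _ hb0 _ h3)
  have e3 := intervalIntegral.integral_symm (f := H (ξ u)) (μ := MeasureTheory.volume) (a u) (a t)
  simp only [Pi.add_apply, Pi.sub_apply, Function.comp_apply]
  linarith

/-- The denominator of the Dulac function, for the parameter `s = 27 / 20 * α ^ 2`. -/
def dulacBase (α x y : ℝ) : ℝ := dulac.eval (α * x) (α * y)

/-- First component of the scaled field times the Dulac function. -/
def dulacFst (α x y : ℝ) : ℝ := 27 / 20 * α ^ 2 * (y ^ 3 - x ^ 3) / dulacBase α x y ^ 3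

/-- Second component of the scaled field times the Dulac function. -/
def dulacSnd (α x y : ℝ) : ℝ := (y ^ 5 - x) / dulacBase α x y ^ 3

def dulacFstDeriv (α x y : ℝ) : ℝ :=
  27 / 20 * α ^ 2 * (-3 * x ^ 2) / dulacBase α x y ^ 3 -
    3 * (27 / 20 * α ^ 2 * (y ^ 3 - x ^ 3)) * (α * dulac.derivX.eval (α * x) (α * y)) /
      dulacBase α x y ^ 4

def dulacSndDeriv (α x y : ℝ) : ℝ :=
  5 * y ^ 4 / dulacBase α x y ^ 3 -
    3 * (y ^ 5 - x) * (α * dulac.derivY.eval (α * x) (α * y)) / dulacBase α x y ^ 4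

theorem dulacBase_neg (α x y : ℝ) : dulacBase α (-x) (-y) = dulacBase α x y := by
  simp only [dulacBase, dulac, ofMonomials, List.foldr, PolyExpr.eval]
  push_cast
  ring

theorem dulacSnd_neg (α x y : ℝ) : dulacSnd α (-x) (-y) = -dulacSnd α x y := by
  rw [dulacSnd, dulacSnd, dulacBase_neg]
  ring

theorem continuous_dulacBase (α : ℝ) : Continuous fun p : ℝ × ℝ => dulacBase α p.1 p.2 :=
  dulac.continuous_eval.comp (f := fun p : ℝ × ℝ => (α * p.1, α * p.2)) (by fun_prop)

theorem dulacBase_pos {α x y : ℝ} (hα : 0 < α) (hα1 : α ≤ 1) (hx : |x| ≤ 1) (hy : |y| ≤ 1)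
    (h0 : x ≠ 0 ∨ y ≠ 0) : 0 < dulacBase α x y := by
  have habs : ∀ {z : ℝ}, |z| ≤ 1 → |α * z| ≤ 1 := fun hz => by
    rw [abs_mul, abs_of_pos hα]
    exact mul_le_one₀ hα1 (abs_nonneg _) hz
  exact dulac_pos (habs hx) (habs hy) (h0.imp (mul_ne_zero hα.ne') (mul_ne_zero hα.ne'))

theorem hasDerivAt_dulacFst {α x y : ℝ} (h : dulacBase α x y ≠ 0) :
    HasDerivAt (fun z => dulacFst α z y) (dulacFstDeriv α x y) x := by
  have hb : HasDerivAt (fun z => dulacBase α z y) (α * dulac.derivX.eval (α * x) (α * y)) x :=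
    (PolyExpr.hasDerivAt_comp ((hasDerivAt_id x).const_mul α) (hasDerivAt_const x (α * y))
      dulac).congr_deriv (by simp only [id]; ring)
  refine (((((hasDerivAt_pow 3 x).const_sub (y ^ 3)).const_mul (27 / 20 * α ^ 2))).div (hb.pow 3)
    (pow_ne_zero 3 h)).congr_deriv ?_
  rw [dulacFstDeriv]
  simp only [Pi.pow_apply]
  field_simp
  push_cast
  ring

theorem hasDerivAt_dulacSnd {α x y : ℝ} (h : dulacBase α x y ≠ 0) :
    HasDerivAt (fun w => dulacSnd α x w) (dulacSndDeriv α x y) y := by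
  have hb : HasDerivAt (fun w => dulacBase α x w) (α * dulac.derivY.eval (α * x) (α * y)) y :=
    (PolyExpr.hasDerivAt_comp (hasDerivAt_const y (α * x)) ((hasDerivAt_id y).const_mul α)
      dulac).congr_deriv (by simp only [id]; ring)
  refine (((hasDerivAt_pow 5 y).sub_const x).div (hb.pow 3) (pow_ne_zero 3 h)).congr_deriv ?_
  rw [dulacSndDeriv]
  simp only [Pi.pow_apply]
  field_simp
  push_cast
  ring

theorem continuousOn_dulacFst (α : ℝ) :
    ContinuousOn (fun p : ℝ × ℝ => dulacFst α p.1 p.2) {p | 0 < dulacBase α p.1 p.2} :=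
  ContinuousOn.div (by fun_prop) ((continuous_dulacBase α).pow 3).continuousOn
    fun _ hp => pow_ne_zero 3 hp.ne'

theorem continuousOn_dulacFstDeriv (α : ℝ) :
    ContinuousOn (fun p : ℝ × ℝ => dulacFstDeriv α p.1 p.2) {p | 0 < dulacBase α p.1 p.2} := by
  have h := dulac.derivX.continuous_eval.comp (f := fun p : ℝ × ℝ => (α * p.1, α * p.2))
    (by fun_prop)
  exact (ContinuousOn.div (by fun_prop) ((continuous_dulacBase α).pow 3).continuousOn
    fun _ hp => pow_ne_zero 3 hp.ne').sub (ContinuousOn.div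
    ((Continuous.mul (by fun_prop) (h.const_mul α)).continuousOn)
    ((continuous_dulacBase α).pow 4).continuousOn fun _ hp => pow_ne_zero 4 hp.ne')

theorem continuousOn_dulacSndDeriv (α : ℝ) :
    ContinuousOn (fun p : ℝ × ℝ => dulacSndDeriv α p.1 p.2) {p | 0 < dulacBase α p.1 p.2} := by
  have h := dulac.derivY.continuous_eval.comp (f := fun p : ℝ × ℝ => (α * p.1, α * p.2))
    (by fun_prop)
  exact (ContinuousOn.div (by fun_prop) ((continuous_dulacBase α).pow 3).continuousOn
    fun _ hp => pow_ne_zero 3 hp.ne').sub (ContinuousOn.div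
    ((Continuous.mul (by fun_prop) (h.const_mul α)).continuousOn)
    ((continuous_dulacBase α).pow 4).continuousOn fun _ hp => pow_ne_zero 4 hp.ne')

/-- The divergence of the scaled field times the Dulac function is positive. -/
theorem dulac_div_pos {α x y : ℝ} (hα : 0 < α) (hα1 : α ≤ 1) (hα2 : 53 / 54 ≤ α ^ 2)
    (hx : |x| ≤ 1) (hy : |y| ≤ 1) (h0 : x ≠ 0 ∨ y ≠ 0) :
    0 < dulacFstDeriv α x y + dulacSndDeriv α x y := by
  have hb := dulacBase_pos hα hα1 hx hy h0
  have habs : ∀ {z : ℝ}, |z| ≤ 1 → |α * z| ≤ 1 := fun hz => by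
    rw [abs_mul, abs_of_pos hα]
    exact mul_le_one₀ hα1 (abs_nonneg _) hz
  have h4 : 0 < α ^ 4 := by positivity
  have hμ : (α ^ 4)⁻¹ * α ^ 4 = 1 := inv_mul_cancel₀ h4.ne'
  have key := dulac_defect (habs hx) (habs hy) (h0.imp (mul_ne_zero hα.ne') (mul_ne_zero hα.ne'))
    (μ := (α ^ 4)⁻¹) ((one_le_inv₀ h4).2 (pow_le_one₀ hα.le hα1))
    (by rw [inv_le_comm₀ h4 (by norm_num)]; nlinarith)
  have e : dulacFstDeriv α x y + dulacSndDeriv α x y =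
      (dulac.eval (α * x) (α * y) * (-(81 / 20) * (α * x) ^ 2 + 5 * (α ^ 4)⁻¹ * (α * y) ^ 4) -
        3 * (dulac.derivX.eval (α * x) (α * y) * (27 / 20 * ((α * y) ^ 3 - (α * x) ^ 3)) +
          dulac.derivY.eval (α * x) (α * y) * ((α ^ 4)⁻¹ * (α * y) ^ 5 - α * x))) /
        dulacBase α x y ^ 4 := by
    rw [dulacFstDeriv, dulacSndDeriv]
    have : dulac.eval (α * x) (α * y) = dulacBase α x y := rfl
    rw [this]
    field_simp
    ring
  rw [e]
  exact div_pos (sub_pos.2 key) (by positivity)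

namespace IsProfile

variable {α : ℝ} {f : ℝ → ℝ}

theorem hasDerivAt_flux (hα : 0 < α) (hα1 : α ≤ 1) (hα2 : 53 / 54 ≤ α ^ 2)
    (hf : IsProfile (27 / 20 * α ^ 2) f) {ξ a : ℝ → ℝ} {ξ' a' t : ℝ} (hξ : HasDerivAt ξ ξ' t)
    (ha : HasDerivAt a a' t) (hξt : ξ t ∈ Ioo (-1 : ℝ) 1) (hat : -1 ≤ a t) (hlt : a t < f (ξ t))
    (h0 : ξ t ≠ 0 ∨ 0 < a t) :
    ∃ D > 0, HasDerivAt (fun u => ∫ w in a u..f (ξ u), dulacFst α (ξ u) w)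
      (D * ξ' + (dulacSnd α (ξ t) (a t) * ξ' - dulacFst α (ξ t) (a t) * a')) t := by
  have hs : 0 < 27 / 20 * α ^ 2 := by positivity
  have hξ1 : |ξ t| ≤ 1 := abs_le.2 ⟨hξt.1.le, hξt.2.le⟩
  have hw1 : ∀ w ∈ Icc (a t) (f (ξ t)), |w| ≤ 1 ∧ (ξ t ≠ 0 ∨ w ≠ 0) := fun w hw =>
    ⟨abs_le.2 ⟨hat.trans hw.1, hw.2.trans (hf.lt_one hs hξt).le⟩,
      h0.imp_right fun h => (h.trans_le hw.1).ne'⟩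
  have hpos : ∀ w ∈ Icc (a t) (f (ξ t)), 0 < dulacBase α (ξ t) w := fun w hw =>
    dulacBase_pos hα hα1 hξ1 (hw1 w hw).1 (hw1 w hw).2
  have hU : IsOpen {p : ℝ × ℝ | 0 < dulacBase α p.1 p.2} :=
    isOpen_lt continuous_const (continuous_dulacBase α)
  have hsec : ∀ {F : ℝ → ℝ → ℝ},
      ContinuousOn (fun p : ℝ × ℝ => F p.1 p.2) {p | 0 < dulacBase α p.1 p.2} →
      ContinuousOn (F (ξ t)) (Icc (a t) (f (ξ t))) := fun hF =>
    hF.comp (f := fun w => (ξ t, w)) (by fun_prop) hpos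
  have hc1 := hsec (continuousOn_dulacFstDeriv α)
  have hc2 := hsec (continuousOn_dulacSndDeriv α)
  rw [← uIcc_of_le hlt.le] at hc1 hc2
  have hd := hasDerivAt_integral_segment hU (continuousOn_dulacFst α)
    (continuousOn_dulacFstDeriv α) (fun p hp => hasDerivAt_dulacFst hp.ne') hξ ha
    ((hf.hasDerivAt _ hξt).comp t hξ) hlt.le hpos
  have hftc := intervalIntegral.integral_eq_sub_of_hasDerivAt (f := fun w => dulacSnd α (ξ t) w)
    (fun w hw => hasDerivAt_dulacSnd (hpos w (by rwa [uIcc_of_le hlt.le] at hw)).ne')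
    hc2.intervalIntegrable
  refine ⟨∫ w in a t..f (ξ t), (dulacFstDeriv α (ξ t) w + dulacSndDeriv α (ξ t) w), ?_, ?_⟩
  · refine intervalIntegral.intervalIntegral_pos_of_pos_on (hc1.add hc2).intervalIntegrable
      (fun w hw => ?_) hlt
    obtain ⟨h1, h2⟩ := hw1 w (Ioo_subset_Icc_self hw)
    exact dulac_div_pos hα hα1 hα2 hξ1 h1 h2
  · refine hd.congr_deriv ?_
    have hslope : dulacFst α (ξ t) (f (ξ t)) * orbitSlope (27 / 20 * α ^ 2) (ξ t) (f (ξ t)) =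
        dulacSnd α (ξ t) (f (ξ t)) := by
      have h1 := cube_sub_pos (hf.lt _ hξt)
      have h2 := hpos _ ⟨hlt.le, le_rfl⟩
      rw [dulacFst, dulacSnd, orbitSlope]
      field_simp
    rw [intervalIntegral.integral_add hc1.intervalIntegrable hc2.intervalIntegrable, hftc]
    simp only [Function.comp_apply]
    linear_combination ξ' * hslope

/-- The flux through the vertical segment between the diagonal and the profile. -/
theorem hasDerivAt_diagonal_flux (hα : 0 < α) (hα1 : α ≤ 1) (hα2 : 53 / 54 ≤ α ^ 2)
    (hf : IsProfile (27 / 20 * α ^ 2) f) {x : ℝ} (hx : x ∈ Ioo (-1 : ℝ) 1) (h0 : x ≠ 0) :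
    ∃ D > 0, HasDerivAt (fun u => ∫ w in u..f u, dulacFst α u w) (D + dulacSnd α x x) x := by
  obtain ⟨D, hD, h⟩ := hf.hasDerivAt_flux hα hα1 hα2 (hasDerivAt_id x) (hasDerivAt_id x) hx hx.1.le
    (hf.lt x hx) (Or.inl h0)
  refine ⟨D, hD, h.congr_deriv ?_⟩
  have : dulacFst α x x = 0 := by simp [dulacFst]
  simp only [id, this]
  ring

theorem diagonal_flux_mono (hα : 0 < α) (hα1 : α ≤ 1) (hα2 : 53 / 54 ≤ α ^ 2)
    (hf : IsProfile (27 / 20 * α ^ 2) f) :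
    MonotoneOn (fun u => ∫ w in u..f u, dulacFst α u w) (Ioo (-1) 0) := by
  have hI : ∀ x ∈ Ioo (-1 : ℝ) 0, x ∈ Ioo (-1 : ℝ) 1 := fun x hx => ⟨hx.1, by linarith [hx.2]⟩
  refine monotoneOn_of_deriv_nonneg (convex_Ioo _ _) (fun x hx => ?_) (fun x hx => ?_)
    fun x hx => ?_
  · obtain ⟨D, -, h⟩ := hf.hasDerivAt_diagonal_flux hα hα1 hα2 (hI x hx) hx.2.ne
    exact h.continuousAt.continuousWithinAt
  · rw [interior_Ioo] at hx
    obtain ⟨D, -, h⟩ := hf.hasDerivAt_diagonal_flux hα hα1 hα2 (hI x hx) hx.2.ne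
    exact h.differentiableAt.differentiableWithinAt
  · rw [interior_Ioo] at hx
    obtain ⟨D, hD, h⟩ := hf.hasDerivAt_diagonal_flux hα hα1 hα2 (hI x hx) hx.2.ne
    rw [h.deriv]
    have habs : |x| ≤ 1 := abs_le.2 ⟨hx.1.le, by linarith [hx.2]⟩
    have := dulacBase_pos hα hα1 habs habs (Or.inl hx.2.ne)
    have h4 : x ^ 4 ≤ 1 := by
      rw [← (show Even 4 by decide).neg_pow]
      exact pow_le_one₀ (by linarith [hx.2]) (by linarith [hx.1])
    have h5 : 0 ≤ x ^ 5 - x := by nlinarith [hx.2]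
    rw [dulacSnd]
    positivity

theorem diagonal_flux_lt_neg (hα : 0 < α) (hα1 : α ≤ 1) (hα2 : 53 / 54 ≤ α ^ 2)
    (hf : IsProfile (27 / 20 * α ^ 2) f) {q : ℝ} (hq : q ∈ Ioo (0 : ℝ) 1) :
    (∫ w in q..f q, dulacFst α q w) < ∫ w in -q..f (-q), dulacFst α (-q) w := by
  have hs : 0 < 27 / 20 * α ^ 2 := by positivity
  set G : ℝ → ℝ := fun u => ∫ w in u..f u, dulacFst α u w with hG
  have hd : ∀ x ∈ Ioo (0 : ℝ) 1, ∃ D > 0, HasDerivAt (fun u => G u - G (-u)) D x := by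
    intro x hx
    obtain ⟨D₁, h1, hd1⟩ := hf.hasDerivAt_diagonal_flux hα hα1 hα2
      ⟨by linarith [hx.1], hx.2⟩ hx.1.ne'
    obtain ⟨D₂, h2, hd2⟩ := hf.hasDerivAt_diagonal_flux hα hα1 hα2
      (x := -x) ⟨by linarith [hx.2], by linarith [hx.1, hx.2]⟩ (neg_ne_zero.2 hx.1.ne')
    refine ⟨D₁ + D₂, by positivity,
      (hd1.sub (hd2.scomp x (hasDerivAt_neg x))).congr_deriv ?_⟩
    rw [dulacSnd_neg, smul_eq_mul]
    ring
  have hm : StrictMonoOn (fun u => G u - G (-u)) (Ioo 0 1) := by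
    refine strictMonoOn_of_deriv_pos (convex_Ioo _ _) (fun x hx => ?_) fun x hx => ?_
    · obtain ⟨D, -, h⟩ := hd x hx
      exact h.continuousAt.continuousWithinAt
    · rw [interior_Ioo] at hx
      obtain ⟨D, hD, h⟩ := hd x hx
      rwa [h.deriv]
  have hnonneg : ∀ x ∈ Ioo (-1 : ℝ) 1, x ≠ 0 → 0 ≤ G x := by
    intro x hx hx0
    refine intervalIntegral.integral_nonneg (hf.lt x hx).le fun w hw => ?_
    have := dulacBase_pos hα hα1 (abs_le.2 ⟨hx.1.le, hx.2.le⟩)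
      (abs_le.2 ⟨hx.1.le.trans hw.1, hw.2.trans (hf.lt_one hs hx).le⟩) (Or.inl hx0)
    have h3 : 0 ≤ w ^ 3 - x ^ 3 := sub_nonneg.2
      ((Odd.strictMono_pow (by decide) : StrictMono fun z : ℝ => z ^ 3).monotone hw.1)
    rw [dulacFst]
    positivity
  have hlim : Tendsto G (nhdsWithin 1 (Iio 1)) (nhds 0) := by
    obtain ⟨C, hC⟩ := ((isCompact_Icc (a := (1 / 2 : ℝ)) (b := 1)).prod
      (isCompact_Icc (a := (1 / 2 : ℝ)) (b := 1))).exists_bound_of_continuousOn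
      ((continuousOn_dulacFst α).mono fun p hp => dulacBase_pos hα hα1
        (abs_le.2 ⟨by linarith [hp.1.1], hp.1.2⟩) (abs_le.2 ⟨by linarith [hp.2.1], hp.2.2⟩)
        (Or.inl (by linarith [hp.1.1] : (0 : ℝ) < p.1).ne'))
    have h0 : Tendsto (fun x => C * |f x - x|) (nhdsWithin 1 (Iio 1)) (nhds 0) := by
      have := ((hf.tendsto_right.sub (tendsto_id.mono_left nhdsWithin_le_nhds)).abs.const_mul C)
      simpa using this
    refine squeeze_zero_norm' ?_ h0
    filter_upwards [Ioo_mem_nhdsLT (by norm_num : (1 / 2 : ℝ) < 1)] with x hx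
    have hxI : x ∈ Ioo (-1 : ℝ) 1 := ⟨by linarith [hx.1], hx.2⟩
    refine intervalIntegral.norm_integral_le_of_norm_le_const fun w hw => ?_
    rw [uIoc_of_le (hf.lt x hxI).le] at hw
    exact hC (x, w) ⟨⟨hx.1.le, hx.2.le⟩, hx.1.le.trans hw.1.le,
      hw.2.trans (hf.lt_one hs hxI).le⟩
  obtain ⟨r, hqr, hr⟩ := exists_between hq.2
  have hr0 : r ∈ Ioo (0 : ℝ) 1 := ⟨hq.1.trans hqr, hr⟩
  have h1 : G q - G (-q) < G r - G (-r) := hm hq hr0 hqr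
  have h2 : G r - G (-r) ≤ 0 := by
    refine ge_of_tendsto hlim (Filter.eventually_of_mem (Ioo_mem_nhdsLT hr) fun x hx => ?_)
    have hx0 : x ∈ Ioo (0 : ℝ) 1 := ⟨hr0.1.trans hx.1, hx.2⟩
    have h3 : G r - G (-r) < G x - G (-x) := hm hr0 hx0 hx.1
    linarith [hnonneg (-x) ⟨by linarith [hx.2], by linarith [hx0.1, hx.2]⟩
      (neg_ne_zero.2 hx0.1.ne')]
  linarith

/-- No arc of an orbit below the profile starts on the diagonal at `-p` and ends at `q ≥ p`. -/
theorem no_arc (hα : 0 < α) (hα1 : α ≤ 1) (hα2 : 53 / 54 ≤ α ^ 2)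
    (hf : IsProfile (27 / 20 * α ^ 2) f) {x y : ℝ → ℝ}
    (h : IsScaledSolution (27 / 20 * α ^ 2) x y) {t₁ t₀ : ℝ} (ht : t₁ < t₀)
    (hlt : ∀ t ∈ Ioo t₁ t₀, x t < y t) (he₁ : y t₁ = x t₁) (he₀ : y t₀ = x t₀)
    (hbelow : ∀ t ∈ Icc t₁ t₀, y t < f (x t))
    (hx₁ : x t₁ ∈ Ioo (-1 : ℝ) 0) (hx₀ : x t₀ ∈ Ioo (0 : ℝ) 1) : x t₁ < -x t₀ := by
  have hs : 0 < 27 / 20 * α ^ 2 := by positivity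
  have hxm : StrictMonoOn x (Icc t₁ t₀) := by
    refine strictMonoOn_of_deriv_pos (convex_Icc _ _) h.continuous_fst.continuousOn fun t ht => ?_
    rw [interior_Icc] at ht
    rw [(h.1 t).deriv]
    exact mul_pos hs (cube_sub_pos (hlt t ht))
  have hle : ∀ t ∈ Icc t₁ t₀, x t ≤ y t := by
    intro t ht
    rcases ht.1.eq_or_lt with rfl | h1
    · exact he₁.ge
    rcases ht.2.eq_or_lt with rfl | h2
    · exact he₀.ge
    exact (hlt t ⟨h1, h2⟩).le
  set I : ℝ → ℝ := fun t => ∫ w in y t..f (x t), dulacFst α (x t) w with hI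
  have hd : ∀ t ∈ Icc t₁ t₀, ∃ D > 0, HasDerivAt I
      (D * (27 / 20 * α ^ 2 * (y t ^ 3 - x t ^ 3))) t := by
    intro t ht'
    have h1 : x t₁ ≤ x t := hxm.monotoneOn ⟨le_rfl, ht.le⟩ ht' ht'.1
    have h2 : x t ≤ x t₀ := hxm.monotoneOn ht' ⟨ht.le, le_rfl⟩ ht'.2
    have hxt : x t ∈ Ioo (-1 : ℝ) 1 := ⟨hx₁.1.trans_le h1, h2.trans_lt hx₀.2⟩
    obtain ⟨D, hD, hd⟩ := hf.hasDerivAt_flux hα hα1 hα2 (h.1 t) (h.2 t) hxt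
      (hxt.1.le.trans (hle t ht')) (hbelow t ht') (by
        by_contra! h0
        have h3 : t ∈ Ioo t₁ t₀ :=
          ⟨lt_of_le_of_ne ht'.1 (by rintro rfl; linarith [hx₁.2]),
            lt_of_le_of_ne ht'.2 (by rintro rfl; linarith [hx₀.1])⟩
        linarith [hlt t h3])
    refine ⟨D, hD, hd.congr_deriv ?_⟩
    rw [dulacFst, dulacSnd]
    ring
  have hIm : StrictMonoOn I (Icc t₁ t₀) := by
    refine strictMonoOn_of_deriv_pos (convex_Icc _ _) (fun t ht => ?_) fun t ht => ?_
    · obtain ⟨D, -, h⟩ := hd t ht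
      exact h.continuousAt.continuousWithinAt
    · rw [interior_Icc] at ht
      obtain ⟨D, hD, h⟩ := hd t (Ioo_subset_Icc_self ht)
      rw [h.deriv]
      exact mul_pos hD (mul_pos hs (cube_sub_pos (hlt t ht)))
  have h1 := hIm ⟨le_rfl, ht.le⟩ ⟨ht.le, le_rfl⟩ ht
  simp only [hI, he₁, he₀] at h1
  by_contra! hge
  have h2 := hf.diagonal_flux_mono hα hα1 hα2 ⟨by linarith [hx₀.2], by linarith [hx₀.1]⟩ hx₁ hge
  have h3 := hf.diagonal_flux_lt_neg hα hα1 hα2 hx₀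
  simp only at h2
  linarith

end IsProfile

theorem Function.Periodic.exists_le_eq {α : Type*} {g : ℝ → α} {T : ℝ} (hg : Function.Periodic g T)
    (hT : 0 < T) (a t : ℝ) : ∃ u ≤ a, g u = g t := by
  obtain ⟨n, hn⟩ := exists_nat_ge ((t - a) / T)
  exact ⟨t - n * T, by linarith [(div_le_iff₀ hT).1 hn], hg.sub_nat_mul_eq n⟩

theorem Function.Periodic.exists_ge_eq {α : Type*} {g : ℝ → α} {T : ℝ} (hg : Function.Periodic g T)
    (hT : 0 < T) (a t : ℝ) : ∃ u ≥ a, g u = g t := by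
  obtain ⟨n, hn⟩ := exists_nat_ge ((a - t) / T)
  exact ⟨t + n * T, by linarith [(div_le_iff₀ hT).1 hn], hg.nat_mul n t⟩

namespace IsScaledSolution

variable {s T : ℝ} {x y : ℝ → ℝ}

theorem le_one_of_periodic (h : IsScaledSolution s x y) (hs : 0 < s) (hT : 0 < T)
    (hx : Function.Periodic x T) (hy : Function.Periodic y T) {t₀ : ℝ} (he : y t₀ = x t₀) :
    x t₀ ≤ 1 := by
  by_contra! h0
  have hpow : ∀ z : ℝ, 1 < z → z < z ^ 5 := fun z hz => lt_self_pow₀ hz (by norm_num)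
  have hinv := forward_invariant (t₀ := t₀) (fun t => (h.1 t).sub_const 1) h.hasDerivAt_sub
    (by linarith) (by linarith)
    (fun t _ _ h2 => mul_nonneg hs.le (sub_nonneg.2
      ((Odd.strictMono_pow (by decide) : StrictMono fun z : ℝ => z ^ 3).monotone
        (by linarith : x t ≤ y t))))
    (fun t _ h2 h3 => by
      have h4 := hpow (x t) (by linarith)
      rw [show y t = x t by linarith]
      linarith)
  have hmin : IsLocalMin (fun t => y t - x t) t₀ := Filter.Eventually.of_forall fun t => by
    obtain ⟨u, hu, hut⟩ := (hy.sub hx).exists_ge_eq hT t₀ t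
    have h1 := (hinv u hu).2
    simp only [Pi.sub_apply] at hut
    linarith
  have h1 := hmin.hasDerivAt_eq_zero (h.hasDerivAt_sub t₀)
  rw [he] at h1
  linarith [hpow _ h0]

end IsScaledSolution

namespace IsConnection

variable {s T : ℝ} {X Y x y : ℝ → ℝ}

theorem not_exists_maximal_crossing (hc : IsConnection s X Y) (hs : s ∈ Ioo (53 / 40 : ℝ) (27 / 20))
    (h : IsScaledSolution s x y) (hT : 0 < T) (hx : Function.Periodic x T)
    (hy : Function.Periodic y T) (hne : ∀ t, y t = x t → x t ^ 5 ≠ x t) {t₀ : ℝ}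
    (he₀ : y t₀ = x t₀) (hpos : 0 < x t₀) (hmax : ∀ t, y t = x t → |x t| ≤ x t₀) : False := by
  have hs0 : 0 < s := by linarith [hs.1]
  obtain ⟨f, hf, hfX, hrange⟩ := hc.exists_profile hs0
  have hlt1 : x t₀ < 1 := (h.le_one_of_periodic hs0 hT hx hy he₀).lt_of_ne fun h1 =>
    hne t₀ he₀ (by rw [h1, one_pow])
  have hcd : Continuous fun t => y t - x t := h.continuous_snd.sub h.continuous_fst
  obtain ⟨a, ha, hbefore⟩ : ∃ a < t₀, ∀ t ∈ Ioo a t₀, 0 < y t - x t := by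
    have h1 := h.hasDerivAt_sub t₀
    rw [he₀] at h1
    have h2 : x t₀ ^ 5 - x t₀ - s * (x t₀ ^ 3 - x t₀ ^ 3) < 0 := by
      linarith [pow_lt_self_of_lt_one₀ hpos hlt1 (by norm_num : 1 < 5)]
    have h3 := ((hasDerivWithinAt_iff_tendsto_slope' (s := Iio t₀) (by simp)).1
      h1.hasDerivWithinAt).eventually (gt_mem_nhds h2)
    obtain ⟨a, ha, hsub⟩ := (mem_nhdsLT_iff_exists_Ioo_subset).1 h3
    refine ⟨a, ha, fun t ht => ?_⟩
    have h4 : slope (fun t => y t - x t) t₀ t < 0 := hsub ht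
    rw [slope_def_field, he₀, sub_self, sub_zero] at h4
    by_contra! h5
    exact absurd h4 (not_lt.2 (div_nonneg_of_nonpos h5 (by linarith [ht.2])))
  have hZ : IsClosed {t | t ≤ a ∧ y t - x t = 0} :=
    (isClosed_le continuous_id continuous_const).inter (isClosed_eq hcd continuous_const)
  have hZne : {t | t ≤ a ∧ y t - x t = 0}.Nonempty := by
    obtain ⟨u, hu, hut⟩ := (hy.sub hx).exists_le_eq hT a t₀
    exact ⟨u, hu, hut.trans (sub_eq_zero.2 he₀)⟩
  have hZb : BddAbove {t | t ≤ a ∧ y t - x t = 0} := ⟨a, fun t ht => ht.1⟩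
  set t₁ := sSup {t | t ≤ a ∧ y t - x t = 0}
  obtain ⟨ht₁a, hd₁⟩ : t₁ ≤ a ∧ y t₁ - x t₁ = 0 := hZ.csSup_mem hZne hZb
  have he₁ := sub_eq_zero.1 hd₁
  have ht : t₁ < t₀ := ht₁a.trans_lt ha
  have hnz : ∀ t ∈ Ioo t₁ t₀, y t - x t ≠ 0 := fun t ht h0 => by
    rcases le_or_gt t a with h1 | h1
    · exact absurd (le_csSup hZb ⟨h1, h0⟩) (not_le.2 ht.1)
    · exact (hbefore t ⟨h1, ht.2⟩).ne' h0
  have hd : ∀ t ∈ Ioo t₁ t₀, 0 < y t - x t := by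
    intro t ht
    by_contra! h0
    obtain ⟨v, hv1, hv2⟩ := exists_between (max_lt ha ht.2)
    obtain ⟨hva, hvt⟩ := max_lt_iff.1 hv1
    obtain ⟨w, hw, hw0⟩ := intermediate_value_Icc hvt.le hcd.continuousOn
      ⟨h0, (hbefore v ⟨hva, hv2⟩).le⟩
    exact hnz w ⟨ht.1.trans_le hw.1, hw.2.trans_lt hv2⟩ hw0
  obtain ⟨hc1, hc2⟩ := abs_le.1 (hmax t₁ he₁)
  have hx₁ : x t₁ ∈ Ioo (-1 : ℝ) 0 := by
    refine ⟨by linarith, ?_⟩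
    have h1 := (h.hasDerivAt_sub t₁).nonneg_of_pos_right ht hd hd₁
    rw [he₁] at h1
    by_contra! h2
    rcases h2.eq_or_lt with h3 | h3
    · exact hne t₁ he₁ (by rw [← h3]; norm_num)
    · linarith [pow_lt_self_of_lt_one₀ h3 (hc2.trans_lt hlt1) (by norm_num : 1 < 5)]
  have hxm : MonotoneOn x (Icc t₁ t₀) := by
    refine monotoneOn_of_deriv_nonneg (convex_Icc _ _) h.continuous_fst.continuousOn
      (fun t _ => (h.1 t).differentiableAt.differentiableWithinAt) fun t ht => ?_
    rw [interior_Icc] at ht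
    rw [(h.1 t).deriv]
    exact (mul_pos hs0 (cube_sub_pos (sub_pos.1 (hd t ht)))).le
  have hxI : ∀ t ∈ Icc t₁ t₀, x t ∈ Ioo (-1 : ℝ) 1 := fun t ht' =>
    ⟨hx₁.1.trans_le (hxm ⟨le_rfl, ht.le⟩ ht' ht'.1),
      (hxm ht' ⟨ht.le, le_rfl⟩ ht'.2).trans_lt hlt1⟩
  have hmiss : ∀ t ∈ Icc t₁ t₀, f (x t) - y t ≠ 0 := by
    intro t ht' h0
    obtain ⟨u, hu⟩ : x t ∈ range X := hrange ▸ hxI t ht'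
    have hu' : Y u = y t := by rw [← hfX, hu]; linarith
    have h1 := hc.toIsScaledSolution.eq_of_eq (h.comp_add_const (t - u)) (t₀ := u)
      (by rw [hu, add_sub_cancel]) (by rw [hu', add_sub_cancel])
    refine hc.not_periodic hT fun v => ?_
    rw [(h1 _).1, (h1 v).1, add_right_comm, hx]
  have hbelow : ∀ t ∈ Icc t₁ t₀, y t < f (x t) := by
    intro t ht'
    by_contra! h0
    have hcont : ContinuousOn (fun t => f (x t) - y t) (Icc t₁ t₀) :=
      (hf.continuousOn.comp h.continuous_fst.continuousOn hxI).sub h.continuous_snd.continuousOn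
    obtain ⟨w, hw, hw0⟩ := intermediate_value_Icc' ht'.1
      (hcont.mono (Icc_subset_Icc_right ht'.2)) (show (0 : ℝ) ∈ _ from
        ⟨sub_nonpos.2 h0, by rw [he₁]; exact (sub_pos.2 (hf.lt _ (hxI _ ⟨le_rfl, ht.le⟩))).le⟩)
    exact hmiss w ⟨hw.1, hw.2.trans ht'.2⟩ hw0
  have hα : s = 27 / 20 * √(20 / 27 * s) ^ 2 := by
    rw [Real.sq_sqrt (by positivity)]
    ring
  have hα2 : √(20 / 27 * s) ^ 2 = 20 / 27 * s := Real.sq_sqrt (by positivity)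
  have := IsProfile.no_arc (α := √(20 / 27 * s)) (Real.sqrt_pos.2 (by positivity))
    (Real.sqrt_le_one.2 (by linarith [hs.2])) (by rw [hα2]; linarith [hs.1]) (hα ▸ hf)
    (hα ▸ h) ht (fun t ht => sub_pos.1 (hd t ht)) he₁ he₀ hbelow hx₁ ⟨hpos, hlt1⟩
  linarith

/-- In the presence of a connection, every periodic solution is stationary. -/
theorem exists_equilibrium_of_periodic (hc : IsConnection s X Y)
    (hs : s ∈ Ioo (53 / 40 : ℝ) (27 / 20)) (h : IsScaledSolution s x y) (hT : 0 < T)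
    (hx : Function.Periodic x T) (hy : Function.Periodic y T) :
    ∃ t, y t = x t ∧ x t ^ 5 = x t := by
  by_contra! hne
  have hs0 : 0 < s := by linarith [hs.1]
  have hp : Function.Periodic (fun t => (x t, y t)) T := fun t => Prod.ext (hx t) (hy t)
  have hK : IsCompact {t | t ∈ Icc 0 T ∧ y t = x t} :=
    isCompact_Icc.inter_right (isClosed_eq h.continuous_snd h.continuous_fst)
  have hKne : {t | t ∈ Icc 0 T ∧ y t = x t}.Nonempty := by
    obtain ⟨t, ht, h0⟩ := exists_hasDerivAt_eq_zero hT h.continuous_fst.continuousOn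
      (by simpa using (hx 0).symm) fun t _ => h.1 t
    exact ⟨t, Ioo_subset_Icc_self ht, (Odd.strictMono_pow (by decide) :
      StrictMono fun z : ℝ => z ^ 3).injective
        (sub_eq_zero.1 ((mul_eq_zero.1 h0).resolve_left hs0.ne'))⟩
  obtain ⟨t₀, ⟨-, he₀⟩, hmax⟩ := hK.exists_isMaxOn hKne h.continuous_fst.abs.continuousOn
  have hmax : ∀ t, y t = x t → |x t| ≤ |x t₀| := by
    intro t ht
    obtain ⟨u, hu, hut⟩ := hp.exists_mem_Ico₀ hT t
    obtain ⟨hu1, hu2⟩ := Prod.ext_iff.1 hut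
    simp only at hu1 hu2
    rw [hu1]
    exact hmax ⟨Ico_subset_Icc_self hu, by rw [← hu1, ← hu2, ht]⟩
  rcases lt_trichotomy (x t₀) 0 with h0 | h0 | h0
  · refine hc.not_exists_maximal_crossing hs h.neg hT (fun t => congrArg _ (hx t))
      (fun t => congrArg _ (hy t)) (fun t ht h5 => ?_)
      (t₀ := t₀) (by rw [he₀]) (by linarith) fun t ht => ?_
    · exact hne t (neg_injective ht) (by rw [Odd.neg_pow (by decide)] at h5; exact neg_injective h5)
    · rw [abs_neg, ← abs_of_neg h0]
      exact hmax t (neg_injective ht)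
  · exact hne t₀ he₀ (by rw [h0]; norm_num)
  · exact hc.not_exists_maximal_crossing hs h hT hx hy hne he₀ h0 fun t ht => by
      rw [← abs_of_pos h0]
      exact hmax t ht

end IsConnection

theorem IsHeteroclinic.isConnection {m : ℝ} (hm : 0 < m) {γ : ℝ → ℝ × ℝ}
    (h : IsHeteroclinic m γ) :
    IsConnection ((m ^ (-(1 : ℝ) / 4)) ^ 2) (fun t => (γ t).1 / m ^ (-(1 : ℝ) / 4))
      fun t => (γ t).2 / m ^ (-(1 : ℝ) / 4) := by
  obtain ⟨h1, hbot, htop⟩ := h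
  have ha : m ^ (-(1 : ℝ) / 4) ≠ 0 := (Real.rpow_pos_of_pos hm _).ne'
  have key : ∀ {l : Filter ℝ} {g : ℝ → ℝ} {z w : ℝ}, Tendsto g l (nhds z) →
      z / m ^ (-(1 : ℝ) / 4) = w → Tendsto (fun t => g t / m ^ (-(1 : ℝ) / 4)) l (nhds w) :=
    fun hg hz => hz ▸ hg.div_const _
  refine ⟨h1.isScaledSolution ha (mul_rpow_neg_quarter_pow hm), key hbot.fst_nhds ?_,
    key hbot.snd_nhds ?_, key htop.fst_nhds ?_, key htop.snd_nhds ?_⟩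
  · exact (neg_div _ _).trans (congrArg _ (div_self ha))
  · exact (neg_div _ _).trans (congrArg _ (div_self ha))
  · exact div_self ha
  · exact div_self ha

theorem IsHeteroclinic.eq_of_isHeteroclinic {m m' : ℝ} (hm : 0 < m) (hm' : 0 < m')
    {γ γ' : ℝ → ℝ × ℝ} (h : IsHeteroclinic m γ) (h' : IsHeteroclinic m' γ') : m = m' := by
  have hs := pow_pos (Real.rpow_pos_of_pos hm (-(1 : ℝ) / 4)) 2
  have hs' := pow_pos (Real.rpow_pos_of_pos hm' (-(1 : ℝ) / 4)) 2
  obtain ⟨f, hf, -⟩ := (h.isConnection hm).exists_profile hs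
  obtain ⟨g, hg, -⟩ := (h'.isConnection hm').exists_profile hs'
  have heq := IsProfile.param_unique hs hs' hf hg
  have h1 := mul_rpow_neg_quarter_pow hm
  have h2 := mul_rpow_neg_quarter_pow hm'
  rw [show 4 = 2 * 2 from rfl, pow_mul] at h1 h2
  rw [← heq] at h2
  exact mul_right_cancel₀ (pow_pos hs 2).ne' (h1.trans h2.symm)

theorem IsHeteroclinic.scale_mem {m : ℝ} (hm : 0 < m) {γ : ℝ → ℝ × ℝ}
    (h : IsHeteroclinic m γ) : (m ^ (-(1 : ℝ) / 4)) ^ 2 ∈ Ioo (53 / 40 : ℝ) (27 / 20) := by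
  have hs := pow_pos (Real.rpow_pos_of_pos hm (-(1 : ℝ) / 4)) 2
  obtain ⟨f, hf, -⟩ := (h.isConnection hm).exists_profile hs
  exact hf.param_mem hs

theorem IsHeteroclinic.mem_Ioo {m : ℝ} (hm : 0 < m) {γ : ℝ → ℝ × ℝ}
    (h : IsHeteroclinic m γ) : m ∈ Ioo (0.547 : ℝ) 0.6 := by
  obtain ⟨h1, h2⟩ := h.scale_mem hm
  have h3 := mul_rpow_neg_quarter_pow hm
  rw [show 4 = 2 * 2 from rfl, pow_mul] at h3
  set s := (m ^ (-(1 : ℝ) / 4)) ^ 2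
  have h4 : (53 / 40 : ℝ) ^ 2 < s ^ 2 := by gcongr
  have h5 : s ^ 2 < (27 / 20) ^ 2 := by gcongr
  constructor <;> nlinarith

theorem IsHeteroclinic.not_isPeriodicOrbit {m T : ℝ} (hm : 0 < m) {γ₀ γ : ℝ → ℝ × ℝ}
    (h₀ : IsHeteroclinic m γ₀) : ¬ IsPeriodicOrbit m γ T := by
  rintro ⟨h, hconst, hT, hp⟩
  have ha : m ^ (-(1 : ℝ) / 4) ≠ 0 := (Real.rpow_pos_of_pos hm _).ne'
  have hsol := h.isScaledSolution ha (mul_rpow_neg_quarter_pow hm)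
  obtain ⟨t, h1, h2⟩ := (h₀.isConnection hm).exists_equilibrium_of_periodic (h₀.scale_mem hm) hsol
    hT (fun t => by simp only [hp t]) fun t => by simp only [hp t]
  refine hconst ⟨((γ t).1, (γ t).1), fun u => ?_⟩
  obtain ⟨h3, h4⟩ := hsol.eq_const h1 h2 u
  exact Prod.ext ((div_left_inj' ha).1 h3) ((div_left_inj' ha).1 h4)

theorem bacciotti_heteroclinic_set :
    let M : Set ℝ := {m : ℝ | 0 < m ∧ ∃ γ : ℝ → ℝ × ℝ, IsHeteroclinic m γ}
    M.Nonempty ∧ M.Finite ∧ M ⊆ Set.Ioo 0.547 0.6 ∧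
      ∀ m ∈ M, ¬ ∃ (γ : ℝ → ℝ × ℝ) (T : ℝ), IsPeriodicOrbit m γ T := by
  refine ⟨exists_heteroclinic, Set.Subsingleton.finite ?_, ?_, ?_⟩
  · rintro m ⟨hm, γ, h⟩ m' ⟨hm', γ', h'⟩
    exact h.eq_of_isHeteroclinic hm hm' h'
  · rintro m ⟨hm, γ, h⟩
    exact h.mem_Ioo hm
  · rintro m ⟨hm, γ₀, h₀⟩ ⟨γ, T, h⟩
    exact h₀.not_isPeriodicOrbit hm h

end
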